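/- arXiv:math/0305072 — 5 statements merged into one kernel-verified Lean document; each statement's English description precedes it below -/
import Mathlib

section
/- Let n ≥ 3, ν > n/2 − 1, 1 ≤ p < ∞ and 1 ≤ q < ∞. If q ≤ (q̃_{ν,p})' or q ≥ q̃_{ν,p} (where (q̃_{ν,p})' is the conjugate exponent of q̃_{ν,p}, interpreted as 1 when q̃_{ν,p} = ∞), then there is no constant C > 0 such that ‖T_ν F‖_{L^{p,q}_ν} ≤ C·‖F‖_{L^{p,q}_ν} holds for all F ∈ L²_ν with ‖F‖_{L^{p,q}_ν} < ∞. -/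
open MeasureTheory Complex Set
open scoped ENNReal NNReal

noncomputable section

def lorentzQ (n : ℕ) [NeZero n] (y : Fin n → ℝ) : ℝ :=
  y 0 ^ 2 - ∑ k ∈ Finset.univ.filter (fun k => k ≠ 0), y k ^ 2

def lorentzQC (n : ℕ) [NeZero n] (z : Fin n → ℂ) : ℂ :=
  z 0 ^ 2 - ∑ k ∈ Finset.univ.filter (fun k => k ≠ 0), z k ^ 2

def lightCone (n : ℕ) [NeZero n] : Set (Fin n → ℝ) :=
  {y | 0 < y 0 ∧ 0 < lorentzQ n y}

def tubePt (n : ℕ) (x y : Fin n → ℝ) : Fin n → ℂ :=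
  fun k => (x k : ℂ) + (y k : ℂ) * Complex.I

def inTube (n : ℕ) [NeZero n] (z : Fin n → ℂ) : Prop :=
  (fun k => (z k).im) ∈ lightCone n

def eVec (n : ℕ) [NeZero n] : Fin n → ℝ := fun k => if k = 0 then 1 else 0

def mixedNorm (n : ℕ) [NeZero n] (p q ν : ℝ) (F : (Fin n → ℂ) → ℂ) : ℝ≥0∞ :=
  (∫⁻ y in lightCone n,
      (∫⁻ x : Fin n → ℝ, (‖F (tubePt n x y)‖₊ : ℝ≥0∞) ^ p) ^ (q / p)
        * ENNReal.ofReal (lorentzQ n y ^ (ν - (n : ℝ) / 2))) ^ (1 / q)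

def bergmanIntegrand (n : ℕ) [NeZero n] (ν : ℝ) (F : (Fin n → ℂ) → ℂ) (z : Fin n → ℂ)
    (uv : (Fin n → ℝ) × (Fin n → ℝ)) : ℂ :=
  lorentzQC n (fun k => (z k - ((uv.1 k : ℂ) - (uv.2 k : ℂ) * Complex.I)) / Complex.I)
      ^ (((-(ν + (n : ℝ) / 2) : ℝ)) : ℂ)
    * F (tubePt n uv.1 uv.2)
    * ((lorentzQ n uv.2 ^ (ν - (n : ℝ) / 2) : ℝ) : ℂ)

def bergmanOp (n : ℕ) [NeZero n] (ν : ℝ) (F : (Fin n → ℂ) → ℂ) (z : Fin n → ℂ) : ℂ :=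
  ∫ uv in (univ ×ˢ lightCone n : Set ((Fin n → ℝ) × (Fin n → ℝ))),
    bergmanIntegrand n ν F z uv

def qnu (n : ℕ) (ν : ℝ) : ℝ := (ν + (n : ℝ) / 2 - 1) / ((n : ℝ) / 2 - 1)

def pSharp (p : ℝ) : ℝ := if p ≤ 2 then p else p / (p - 1)

def qtilde (n : ℕ) (ν p : ℝ) : ℝ≥0∞ :=
  if 1 < (n : ℝ) / 2 * (1 - 1 / p) then
    ENNReal.ofReal ((ν + (n : ℝ) / 2 - 1) / ((n : ℝ) / 2 * (1 - 1 / p) - 1))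
  else ∞

/-- The conjugate exponent of `q̃_{ν,p}`, interpreted as `1` when `q̃_{ν,p} = ∞`. -/
def qtildeConj (n : ℕ) (ν p : ℝ) : ℝ :=
  if 1 < (n : ℝ) / 2 * (1 - 1 / p) then
    ((ν + (n : ℝ) / 2 - 1) / ((n : ℝ) / 2 * (1 - 1 / p) - 1)) /
      ((ν + (n : ℝ) / 2 - 1) / ((n : ℝ) / 2 * (1 - 1 / p) - 1) - 1)
  else 1

namespace LightCone

variable {m : ℕ}

/-- The null coordinate `y₁ + y₂`. -/
def nullA (y : Fin (m + 2) → ℝ) : ℝ := y 0 + y 1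

/-- The null coordinate `y₁ - y₂`. -/
def nullB (y : Fin (m + 2) → ℝ) : ℝ := y 0 - y 1

/-- The coordinates transverse to the first two. -/
def nullT (y : Fin (m + 2) → ℝ) : Fin m → ℝ := fun i => y i.succ.succ

/-- The transverse coordinates after the null rotation with parameter `θ`. -/
def tiltT (θ : Fin m → ℝ) (y : Fin (m + 2) → ℝ) : Fin m → ℝ :=
  fun i => nullT y i - nullA y * θ i

/-- The coordinate `nullB` after the null rotation with parameter `θ`. -/
def tiltB (θ : Fin m → ℝ) (y : Fin (m + 2) → ℝ) : ℝ :=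
  nullB y - ∑ i, θ i * (2 * nullT y i - nullA y * θ i)

/-- Twice the polarization of the Lorentz form. -/
def lorentzPolar (y w : Fin (m + 2) → ℝ) : ℝ :=
  nullA y * nullB w + nullA w * nullB y - 2 * ∑ i, nullT y i * nullT w i

lemma sum_filter_ne_zero {M : Type*} [AddCommMonoid M] (f : Fin (m + 2) → M) :
    ∑ k ∈ Finset.univ.filter (fun k => k ≠ 0), f k = f 1 + ∑ i : Fin m, f i.succ.succ := by
  rw [Finset.sum_filter, Fin.sum_univ_succ, Fin.sum_univ_succ]
  simp

lemma lorentzQ_eq (y : Fin (m + 2) → ℝ) :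
    lorentzQ (m + 2) y = nullA y * nullB y - ∑ i, nullT y i ^ 2 := by
  rw [lorentzQ, sum_filter_ne_zero, nullA, nullB]
  simp only [nullT]
  ring

lemma lorentzQ_eq_tilt (θ : Fin m → ℝ) (y : Fin (m + 2) → ℝ) :
    lorentzQ (m + 2) y = nullA y * tiltB θ y - ∑ i, tiltT θ y i ^ 2 := by
  have h : ∑ i, nullT y i ^ 2 =
      nullA y * ∑ i, θ i * (2 * nullT y i - nullA y * θ i) + ∑ i, tiltT θ y i ^ 2 := by
    rw [Finset.mul_sum, ← Finset.sum_add_distrib]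
    refine Finset.sum_congr rfl fun i _ => ?_
    simp only [tiltT]
    ring
  rw [lorentzQ_eq, h, tiltB]
  ring

lemma lorentzPolar_eq_tilt (θ : Fin m → ℝ) (y w : Fin (m + 2) → ℝ) :
    lorentzPolar y w = nullA y * tiltB θ w + nullA w * tiltB θ y
      - 2 * ∑ i, tiltT θ y i * tiltT θ w i := by
  have h : 2 * ∑ i, nullT y i * nullT w i =
      nullA y * ∑ i, θ i * (2 * nullT w i - nullA w * θ i)
        + nullA w * ∑ i, θ i * (2 * nullT y i - nullA y * θ i)
        + 2 * ∑ i, tiltT θ y i * tiltT θ w i := by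
    simp only [Finset.mul_sum]
    rw [← Finset.sum_add_distrib, ← Finset.sum_add_distrib]
    refine Finset.sum_congr rfl fun i _ => ?_
    simp only [tiltT]
    ring
  rw [lorentzPolar, h, tiltB, tiltB]
  ring

lemma nullA_add (y w : Fin (m + 2) → ℝ) : nullA (y + w) = nullA y + nullA w := by
  simp only [nullA, Pi.add_apply]; ring

lemma nullB_add (y w : Fin (m + 2) → ℝ) : nullB (y + w) = nullB y + nullB w := by
  simp only [nullB, Pi.add_apply]; ring

lemma nullT_add (y w : Fin (m + 2) → ℝ) (i : Fin m) :
    nullT (y + w) i = nullT y i + nullT w i := rfl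

lemma tiltT_add (θ : Fin m → ℝ) (y w : Fin (m + 2) → ℝ) (i : Fin m) :
    tiltT θ (y + w) i = tiltT θ y i + tiltT θ w i := by
  simp only [tiltT, nullA_add, nullT_add]; ring

lemma tiltB_add (θ : Fin m → ℝ) (y w : Fin (m + 2) → ℝ) :
    tiltB θ (y + w) = tiltB θ y + tiltB θ w := by
  have h : ∑ i, θ i * (2 * nullT (y + w) i - nullA (y + w) * θ i) =
      ∑ i, θ i * (2 * nullT y i - nullA y * θ i) + ∑ i, θ i * (2 * nullT w i - nullA w * θ i) := by
    rw [← Finset.sum_add_distrib]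
    refine Finset.sum_congr rfl fun i _ => ?_
    rw [nullA_add, nullT_add]
    ring
  rw [tiltB, tiltB, tiltB, h, nullB_add]
  ring

lemma nullA_neg (y : Fin (m + 2) → ℝ) : nullA (-y) = -nullA y := by
  simp only [nullA, Pi.neg_apply]; ring

lemma tiltT_neg (θ : Fin m → ℝ) (y : Fin (m + 2) → ℝ) (i : Fin m) :
    tiltT θ (-y) i = -tiltT θ y i := by
  simp only [tiltT, nullA_neg, nullT, Pi.neg_apply]; ring

lemma tiltB_neg (θ : Fin m → ℝ) (y : Fin (m + 2) → ℝ) : tiltB θ (-y) = -tiltB θ y := by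
  have h : tiltB θ (-y + y) = tiltB θ (-y) + tiltB θ y := tiltB_add θ _ _
  have h0 : tiltB θ (-y + y) = 0 := by
    simp [tiltB, nullB, nullA, nullT]
  linarith

/-- The value at which the kernel of `bergmanOp` takes its power. -/
lemma lorentzQC_kernel_arg (x y u v : Fin (m + 2) → ℝ) :
    lorentzQC (m + 2) (fun k => (tubePt (m + 2) x y k - ((u k : ℂ) - (v k : ℂ) * I)) / I) =
      ((lorentzQ (m + 2) (y + v) - lorentzQ (m + 2) (x - u) : ℝ) : ℂ)
        - (lorentzPolar (y + v) (x - u) : ℂ) * I := by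
  have hk : ∀ k, (tubePt (m + 2) x y k - ((u k : ℂ) - (v k : ℂ) * I)) / I =
      ((y + v) k : ℂ) - ((x - u) k : ℂ) * I := by
    intro k
    rw [div_eq_iff I_ne_zero]
    simp only [tubePt, Pi.add_apply, Pi.sub_apply, ofReal_add, ofReal_sub]
    linear_combination (x k - u k : ℂ) * I_mul_I
  simp only [hk]
  generalize y + v = p
  generalize x - u = r
  rw [lorentzQC, sum_filter_ne_zero, lorentzQ_eq, lorentzQ_eq, lorentzPolar]
  have hs : ∑ i : Fin m, ((p i.succ.succ : ℂ) - (r i.succ.succ : ℂ) * I) ^ 2 =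
      ((∑ i, nullT p i ^ 2 : ℝ) : ℂ) - ((∑ i, nullT r i ^ 2 : ℝ) : ℂ)
        - 2 * ((∑ i, nullT p i * nullT r i : ℝ) : ℂ) * I := by
    push_cast
    rw [Finset.mul_sum, Finset.sum_mul, ← Finset.sum_sub_distrib, ← Finset.sum_sub_distrib]
    refine Finset.sum_congr rfl fun i _ => ?_
    simp only [nullT]
    linear_combination ((r i.succ.succ : ℂ)) ^ 2 * I_sq
  rw [hs]
  simp only [nullA, nullB]
  push_cast
  linear_combination ((r 0 : ℂ) ^ 2 - (r 1 : ℂ) ^ 2) * I_sq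

/-- The box of dimensions `R × √R × ⋯ × √R × 1` adapted to the null direction `θ`. -/
def plate (R : ℝ) (θ : Fin m → ℝ) (c : ℝ) : Set (Fin (m + 2) → ℝ) :=
  {u | |nullA u| ≤ c * R ∧ (∀ i, |tiltT θ u i| ≤ c * √R) ∧ |tiltB θ u| ≤ c}

lemma plate_add {R c d : ℝ} {θ : Fin m → ℝ} {x u : Fin (m + 2) → ℝ} (hx : x ∈ plate R θ c)
    (hu : u ∈ plate R θ d) : x + u ∈ plate R θ (c + d) := by
  refine ⟨?_, fun i => ?_, ?_⟩
  · rw [nullA_add, add_mul]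
    exact (abs_add_le _ _).trans (add_le_add hx.1 hu.1)
  · rw [tiltT_add, add_mul]
    exact (abs_add_le _ _).trans (add_le_add (hx.2.1 i) (hu.2.1 i))
  · rw [tiltB_add]
    exact (abs_add_le _ _).trans (add_le_add hx.2.2 hu.2.2)

lemma plate_neg {R c : ℝ} {θ : Fin m → ℝ} {u : Fin (m + 2) → ℝ} (hu : u ∈ plate R θ c) :
    -u ∈ plate R θ c := by
  simpa [plate, nullA_neg, tiltT_neg, tiltB_neg] using hu

lemma plate_sub_half {R c : ℝ} {θ : Fin m → ℝ} {x u : Fin (m + 2) → ℝ}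
    (hx : x ∈ plate R θ (c / 2)) (hu : u ∈ plate R θ (c / 2)) : x - u ∈ plate R θ c := by
  rw [sub_eq_add_neg, ← add_halves c]
  exact plate_add hx (plate_neg hu)

/-- A small box is contained in all plates of unit thickness. -/
lemma plate_subset {R c : ℝ} (hR : 1 ≤ R) (hc : 0 < c) {θ : Fin m → ℝ}
    (hθ : ∀ i, θ i ∈ Icc (0 : ℝ) 1) :
    plate 1 (0 : Fin m → ℝ) (c / (3 * m + 2)) ⊆ plate R θ c := by
  intro u hu
  set d := c / (3 * m + 2) with hd
  have hm : (0 : ℝ) ≤ m := Nat.cast_nonneg m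
  have hdc : (3 * m + 2) * d = c := by rw [hd]; field_simp
  have hd0 : 0 < d := by positivity
  obtain ⟨hA, hT, hB⟩ := hu
  simp only [tiltT, tiltB, Pi.zero_apply, mul_zero, sub_zero, zero_mul, Finset.sum_const_zero,
    Real.sqrt_one, mul_one] at hA hT hB
  have hsR : 1 ≤ √R := Real.one_le_sqrt.2 hR
  have h2 : ∀ i, |nullA u * θ i| ≤ d := fun i => by
    rw [abs_mul, abs_of_nonneg (hθ i).1]
    nlinarith [(hθ i).1, (hθ i).2, abs_nonneg (nullA u)]
  have hmd : 0 ≤ m * d := by positivity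
  refine ⟨?_, fun i => ?_, ?_⟩
  · nlinarith
  · have := abs_sub (nullT u i) (nullA u * θ i)
    simp only [tiltT]
    nlinarith [hT i, h2 i]
  · have h3 : |∑ i, θ i * (2 * nullT u i - nullA u * θ i)| ≤ m * (3 * d) := by
      refine (Finset.abs_sum_le_sum_abs _ _).trans ?_
      refine (Finset.sum_le_card_nsmul _ _ (3 * d) fun i _ => ?_).trans (by simp)
      rw [abs_mul, abs_of_nonneg (hθ i).1]
      have h4 : |2 * nullT u i - nullA u * θ i| ≤ 3 * d := by
        have h5 := abs_le.1 (hT i)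
        have h6 := abs_le.1 (h2 i)
        rw [abs_le]; constructor <;> linarith [h5.1, h5.2, h6.1, h6.2]
      nlinarith [(hθ i).1, (hθ i).2, abs_nonneg (2 * nullT u i - nullA u * θ i)]
    have := abs_sub (nullB u) (∑ i, θ i * (2 * nullT u i - nullA u * θ i))
    simp only [tiltB]
    linarith

/-- The argument of the kernel stays in a thin sector when the displacement lies in a plate. -/
lemma sector_of_plate {K κ c R : ℝ} (hK : 1 ≤ K) (hκ : 0 < κ) (hκ1 : κ ≤ 1)
    (hc : c = κ / (4 * (K + m + 4))) (hR : 0 < R) {θ : Fin m → ℝ} {p r : Fin (m + 2) → ℝ}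
    (hA : nullA p ∈ Icc R (4 * R)) (hT : ∀ i, |tiltT θ p i| ≤ c * √R)
    (hB : tiltB θ p ∈ Icc 1 K) (hr : r ∈ plate R θ c) :
    R / 2 ≤ lorentzQ (m + 2) p - lorentzQ (m + 2) r ∧
      lorentzQ (m + 2) p - lorentzQ (m + 2) r ≤ (4 * K + 1) * R ∧
      |lorentzPolar p r| ≤ κ * (lorentzQ (m + 2) p - lorentzQ (m + 2) r) := by
  have hm : (0 : ℝ) ≤ m := Nat.cast_nonneg m
  have hc0 : 0 < c := by rw [hc]; positivity
  have hck : 4 * (K + m + 4) * c = κ := by rw [hc]; field_simp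
  obtain ⟨rA, rT, rB⟩ := hr
  have prod_le : ∀ x y : ℝ, |x| ≤ c * √R → |y| ≤ c * √R → |x * y| ≤ c ^ 2 * R := by
    intro x y hx hy
    rw [abs_mul]
    calc |x| * |y| ≤ (c * √R) * (c * √R) := by gcongr
      _ = c ^ 2 * R := by rw [mul_mul_mul_comm, Real.mul_self_sqrt hR.le]; ring
  have sum_le : ∀ f g : Fin m → ℝ, (∀ i, |f i| ≤ c * √R) → (∀ i, |g i| ≤ c * √R) →
      |∑ i, f i * g i| ≤ m * (c ^ 2 * R) := by
    intro f g hf hg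
    refine (Finset.abs_sum_le_sum_abs _ _).trans ?_
    exact (Finset.sum_le_card_nsmul _ _ _ fun i _ => prod_le _ _ (hf i) (hg i)).trans (by simp)
  have hS1 := sum_le _ _ hT hT
  have hS2 := sum_le _ _ rT rT
  have hS3 := abs_le.1 (sum_le _ _ hT rT)
  have hS1' : 0 ≤ ∑ i, tiltT θ p i * tiltT θ p i :=
    Finset.sum_nonneg fun i _ => mul_self_nonneg _
  have hS2' : 0 ≤ ∑ i, tiltT θ r i * tiltT θ r i :=
    Finset.sum_nonneg fun i _ => mul_self_nonneg _
  rw [abs_of_nonneg hS1'] at hS1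
  rw [abs_of_nonneg hS2'] at hS2
  rw [lorentzQ_eq_tilt θ p, lorentzQ_eq_tilt θ r, lorentzPolar_eq_tilt θ p r]
  simp only [pow_two (tiltT _ _ _)]
  have hAB1 : R ≤ nullA p * tiltB θ p := by nlinarith [hA.1, hB.1]
  have hAB2 : nullA p * tiltB θ p ≤ 4 * R * K :=
    mul_le_mul hA.2 hB.2 (by linarith [hB.1]) (by linarith)
  have hrr : |nullA r * tiltB θ r| ≤ c * R * c := by
    rw [abs_mul]; exact mul_le_mul rA rB (abs_nonneg _) (by positivity)
  have hpr : |nullA p * tiltB θ r| ≤ 4 * R * c := by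
    rw [abs_mul, abs_of_nonneg (hR.le.trans hA.1)]
    exact mul_le_mul hA.2 rB (abs_nonneg _) (by linarith)
  have hrp : |nullA r * tiltB θ p| ≤ c * R * K := by
    rw [abs_mul, abs_of_nonneg (zero_le_one.trans hB.1)]
    exact mul_le_mul rA hB.2 (by linarith [hB.1]) (by positivity)
  rw [abs_le] at hrr hpr hrp
  have hcm : (m + 1) * c ≤ κ / 4 := by nlinarith
  have hc1 : c ≤ 1 / 4 := by nlinarith
  have hcc : (m + 1) * (c ^ 2 * R) ≤ R / 16 := by
    have h1 : ((m + 1) * c) * c ≤ (1 / 4) * (1 / 4) :=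
      mul_le_mul (by linarith) hc1 hc0.le (by norm_num)
    nlinarith
  have hccR : 0 ≤ c ^ 2 * R := by positivity
  have hlow : R / 2 ≤ nullA p * tiltB θ p - ∑ i, tiltT θ p i * tiltT θ p i
      - (nullA r * tiltB θ r - ∑ i, tiltT θ r i * tiltT θ r i) := by
    linarith [hrr.2]
  refine ⟨hlow, ?_, ?_⟩
  · linarith [hrr.1]
  · have hpol : (4 + K + 2 * m * c) * (c * R) ≤ κ * (R / 2) := by
      have h1 : (4 + K + 2 * m * c) * c ≤ κ / 2 := by
        have : 2 * m * c ≤ 2 * m := by nlinarith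
        nlinarith
      nlinarith
    have h2 : κ * (R / 2) ≤ κ * (nullA p * tiltB θ p - ∑ i, tiltT θ p i * tiltT θ p i
      - (nullA r * tiltB θ r - ∑ i, tiltT θ r i * tiltT θ r i)) := by gcongr
    refine le_trans ?_ h2
    rw [abs_le]
    constructor <;> linarith [hpr.1, hpr.2, hrp.1, hrp.2, hS3.1, hS3.2]

lemma measurableSet_forall {α ι : Type*} [MeasurableSpace α] [Countable ι] {p : ι → α → Prop}
    (h : ∀ i, MeasurableSet {x | p i x}) : MeasurableSet {x | ∀ i, p i x} := by
  rw [ofPred_forall]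
  exact .iInter h

/-- The null coordinates as a linear equivalence. -/
def nullEquiv (m : ℕ) : (Fin (m + 2) → ℝ) ≃ₗ[ℝ] ℝ × (Fin m → ℝ) × ℝ where
  toFun y := (nullA y, nullT y, nullB y)
  map_add' y w := by ext <;> simp [nullA_add, nullB_add, nullT]
  map_smul' r y := by ext <;> simp [nullA, nullB, nullT] <;> ring
  invFun e := Fin.cons ((e.1 + e.2.2) / 2) (Fin.cons ((e.1 - e.2.2) / 2) e.2.1)
  left_inv y := by
    ext i
    refine Fin.cases ?_ (fun j => ?_) i
    · simp [nullA, nullB]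
    · refine Fin.cases ?_ (fun k => ?_) j
      · simp [nullA, nullB]
      · simp [nullT]
  right_inv e := by
    ext <;> simp [nullA, nullB, nullT] <;> ring

lemma measurable_nullA : Measurable (nullA : (Fin (m + 2) → ℝ) → ℝ) := by
  unfold nullA; fun_prop

lemma measurable_nullB : Measurable (nullB : (Fin (m + 2) → ℝ) → ℝ) := by
  unfold nullB; fun_prop

lemma measurable_nullT : Measurable (nullT : (Fin (m + 2) → ℝ) → Fin m → ℝ) := by
  unfold nullT; fun_prop

lemma measurable_tiltT (i : Fin m) :
    Measurable fun e : (Fin m → ℝ) × (Fin (m + 2) → ℝ) => tiltT e.1 e.2 i := by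
  unfold tiltT nullA nullT; fun_prop

lemma measurable_tiltB :
    Measurable fun e : (Fin m → ℝ) × (Fin (m + 2) → ℝ) => tiltB e.1 e.2 := by
  unfold tiltB nullA nullB nullT; fun_prop

lemma exists_nullConst (m : ℕ) : ∃ κ : ℝ, 0 < κ ∧ ∀ G : ℝ × (Fin m → ℝ) × ℝ → ℝ≥0∞,
    Measurable G → ∫⁻ y : Fin (m + 2) → ℝ, G (nullA y, nullT y, nullB y) =
      ENNReal.ofReal κ * ∫⁻ a, ∫⁻ t, ∫⁻ b, G (a, t, b) := by
  let e := (nullEquiv m).toContinuousLinearEquiv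
  let μ : Measure (ℝ × (Fin m → ℝ) × ℝ) := Measure.map e volume
  have hμ : μ.IsAddHaarMeasure := e.isAddHaarMeasure_map volume
  have h2 : (volume : Measure ((Fin m → ℝ) × ℝ)).IsAddHaarMeasure :=
    Measure.prod.instIsAddHaarMeasure _ _
  have h3 : (volume : Measure (ℝ × (Fin m → ℝ) × ℝ)).IsAddHaarMeasure :=
    Measure.prod.instIsAddHaarMeasure _ _
  refine ⟨μ.addHaarScalarFactor volume,
    mod_cast Measure.addHaarScalarFactor_pos_of_isAddHaarMeasure μ volume, fun G hG => ?_⟩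
  have h1 : ∫⁻ y : Fin (m + 2) → ℝ, G (nullA y, nullT y, nullB y) = ∫⁻ z, G z ∂μ :=
    (lintegral_map hG e.continuous.measurable).symm
  have h4 : ∫⁻ z, G z ∂μ = ∫⁻ z, G z ∂(μ.addHaarScalarFactor volume • volume) :=
    congrArg (fun ρ => ∫⁻ z, G z ∂ρ) (Measure.isAddLeftInvariant_eq_smul μ volume)
  rw [h1, h4, lintegral_smul_measure,
    ENNReal.ofReal_coe_nnreal, ENNReal.smul_def, smul_eq_mul]
  congr 1
  rw [Measure.volume_eq_prod, lintegral_prod _ hG.aemeasurable]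
  refine lintegral_congr fun a => ?_
  rw [Measure.volume_eq_prod, lintegral_prod _ (by fun_prop)]

/-- The Jacobian of the null coordinates. -/
def nullConst (m : ℕ) : ℝ := (exists_nullConst m).choose

lemma nullConst_pos : 0 < nullConst m := (exists_nullConst m).choose_spec.1

lemma lintegral_null {G : ℝ × (Fin m → ℝ) × ℝ → ℝ≥0∞} (hG : Measurable G) :
    ∫⁻ y : Fin (m + 2) → ℝ, G (nullA y, nullT y, nullB y) =
      ENNReal.ofReal (nullConst m) * ∫⁻ a, ∫⁻ t, ∫⁻ b, G (a, t, b) :=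
  (exists_nullConst m).choose_spec.2 G hG

lemma lintegral_null_shear {f : ℝ → ℝ≥0∞} {g : ℝ → (Fin m → ℝ) → ℝ≥0∞} {h : ℝ → ℝ≥0∞}
    {k : ℝ → (Fin m → ℝ) → ℝ} (hf : Measurable f) (hg : Measurable (Function.uncurry g))
    (hh : Measurable h) (hk : Measurable (Function.uncurry k)) :
    ∫⁻ y : Fin (m + 2) → ℝ,
        f (nullA y) * g (nullA y) (nullT y) * h (nullB y - k (nullA y) (nullT y)) =
      ENNReal.ofReal (nullConst m) * ((∫⁻ a, f a * ∫⁻ t, g a t) * ∫⁻ b, h b) := by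
  have hg' : Measurable fun e : ℝ × (Fin m → ℝ) × ℝ => g e.1 e.2.1 :=
    hg.comp (measurable_fst.prodMk measurable_snd.fst)
  have hk' : Measurable fun e : ℝ × (Fin m → ℝ) × ℝ => k e.1 e.2.1 :=
    hk.comp (measurable_fst.prodMk measurable_snd.fst)
  have hG : Measurable fun e : ℝ × (Fin m → ℝ) × ℝ =>
      f e.1 * g e.1 e.2.1 * h (e.2.2 - k e.1 e.2.1) := by fun_prop
  rw [lintegral_null hG]
  congr 1
  have hgm : ∀ a, Measurable (g a) := fun a => hg.comp (measurable_const.prodMk measurable_id)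
  have hb : ∀ a t, ∫⁻ b, f a * g a t * h (b - k a t) = f a * g a t * ∫⁻ b, h b := by
    intro a t
    rw [lintegral_const_mul _ (by fun_prop), lintegral_sub_right_eq_self h]
  simp only [hb]
  have ht : ∀ a, ∫⁻ t, f a * g a t * ∫⁻ b, h b = (f a * ∫⁻ t, g a t) * ∫⁻ b, h b := by
    intro a
    rw [lintegral_mul_const _ (by have := hgm a; fun_prop), lintegral_const_mul _ (hgm a)]
  simp only [ht]
  rw [lintegral_mul_const]
  exact hf.mul (Measurable.lintegral_prod_right hg)

lemma measurableSet_plate (R : ℝ) (θ : Fin m → ℝ) (c : ℝ) : MeasurableSet (plate R θ c) := by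
  have hA := measurable_nullA (m := m)
  have hT : ∀ i, Measurable fun u : Fin (m + 2) → ℝ => tiltT θ u i := fun i =>
    (measurable_tiltT i).comp (measurable_const.prodMk measurable_id)
  have hB : Measurable fun u : Fin (m + 2) → ℝ => tiltB θ u :=
    measurable_tiltB.comp (measurable_const.prodMk measurable_id)
  refine (measurableSet_le hA.norm measurable_const).inter
    (MeasurableSet.inter ?_ (measurableSet_le hB.norm measurable_const))
  exact measurableSet_forall fun i => measurableSet_le (hT i).norm measurable_const

/-- The volume of a plate, up to the power of its size. -/
def plateConst (m : ℕ) (c : ℝ) : ℝ := nullConst m * ((2 * c) ^ m * (2 * c) * (2 * c))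

lemma plateConst_pos {c : ℝ} (hc : 0 < c) : 0 < plateConst m c := by
  have := nullConst_pos (m := m)
  unfold plateConst; positivity

lemma volume_plate {R c : ℝ} (hR : 0 < R) (hc : 0 < c) (θ : Fin m → ℝ) :
    volume (plate R θ c) = ENNReal.ofReal (plateConst m c * R ^ ((m : ℝ) / 2 + 1)) := by
  have h0 : ∀ y : Fin (m + 2) → ℝ, (plate R θ c).indicator 1 y =
      (Icc (-(c * R)) (c * R)).indicator (1 : ℝ → ℝ≥0∞) (nullA y)
        * (Icc (fun i => nullA y * θ i - c * √R) (fun i => nullA y * θ i + c * √R)).indicator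
          (1 : (Fin m → ℝ) → ℝ≥0∞) (nullT y)
        * (Icc (-c) c).indicator (1 : ℝ → ℝ≥0∞)
          (nullB y - ∑ i, θ i * (2 * nullT y i - nullA y * θ i)) := by
    intro y
    have h1 : (∀ i, |tiltT θ y i| ≤ c * √R) ↔ nullT y ∈
        Icc (fun i => nullA y * θ i - c * √R) (fun i => nullA y * θ i + c * √R) := by
      simp only [mem_Icc, Pi.le_def, ← forall_and, tiltT, abs_le]
      refine forall_congr' fun i => ?_
      constructor <;> rintro ⟨h, h'⟩ <;> constructor <;> linarith
    have h2 : nullB y - ∑ i, θ i * (2 * nullT y i - nullA y * θ i) = tiltB θ y := rfl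
    by_cases hA : |nullA y| ≤ c * R <;>
    by_cases hT : nullT y ∈
        Icc (fun i => nullA y * θ i - c * √R) (fun i => nullA y * θ i + c * √R) <;>
    by_cases hB : |tiltB θ y| ≤ c <;>
    simp only [indicator, plate, mem_ofPred_eq, h1, hA, hT, hB, h2, mem_Icc (a := -(c * R)),
      mem_Icc (a := -c), ← abs_le] <;> simp
  have h2 : volume (plate R θ c) = ∫⁻ y, (plate R θ c).indicator 1 y :=
    (lintegral_indicator_one (measurableSet_plate R θ c)).symm
  rw [h2]
  simp only [h0]
  rw [lintegral_null_shear (f := (Icc (-(c * R)) (c * R)).indicator 1)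
    (g := fun a t => (Icc (fun i => a * θ i - c * √R) (fun i => a * θ i + c * √R)).indicator 1 t)
    (h := (Icc (-c) c).indicator 1) (k := fun a t => ∑ i, θ i * (2 * t i - a * θ i))
    (measurable_one.indicator measurableSet_Icc) ?_
    (measurable_one.indicator measurableSet_Icc) (by unfold Function.uncurry; fun_prop)]
  · have h3 : ∀ a : ℝ, ∫⁻ t : Fin m → ℝ, (Icc (fun i => a * θ i - c * √R)
        (fun i => a * θ i + c * √R)).indicator (1 : (Fin m → ℝ) → ℝ≥0∞) t =
        ENNReal.ofReal ((2 * c * √R) ^ m) := by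
      intro a
      rw [lintegral_indicator_one measurableSet_Icc, Real.volume_Icc_pi,
        ENNReal.ofReal_pow (by positivity)]
      simp only [add_sub_sub_cancel]
      rw [Finset.prod_const, Finset.card_univ, Fintype.card_fin]
      ring_nf
    simp only [h3]
    rw [lintegral_mul_const _ (measurable_one.indicator measurableSet_Icc),
      lintegral_indicator_one measurableSet_Icc, lintegral_indicator_one measurableSet_Icc,
      Real.volume_Icc, Real.volume_Icc, ← ENNReal.ofReal_mul (by linarith [mul_pos hc hR]),
      ← ENNReal.ofReal_mul (mul_nonneg (by linarith [mul_pos hc hR]) (by positivity)),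
      ← ENNReal.ofReal_mul nullConst_pos.le, Real.rpow_add hR, Real.rpow_one,
      Real.rpow_div_two_eq_sqrt _ hR.le, Real.rpow_natCast, plateConst]
    congr 1
    ring
  · have : MeasurableSet {e : ℝ × (Fin m → ℝ) |
        e.2 ∈ Icc (fun i => e.1 * θ i - c * √R) (fun i => e.1 * θ i + c * √R)} := by
      refine MeasurableSet.inter ?_ ?_ <;>
      exact measurableSet_forall fun i => measurableSet_le (by fun_prop) (by fun_prop)
    exact measurable_one.indicator this

/-- The points at distance about one from the light cone, over a patch of directions. -/
def coneShell (m : ℕ) (R S : ℝ) : Set (Fin (m + 2) → ℝ) :=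
  {w | nullA w ∈ Icc R S ∧ (∀ i, nullT w i ∈ Ico 0 (nullA w)) ∧
    nullB w - (∑ i, nullT w i ^ 2) / nullA w ∈ Icc 1 2}

lemma measurableSet_coneShell (R S : ℝ) : MeasurableSet (coneShell m R S) := by
  have hA := measurable_nullA (m := m)
  have hB := measurable_nullB (m := m)
  have hT : ∀ i, Measurable fun u : Fin (m + 2) → ℝ => nullT u i :=
    fun i => measurable_pi_iff.1 measurable_nullT i
  refine (hA measurableSet_Icc).inter (MeasurableSet.inter ?_ ?_)
  · exact measurableSet_forall fun i =>
      (measurableSet_le measurable_const (hT i)).inter (measurableSet_lt (hT i) hA)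
  · have : Measurable fun w : Fin (m + 2) → ℝ => nullB w - (∑ i, nullT w i ^ 2) / nullA w :=
      hB.sub ((Finset.measurable_sum _ fun i _ => (hT i).pow_const 2).div hA)
    exact this measurableSet_Icc

lemma lintegral_coneShell {R S : ℝ} (hR : 0 < R) {h : ℝ → ℝ≥0∞} (hh : Measurable h) :
    ∫⁻ w in coneShell m R S, h (nullA w) =
      ENNReal.ofReal (nullConst m) * ∫⁻ a in Icc R S, h a * ENNReal.ofReal (a ^ m) := by
  have h0 : ∀ y : Fin (m + 2) → ℝ, (coneShell m R S).indicator (fun w => h (nullA w)) y =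
      (Icc R S).indicator h (nullA y)
        * (univ.pi fun _ => Ico 0 (nullA y)).indicator (1 : (Fin m → ℝ) → ℝ≥0∞) (nullT y)
        * (Icc 1 2).indicator (1 : ℝ → ℝ≥0∞)
          (nullB y - (∑ i, nullT y i ^ 2) / nullA y) := by
    intro y
    have h1 : (∀ i, nullT y i ∈ Ico 0 (nullA y)) ↔ nullT y ∈ univ.pi fun _ => Ico 0 (nullA y) := by
      simp only [mem_pi, mem_univ, true_imp_iff]
    by_cases hA : nullA y ∈ Icc R S <;>
    by_cases hT : nullT y ∈ univ.pi fun _ => Ico 0 (nullA y) <;>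
    by_cases hB : nullB y - (∑ i, nullT y i ^ 2) / nullA y ∈ Icc 1 2 <;>
    simp only [indicator, coneShell, mem_ofPred_eq, h1, hA, hT, hB] <;> simp
  rw [← lintegral_indicator (measurableSet_coneShell R S)]
  simp only [h0]
  rw [lintegral_null_shear (f := (Icc R S).indicator h)
    (g := fun a t => (univ.pi fun _ => Ico 0 a).indicator 1 t)
    (h := (Icc 1 2).indicator 1) (k := fun a t => (∑ i, t i ^ 2) / a)
    (hh.indicator measurableSet_Icc) ?_
    (measurable_one.indicator measurableSet_Icc) (by unfold Function.uncurry; fun_prop)]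
  · rw [lintegral_indicator_one measurableSet_Icc, Real.volume_Icc]
    norm_num
    rw [← lintegral_indicator measurableSet_Icc]
    congr 1
    refine lintegral_congr fun a => ?_
    by_cases ha : a ∈ Icc R S
    · rw [indicator_of_mem ha, indicator_of_mem ha, lintegral_indicator_one
        (MeasurableSet.univ_pi fun _ => measurableSet_Ico), Real.volume_pi_Ico]
      simp [ENNReal.ofReal_pow (hR.le.trans ha.1)]
    · simp [indicator_of_notMem ha]
  · have : MeasurableSet {e : ℝ × (Fin m → ℝ) | e.2 ∈ univ.pi fun _ => Ico 0 e.1} := by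
      simp only [mem_pi, mem_univ, true_imp_iff]
      have hi : ∀ i, Measurable fun e : ℝ × (Fin m → ℝ) => e.2 i := fun i => by fun_prop
      exact measurableSet_forall fun i => (measurableSet_le measurable_const (hi i)).inter
        (measurableSet_lt (hi i) measurable_fst)
    exact measurable_one.indicator this

lemma tiltB_eq {y : Fin (m + 2) → ℝ} (hy : nullA y ≠ 0) (θ : Fin m → ℝ) :
    tiltB θ y = nullB y - (∑ i, nullT y i ^ 2) / nullA y + (∑ i, tiltT θ y i ^ 2) / nullA y := by
  have h := (lorentzQ_eq y).symm.trans (lorentzQ_eq_tilt θ y)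
  field_simp
  linarith

lemma coneShell_lorentzQ {R S : ℝ} (hR : 0 < R) {w : Fin (m + 2) → ℝ}
    (hw : w ∈ coneShell m R S) : lorentzQ (m + 2) w ∈ Icc (nullA w) (2 * nullA w) := by
  obtain ⟨hA, -, hB⟩ := hw
  have hA0 : 0 < nullA w := hR.trans_le hA.1
  have h : lorentzQ (m + 2) w = nullA w * (nullB w - (∑ i, nullT w i ^ 2) / nullA w) := by
    rw [lorentzQ_eq]; field_simp
  rw [h]
  constructor <;> nlinarith [hB.1, hB.2]

lemma coneShell_subset_lightCone {R S : ℝ} (hR : 0 < R) :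
    coneShell m R S ⊆ lightCone (m + 2) := by
  intro w hw
  have hA0 : 0 < nullA w := hR.trans_le hw.1.1
  refine ⟨?_, hA0.trans_le (coneShell_lorentzQ hR hw).1⟩
  have h1 : 0 ≤ (∑ i, nullT w i ^ 2) / nullA w :=
    div_nonneg (Finset.sum_nonneg fun i _ => sq_nonneg _) hA0.le
  have hB : 0 < nullB w := by linarith [hw.2.2.1]
  simp only [nullA] at hA0
  simp only [nullB] at hB
  linarith

lemma coneShell_tiltB {R S d : ℝ} (hR : 0 < R) {w : Fin (m + 2) → ℝ}
    (hw : w ∈ coneShell m R S) {θ : Fin m → ℝ} (hT : ∀ i, tiltT θ w i ^ 2 ≤ d * nullA w) :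
    tiltB θ w ∈ Icc 1 (2 + m * d) := by
  have hA0 : 0 < nullA w := hR.trans_le hw.1.1
  have h1 : 0 ≤ (∑ i, tiltT θ w i ^ 2) / nullA w :=
    div_nonneg (Finset.sum_nonneg fun i _ => sq_nonneg _) hA0.le
  have h2 : (∑ i, tiltT θ w i ^ 2) / nullA w ≤ m * d := by
    rw [div_le_iff₀ hA0]
    exact (Finset.sum_le_card_nsmul _ _ _ fun i _ => hT i).trans (by simp [mul_assoc])
  rw [tiltB_eq hA0.ne' θ]
  constructor <;> linarith [hw.2.2.1, hw.2.2.2]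

/-- The direction of a point, in the transverse coordinates. -/
def direction (w : Fin (m + 2) → ℝ) : Fin m → ℝ := fun i => nullT w i / nullA w

lemma direction_mem {R S : ℝ} (hR : 0 < R) {w : Fin (m + 2) → ℝ} (hw : w ∈ coneShell m R S)
    (i : Fin m) : direction w i ∈ Ico (0 : ℝ) 1 := by
  have hA0 : 0 < nullA w := hR.trans_le hw.1.1
  exact ⟨div_nonneg (hw.2.1 i).1 hA0.le, (div_lt_one hA0).2 (hw.2.1 i).2⟩

lemma tiltT_eq_direction {w : Fin (m + 2) → ℝ} (hw : nullA w ≠ 0) (θ : Fin m → ℝ) (i : Fin m) :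
    tiltT θ w i = nullA w * (direction w i - θ i) := by
  simp only [tiltT, direction]
  field_simp

/-- A power is almost positive in a thin sector. -/
lemma cpow_neg_re_ge {s : ℝ} (hs : 0 < s) {a b : ℝ} (ha : 0 < a) (hb : |b| ≤ 1 / s * a)
    (hb1 : |b| ≤ a) :
    (2 * a) ^ (-s) / 2 ≤ (((a : ℂ) - (b : ℂ) * I) ^ ((-s : ℝ) : ℂ)).re := by
  set z : ℂ := (a : ℂ) - (b : ℂ) * I with hz
  have hre : z.re = a := by simp [hz]
  have him : z.im = -b := by simp [hz]
  have hz0 : z ≠ 0 := fun h => by rw [h] at hre; simp at hre; linarith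
  have harg : |z.arg * s| ≤ 1 := by
    have hlt : |z.arg| < Real.pi / 2 := abs_arg_lt_pi_div_two_iff.2 (.inl (hre ▸ ha))
    have h1 : |z.arg| ≤ |b| / a := by
      refine (Real.le_tan (abs_nonneg _) hlt).trans_eq ?_
      have h2 : Real.tan |z.arg| = |Real.tan z.arg| := by
        rcases abs_cases z.arg with ⟨h, h'⟩ | ⟨h, h'⟩ <;> rw [h]
        · rw [abs_of_nonneg]
          exact Real.tan_nonneg_of_nonneg_of_le_pi_div_two h' (h ▸ hlt).le
        · rw [Real.tan_neg, abs_of_nonpos]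
          exact Real.tan_nonpos_of_nonpos_of_neg_pi_div_two_le h'.le (by linarith [h ▸ hlt])
      rw [h2, tan_arg, hre, him, abs_div, abs_neg, abs_of_pos ha]
    have h3 : |b| / a ≤ 1 / s := (div_le_iff₀ ha).2 hb
    rw [abs_mul, abs_of_pos hs]
    exact (le_div_iff₀ hs).1 (h1.trans h3)
  have hcos : 1 / 2 ≤ Real.cos (z.arg * -s) := by
    have h1 := Real.one_sub_sq_div_two_le_cos (x := z.arg * -s)
    have h2 : (z.arg * -s) ^ 2 ≤ 1 := by
      rw [mul_neg, neg_sq]; exact (sq_le_one_iff_abs_le_one _).2 harg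
    linarith
  have hnorm : ‖z‖ ≤ 2 * a := by
    have := Complex.norm_le_abs_re_add_abs_im z
    rw [hre, him, abs_of_pos ha, abs_neg] at this
    linarith
  rw [cpow_ofReal_re]
  have hpow : (2 * a) ^ (-s) ≤ ‖z‖ ^ (-s) :=
    Real.rpow_le_rpow_of_nonpos (norm_pos_iff.2 hz0) hnorm (by linarith)
  have := Real.rpow_nonneg (norm_nonneg z) (-s)
  nlinarith

/-- The exponent of the Bergman kernel. -/
def kernelExp (m : ℕ) (ν : ℝ) : ℝ := ν + ((m + 2 : ℕ) : ℝ) / 2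

/-- The exponent of the Bergman weight. -/
def weightExp (m : ℕ) (ν : ℝ) : ℝ := ν - ((m + 2 : ℕ) : ℝ) / 2

/-- The kernel of `bergmanOp`, as a function of the sum of the imaginary parts and of the
difference of the real parts. -/
def bergmanKernel (ν : ℝ) (p r : Fin (m + 2) → ℝ) : ℂ :=
  (((lorentzQ (m + 2) p - lorentzQ (m + 2) r : ℝ) : ℂ) - (lorentzPolar p r : ℂ) * I)
    ^ ((-kernelExp m ν : ℝ) : ℂ)

lemma bergmanIntegrand_eq (ν : ℝ) (F : (Fin (m + 2) → ℂ) → ℂ)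
    (x y : Fin (m + 2) → ℝ) (uv : (Fin (m + 2) → ℝ) × (Fin (m + 2) → ℝ)) :
    bergmanIntegrand (m + 2) ν F (tubePt (m + 2) x y) uv =
      bergmanKernel ν (y + uv.2) (x - uv.1) * F (tubePt (m + 2) uv.1 uv.2)
        * ((lorentzQ (m + 2) uv.2 ^ weightExp m ν : ℝ) : ℂ) := by
  rw [bergmanIntegrand, lorentzQC_kernel_arg]
  rfl

/-- An upper bound for `tiltB` on the regions considered below. -/
def tiltBound (m : ℕ) : ℝ := 4 + 5 * m

/-- The relative size of the plates on which the Bergman kernel is almost positive. -/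
def width (m : ℕ) (ν : ℝ) : ℝ :=
  min 1 (1 / kernelExp m ν) / (4 * (tiltBound m + m + 4))

lemma one_le_tiltBound : 1 ≤ tiltBound m := by
  have hm : (0 : ℝ) ≤ m := Nat.cast_nonneg m
  unfold tiltBound; linarith

lemma width_pos {ν : ℝ} (hs : 0 < kernelExp m ν) : 0 < width m ν := by
  have hm : (0 : ℝ) ≤ m := Nat.cast_nonneg m
  have := one_le_tiltBound (m := m)
  exact div_pos (lt_min one_pos (by positivity)) (by positivity)

lemma width_le (ν : ℝ) : width m ν ≤ 1 / 16 := by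
  have hm : (0 : ℝ) ≤ m := Nat.cast_nonneg m
  have hK := one_le_tiltBound (m := m)
  rw [width, div_le_div_iff₀ (by positivity) (by norm_num)]
  have := min_le_left 1 (1 / kernelExp m ν)
  unfold tiltBound at *
  linarith

/-- The size from which on the estimates below hold. -/
def threshold (m : ℕ) (ν : ℝ) : ℝ := (4 / width m ν) ^ 2

lemma two_le_threshold {ν : ℝ} (hs : 0 < kernelExp m ν) : 2 ≤ threshold m ν := by
  have h1 := width_pos hs
  have h2 : 64 ≤ 4 / width m ν := by
    rw [le_div_iff₀ h1]; linarith [width_le (m := m) ν]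
  unfold threshold; nlinarith

lemma four_le_of_threshold_le {ν : ℝ} (hs : 0 < kernelExp m ν) {R : ℝ}
    (hR : threshold m ν ≤ R) : 4 ≤ width m ν * √R := by
  have h1 := width_pos hs
  have h2 : 4 / width m ν ≤ √R := Real.le_sqrt_of_sq_le hR
  rwa [div_le_iff₀' h1] at h2

/-- The argument of the kernel when one point lies near the light cone and the other is bounded. -/
lemma sector_of_coneShell {ν : ℝ} (hs : 0 < kernelExp m ν) {R S T : ℝ}
    (hR : threshold m ν ≤ R) (hS : 0 < S) {θ : Fin m → ℝ} (hθ : ∀ i, θ i ∈ Icc (0 : ℝ) 1)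
    {w y : Fin (m + 2) → ℝ} (hw : w ∈ coneShell m S T) (hwR : nullA w ∈ Icc R (2 * R))
    (hwT : ∀ i, |tiltT θ w i| ≤ width m ν * √R / 2) (hy : y ∈ coneShell m 1 2)
    {r : Fin (m + 2) → ℝ} (hr : r ∈ plate R θ (width m ν)) :
    R / 2 ≤ lorentzQ (m + 2) (w + y) - lorentzQ (m + 2) r ∧
      lorentzQ (m + 2) (w + y) - lorentzQ (m + 2) r ≤ (4 * tiltBound m + 1) * R ∧
      |lorentzPolar (w + y) r| ≤
        min 1 (1 / kernelExp m ν) * (lorentzQ (m + 2) (w + y) - lorentzQ (m + 2) r) := by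
  have hc := width_pos hs
  have hc1 := width_le (m := m) ν
  have h4 := four_le_of_threshold_le hs hR
  have hR2 := (two_le_threshold hs).trans hR
  have hR0 : 0 < R := by linarith
  have hm : (0 : ℝ) ≤ m := Nat.cast_nonneg m
  have hyA : nullA y ∈ Icc (1 : ℝ) 2 := hy.1
  have hyT : ∀ i, |tiltT θ y i| ≤ nullA y := fun i => by
    have h0 : 0 < nullA y := by linarith [hyA.1]
    rw [tiltT_eq_direction h0.ne', abs_mul, abs_of_pos h0]
    have h1 := direction_mem one_pos hy i
    have h2 : |direction y i - θ i| ≤ 1 := by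
      rw [abs_le]; constructor <;> linarith [h1.1, h1.2, (hθ i).1, (hθ i).2]
    nlinarith
  have hwB : tiltB θ w ∈ Icc (1 : ℝ) (2 + m * 1) := by
    refine coneShell_tiltB hS hw fun i => ?_
    have h1 : tiltT θ w i ^ 2 ≤ (width m ν * √R / 2) ^ 2 := sq_le_sq' (by
      linarith [(abs_le.1 (hwT i)).1]) (abs_le.1 (hwT i)).2
    have h2 : (width m ν * √R / 2) ^ 2 = width m ν ^ 2 / 4 * R := by
      rw [div_pow, mul_pow, Real.sq_sqrt hR0.le]; ring
    have h3 : width m ν ^ 2 / 4 ≤ 1 := by nlinarith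
    nlinarith [hwR.1]
  have hyB : tiltB θ y ∈ Icc (1 : ℝ) (2 + m * 2) := by
    refine coneShell_tiltB one_pos hy fun i => ?_
    have h1 : tiltT θ y i ^ 2 ≤ nullA y ^ 2 := sq_le_sq' (by
      linarith [(abs_le.1 (hyT i)).1]) (abs_le.1 (hyT i)).2
    nlinarith [hyA.1, hyA.2]
  refine sector_of_plate one_le_tiltBound (lt_min one_pos (by positivity)) (min_le_left _ _)
    rfl hR0 (θ := θ) ?_ (fun i => ?_) ?_ hr
  · rw [nullA_add]
    constructor <;> linarith [hyA.1, hyA.2, hwR.1, hwR.2]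
  · rw [tiltT_add]
    have h5 := abs_add_le (tiltT θ w i) (tiltT θ y i)
    change _ ≤ width m ν * √R
    linarith [hwT i, hyT i, hyA.2]
  · rw [tiltB_add, tiltBound]
    constructor <;> linarith [hyB.1, hyB.2, hwB.1, hwB.2]

/-- The constant comparing the argument of the kernel and the size of the plates. -/
def sectorBound (m : ℕ) : ℝ := 2 * (4 * tiltBound m + 1)

lemma sectorBound_pos : 0 < sectorBound m := by
  have := one_le_tiltBound (m := m)
  unfold sectorBound; linarith

lemma norm_bergmanKernel_le {ν : ℝ} (hs : 0 < kernelExp m ν) {p r : Fin (m + 2) → ℝ} {H : ℝ}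
    (hH : 0 < H) (h : H ≤ |lorentzQ (m + 2) p - lorentzQ (m + 2) r|) :
    ‖bergmanKernel ν p r‖ ≤ H ^ (-kernelExp m ν) := by
  rw [bergmanKernel, norm_cpow_real]
  refine Real.rpow_le_rpow_of_nonpos hH (h.trans ?_) (by linarith)
  refine le_of_eq_of_le ?_ (abs_re_le_norm _)
  congr 1
  simp

lemma bergmanKernel_near {ν : ℝ} (hs : 0 < kernelExp m ν) {R S T : ℝ}
    (hR : threshold m ν ≤ R) (hS : 0 < S) {θ : Fin m → ℝ} (hθ : ∀ i, θ i ∈ Icc (0 : ℝ) 1)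
    {w y : Fin (m + 2) → ℝ} (hw : w ∈ coneShell m S T) (hwR : nullA w ∈ Icc R (2 * R))
    (hwT : ∀ i, |tiltT θ w i| ≤ width m ν * √R / 2) (hy : y ∈ coneShell m 1 2)
    {r : Fin (m + 2) → ℝ} (hr : r ∈ plate R θ (width m ν)) :
    (sectorBound m * R) ^ (-kernelExp m ν) / 2 ≤ (bergmanKernel ν (w + y) r).re ∧
      ‖bergmanKernel ν (w + y) r‖ ≤ 1 := by
  obtain ⟨h1, h2, h3⟩ := sector_of_coneShell hs hR hS hθ hw hwR hwT hy hr
  have hR2 := (two_le_threshold hs).trans hR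
  set a := lorentzQ (m + 2) (w + y) - lorentzQ (m + 2) r
  have ha : 0 < a := by linarith
  constructor
  · refine le_trans ?_ (cpow_neg_re_ge hs ha (h3.trans ?_) (h3.trans ?_))
    · gcongr ?_ / 2
      exact Real.rpow_le_rpow_of_nonpos (by linarith)
        (by unfold sectorBound; linarith) (by linarith)
    · gcongr; exact min_le_right _ _
    · nlinarith [min_le_left 1 (1 / kernelExp m ν)]
  · refine (norm_bergmanKernel_le hs one_pos ?_).trans_eq (Real.one_rpow _)
    exact le_trans (by linarith) (le_abs_self a)

/-- The first basis vector, times `τ`. -/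
def timeShift (τ : ℝ) : Fin (m + 2) → ℝ := Pi.single 0 τ

lemma lorentzQ_timeShift_add_le {τ B : ℝ} {r : Fin (m + 2) → ℝ} (hA : |nullA r| ≤ B)
    (hB : |nullB r| ≤ B) (hT : ∀ i, |nullT r i| ≤ B) {X : ℝ} (hX : 0 ≤ X)
    (hτ : 1 + B + m * B ^ 2 + X ≤ |τ|) :
    X ≤ lorentzQ (m + 2) (timeShift τ + r) := by
  have hm : (0 : ℝ) ≤ m := Nat.cast_nonneg m
  have hB0 : 0 ≤ B := (abs_nonneg _).trans hA
  have h1 : ∑ i, nullT r i ^ 2 ≤ m * B ^ 2 := by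
    refine (Finset.sum_le_card_nsmul _ _ (B ^ 2) fun i _ => ?_).trans (by simp)
    exact sq_le_sq' (by linarith [(abs_le.1 (hT i)).1]) (abs_le.1 (hT i)).2
  have h2 : lorentzQ (m + 2) (timeShift τ + r)
      = (τ + nullA r) * (τ + nullB r) - ∑ i, nullT r i ^ 2 := by
    rw [lorentzQ_eq]
    simp [nullA, nullB, nullT, timeShift, Fin.succ_ne_zero]
    ring
  have hmB : 0 ≤ m * B ^ 2 := by positivity
  rw [h2]
  obtain ⟨a1, a2⟩ := abs_le.1 hA
  obtain ⟨b1, b2⟩ := abs_le.1 hB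
  have h3 : m * B ^ 2 + X ≤ (τ + nullA r) * (τ + nullB r) := by
    rcases abs_cases τ with ⟨h, h'⟩ | ⟨h, h'⟩
    · nlinarith [mul_le_mul (show 1 + m * B ^ 2 + X ≤ τ + nullA r by linarith)
        (show 1 ≤ τ + nullB r by linarith) zero_le_one (by linarith)]
    · nlinarith [mul_le_mul (show 1 + m * B ^ 2 + X ≤ -(τ + nullA r) by linarith)
        (show 1 ≤ -(τ + nullB r) by linarith) zero_le_one (by linarith)]
  linarith

/-- Coordinate bounds on plates. -/
lemma abs_null_le_of_plate {R c : ℝ} (hR : 1 ≤ R) (hc : 0 ≤ c) {θ : Fin m → ℝ}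
    (hθ : ∀ i, θ i ∈ Icc (0 : ℝ) 1) {u : Fin (m + 2) → ℝ} (hu : u ∈ plate R θ c) :
    |nullA u| ≤ (2 + 5 * m) * (c * R) ∧ |nullB u| ≤ (2 + 5 * m) * (c * R) ∧
      ∀ i, |nullT u i| ≤ (2 + 5 * m) * (c * R) := by
  have hm : (0 : ℝ) ≤ m := Nat.cast_nonneg m
  have hcR : 0 ≤ c * R := by positivity
  have hmcR : 0 ≤ m * (c * R) := by positivity
  have hsR : √R ≤ R := Real.sqrt_le_iff.2 ⟨by linarith, by nlinarith⟩
  obtain ⟨hA, hT, hB⟩ := hu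
  have h2 : ∀ i, |nullA u * θ i| ≤ c * R := fun i => by
    rw [abs_mul, abs_of_nonneg (hθ i).1]
    nlinarith [(hθ i).1, (hθ i).2, abs_nonneg (nullA u)]
  have h3 : ∀ i, |nullT u i| ≤ 2 * (c * R) := fun i => by
    have h4 : nullT u i = tiltT θ u i + nullA u * θ i := by simp [tiltT]
    rw [h4]
    have := abs_add_le (tiltT θ u i) (nullA u * θ i)
    nlinarith [hT i, h2 i]
  refine ⟨by linarith, ?_, fun i => by linarith [h3 i]⟩
  have h4 : |∑ i, θ i * (2 * nullT u i - nullA u * θ i)| ≤ m * (5 * (c * R)) := by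
    refine (Finset.abs_sum_le_sum_abs _ _).trans ?_
    refine (Finset.sum_le_card_nsmul _ _ (5 * (c * R)) fun i _ => ?_).trans (by simp)
    rw [abs_mul, abs_of_nonneg (hθ i).1]
    have h4 : |2 * nullT u i - nullA u * θ i| ≤ 5 * (c * R) := by
      have h5 := abs_le.1 (h3 i)
      have h6 := abs_le.1 (h2 i)
      rw [abs_le]; constructor <;> linarith [h5.1, h5.2, h6.1, h6.2]
    nlinarith [(hθ i).1, (hθ i).2, abs_nonneg (2 * nullT u i - nullA u * θ i)]
  have h5 : nullB u = tiltB θ u + ∑ i, θ i * (2 * nullT u i - nullA u * θ i) := by simp [tiltB]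
  rw [h5]
  refine (abs_add_le _ _).trans ?_
  nlinarith

/-- The separation between plates that makes their interaction smaller than `H ^ (-s)`. -/
def separation (m : ℕ) (ν R H : ℝ) : ℝ :=
  1 + (2 + 5 * m) * (width m ν * R) + m * ((2 + 5 * m) * (width m ν * R)) ^ 2
    + ((4 * tiltBound m + 1) * R + H)

lemma separation_pos {ν : ℝ} (hs : 0 < kernelExp m ν) {R H : ℝ} (hR : 0 < R) (hH : 0 < H) :
    0 < separation m ν R H := by
  have := one_le_tiltBound (m := m)
  have := width_pos hs
  unfold separation; positivity

lemma bergmanKernel_far {ν : ℝ} (hs : 0 < kernelExp m ν) {R S T H τ : ℝ}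
    (hR : threshold m ν ≤ R) (hS : 0 < S) (hH : 0 < H) {θ η : Fin m → ℝ}
    (hθ : ∀ i, θ i ∈ Icc (0 : ℝ) 1) (hη : ∀ i, η i ∈ Icc (0 : ℝ) 1)
    {w y : Fin (m + 2) → ℝ} (hw : w ∈ coneShell m S T) (hwR : nullA w ∈ Icc R (2 * R))
    (hwT : ∀ i, |tiltT θ w i| ≤ width m ν * √R / 2) (hy : y ∈ coneShell m 1 2)
    (hτ : separation m ν R H ≤ |τ|) {x u : Fin (m + 2) → ℝ}
    (hx : x ∈ plate R θ (width m ν / 2)) (hu : u ∈ plate R η (width m ν / 2)) :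
    ‖bergmanKernel ν (w + y) (timeShift τ + (x - u))‖ ≤ H ^ (-kernelExp m ν) := by
  have hc := width_pos hs
  have hm : (0 : ℝ) ≤ m := Nat.cast_nonneg m
  have hK := one_le_tiltBound (m := m)
  have hR2 := (two_le_threshold hs).trans hR
  refine norm_bergmanKernel_le hs hH ?_
  have h0 : lorentzQ (m + 2) (w + y) ≤ (4 * tiltBound m + 1) * R := by
    have hr : (0 : Fin (m + 2) → ℝ) ∈ plate R θ (width m ν) := by
      have : 0 ≤ √R := Real.sqrt_nonneg R
      simp only [plate, mem_ofPred_eq, tiltT, tiltB, nullA, nullB, nullT]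
      simp
      exact ⟨by positivity, fun _ => by positivity, hc.le⟩
    simpa [lorentzQ] using (sector_of_coneShell hs hR hS hθ hw hwR hwT hy hr).2.1
  obtain ⟨xA, xB, xT⟩ := abs_null_le_of_plate (by linarith) (by positivity) hθ hx
  obtain ⟨uA, uB, uT⟩ := abs_null_le_of_plate (by linarith) (by positivity) hη hu
  have h1 := lorentzQ_timeShift_add_le (r := x - u) (τ := τ)
    (B := (2 + 5 * m) * (width m ν * R)) (X := (4 * tiltBound m + 1) * R + H) ?_ ?_ ?_
    (by positivity) hτ
  · rw [abs_sub_comm]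
    exact le_trans (by linarith) (le_abs_self _)
  · have : nullA (x - u) = nullA x - nullA u := by simp [nullA]; ring
    rw [this]
    exact (abs_sub _ _).trans (by linarith)
  · have : nullB (x - u) = nullB x - nullB u := by simp [nullB]; ring
    rw [this]
    exact (abs_sub _ _).trans (by linarith)
  · intro i
    have : nullT (x - u) i = nullT x i - nullT u i := by simp [nullT]
    rw [this]
    exact (abs_sub _ _).trans (by linarith [xT i, uT i])

/-- The function on the tube domain equal to `g y` at the points `x + iy` with `(x, y) ∈ S`, and
to zero elsewhere. -/
def blockFun (g : (Fin (m + 2) → ℝ) → ℝ≥0) (S : Set ((Fin (m + 2) → ℝ) × (Fin (m + 2) → ℝ)))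
    (z : Fin (m + 2) → ℂ) : ℂ :=
  S.indicator (fun e => ((g e.2 : ℝ) : ℂ)) (fun k => (z k).re, fun k => (z k).im)

/-- The real points above `v` in a subset of the tube domain. -/
def slice (S : Set ((Fin (m + 2) → ℝ) × (Fin (m + 2) → ℝ))) (v : Fin (m + 2) → ℝ) :
    Set (Fin (m + 2) → ℝ) := {u | (u, v) ∈ S}

lemma blockFun_tubePt (g : (Fin (m + 2) → ℝ) → ℝ≥0)
    (S : Set ((Fin (m + 2) → ℝ) × (Fin (m + 2) → ℝ))) (x y : Fin (m + 2) → ℝ) :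
    blockFun g S (tubePt (m + 2) x y) = S.indicator (fun e => ((g e.2 : ℝ) : ℂ)) (x, y) := by
  simp [blockFun, tubePt]

lemma measurable_blockFun {g : (Fin (m + 2) → ℝ) → ℝ≥0} (hg : Measurable g)
    {S : Set ((Fin (m + 2) → ℝ) × (Fin (m + 2) → ℝ))} (hS : MeasurableSet S) :
    Measurable (blockFun g S) := by
  have h : Measurable (S.indicator fun e => ((g e.2 : ℝ) : ℂ)) :=
    (by fun_prop : Measurable fun e : (Fin (m + 2) → ℝ) × (Fin (m + 2) → ℝ) =>
      ((g e.2 : ℝ) : ℂ)).indicator hS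
  exact h.comp (by fun_prop)

lemma measurableSet_slice {S : Set ((Fin (m + 2) → ℝ) × (Fin (m + 2) → ℝ))}
    (hS : MeasurableSet S) (v : Fin (m + 2) → ℝ) : MeasurableSet (slice S v) :=
  hS.preimage (measurable_id.prodMk measurable_const)

lemma measurable_lorentzQ : Measurable (lorentzQ (m + 2)) := by
  unfold lorentzQ; fun_prop

/-- The density of the Bergman weight. -/
def bergmanWeight (ν : ℝ) (v : Fin (m + 2) → ℝ) : ℝ≥0∞ :=
  ENNReal.ofReal (lorentzQ (m + 2) v ^ weightExp m ν)

lemma measurable_bergmanWeight (ν : ℝ) : Measurable (bergmanWeight (m := m) ν) := by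
  have := measurable_lorentzQ (m := m)
  unfold bergmanWeight; fun_prop

lemma mixedNorm_blockFun_le {p q ν : ℝ} (hp : 0 < p) (hq : 0 < q)
    {g : (Fin (m + 2) → ℝ) → ℝ≥0} {S : Set ((Fin (m + 2) → ℝ) × (Fin (m + 2) → ℝ))}
    (hS : MeasurableSet S) {V : Set (Fin (m + 2) → ℝ)} (hV : MeasurableSet V)
    (hSV : ∀ e ∈ S, e.2 ∈ V) {σ : (Fin (m + 2) → ℝ) → ℝ≥0∞}
    (hσ : ∀ v ∈ V, volume (slice S v) ≤ σ v) :
    mixedNorm (m + 2) p q ν (blockFun g S) ≤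
      (∫⁻ v in V, ((g v : ℝ≥0∞) ^ p * σ v) ^ (q / p) * bergmanWeight ν v) ^ (1 / q) := by
  unfold mixedNorm
  refine ENNReal.rpow_le_rpow ?_ (by positivity)
  refine (setLIntegral_le_lintegral _ _).trans ?_
  rw [← lintegral_indicator hV]
  refine lintegral_mono fun v => ?_
  have h1 : ∀ x, (‖blockFun g S (tubePt (m + 2) x v)‖₊ : ℝ≥0∞) ^ p =
      (slice S v).indicator (fun _ => (g v : ℝ≥0∞) ^ p) x := by
    intro x
    rw [blockFun_tubePt]
    by_cases hx : (x, v) ∈ S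
    · rw [indicator_of_mem hx, indicator_of_mem (show x ∈ slice S v from hx)]
      congr 2
      ext
      simp
    · rw [indicator_of_notMem hx, indicator_of_notMem (show x ∉ slice S v from hx)]
      simp [hp]
  simp only [h1]
  rw [lintegral_indicator_const (measurableSet_slice hS v)]
  by_cases hv : v ∈ V
  · rw [indicator_of_mem hv]
    gcongr
    · exact hσ v hv
    · exact le_rfl
  · have : slice S v = ∅ := eq_empty_of_forall_notMem fun u hu => hv (hSV _ hu)
    rw [this, measure_empty, mul_zero, ENNReal.zero_rpow_of_pos (by positivity), zero_mul]
    exact zero_le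

lemma lintegral_slice {S : Set ((Fin (m + 2) → ℝ) × (Fin (m + 2) → ℝ))} (hS : MeasurableSet S)
    {φ : (Fin (m + 2) → ℝ) → ℝ≥0∞} (hφ : Measurable φ) {V : Set (Fin (m + 2) → ℝ)} :
    ∫⁻ e in univ ×ˢ V, S.indicator (fun e => φ e.2) e =
      ∫⁻ v in V, φ v * volume (slice S v) := by
  have hm : Measurable (S.indicator fun e => φ e.2) := (hφ.comp measurable_snd).indicator hS
  rw [Measure.volume_eq_prod, ← Measure.prod_restrict, Measure.restrict_univ,
    lintegral_prod_symm _ hm.aemeasurable]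
  refine lintegral_congr fun v => ?_
  rw [← lintegral_indicator_const (measurableSet_slice hS v)]
  rfl

lemma measurable_bergmanKernel (ν : ℝ) (x y : Fin (m + 2) → ℝ) : Measurable
    fun e : (Fin (m + 2) → ℝ) × (Fin (m + 2) → ℝ) => bergmanKernel ν (y + e.2) (x - e.1) := by
  have h0 := measurable_lorentzQ (m := m)
  have h1 : Measurable fun e : (Fin (m + 2) → ℝ) × (Fin (m + 2) → ℝ) =>
      lorentzQ (m + 2) (y + e.2) := h0.comp (by fun_prop)
  have h2 : Measurable fun e : (Fin (m + 2) → ℝ) × (Fin (m + 2) → ℝ) =>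
      lorentzQ (m + 2) (x - e.1) := h0.comp (by fun_prop)
  have h3 : Measurable fun e : (Fin (m + 2) → ℝ) × (Fin (m + 2) → ℝ) =>
      lorentzPolar (y + e.2) (x - e.1) := by
    simp only [lorentzPolar, nullA, nullB, nullT, Pi.add_apply, Pi.sub_apply]
    fun_prop
  unfold bergmanKernel
  fun_prop

/-- A lower bound for the Bergman operator from the region where the kernel is almost positive. -/
lemma lintegral_slice_le_bergmanOp {ν : ℝ} {g : (Fin (m + 2) → ℝ) → ℝ≥0} (hg : Measurable g)
    {S S' : Set ((Fin (m + 2) → ℝ) × (Fin (m + 2) → ℝ))} (hS : MeasurableSet S)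
    (hS' : MeasurableSet S') (hSS' : S' ⊆ S) (hSc : ∀ e ∈ S, e.2 ∈ lightCone (m + 2))
    {k : (Fin (m + 2) → ℝ) → ℝ≥0∞} (hk : Measurable k) {h : ℝ≥0∞} {C : ℝ≥0}
    {x y : Fin (m + 2) → ℝ} (hC : ∀ e ∈ S, ‖bergmanKernel ν (y + e.2) (x - e.1)‖₊ ≤ C)
    (hnear : ∀ e ∈ S', k e.2 ≤ ENNReal.ofReal (bergmanKernel ν (y + e.2) (x - e.1)).re)
    (hfar : ∀ e ∈ S, ENNReal.ofReal (-(bergmanKernel ν (y + e.2) (x - e.1)).re) ≤ h)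
    (hfin : ∫⁻ v in lightCone (m + 2), g v * bergmanWeight ν v * volume (slice S v) ≠ ∞) :
    ∫⁻ v in lightCone (m + 2), k v * (g v * bergmanWeight ν v) * volume (slice S' v) ≤
      ‖bergmanOp (m + 2) ν (blockFun g S) (tubePt (m + 2) x y)‖ₑ +
        h * ∫⁻ v in lightCone (m + 2), g v * bergmanWeight ν v * volume (slice S v) := by
  set f := bergmanIntegrand (m + 2) ν (blockFun g S) (tubePt (m + 2) x y) with hf
  set μ := (volume : Measure ((Fin (m + 2) → ℝ) × (Fin (m + 2) → ℝ))).restrict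
    (univ ×ˢ lightCone (m + 2)) with hμ
  have hφ : Measurable fun v => (g v : ℝ≥0∞) * bergmanWeight ν v := by
    have := measurable_bergmanWeight (m := m) ν
    fun_prop
  have hf0 : ∀ e ∉ S, f e = 0 := fun e he => by
    rw [hf, bergmanIntegrand_eq, blockFun_tubePt, indicator_of_notMem (by exact he)]
    simp
  have hf1 : ∀ e ∈ S, f e = bergmanKernel ν (y + e.2) (x - e.1) *
      ((g e.2 * lorentzQ (m + 2) e.2 ^ weightExp m ν : ℝ) : ℂ) := fun e he => by
    rw [hf, bergmanIntegrand_eq, blockFun_tubePt, indicator_of_mem (by exact he)]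
    push_cast; ring
  have hw : ∀ e ∈ S, 0 ≤ lorentzQ (m + 2) e.2 ^ weightExp m ν := fun e he =>
    Real.rpow_nonneg (hSc e he).2.le _
  have hφ1 : ∀ e ∈ S, (g e.2 : ℝ≥0∞) * bergmanWeight ν e.2 =
      ENNReal.ofReal (g e.2 * lorentzQ (m + 2) e.2 ^ weightExp m ν) := fun e he => by
    rw [ENNReal.ofReal_mul (NNReal.coe_nonneg _), ENNReal.ofReal_coe_nnreal]; rfl
  have hfm : Measurable f := by
    have h1 := measurable_bergmanKernel (m := m) ν x y
    have h2 : f = S.indicator fun e => bergmanKernel ν (y + e.2) (x - e.1) *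
        ((g e.2 * lorentzQ (m + 2) e.2 ^ weightExp m ν : ℝ) : ℂ) := by
      funext e
      by_cases he : e ∈ S
      · rw [indicator_of_mem he, hf1 e he]
      · rw [indicator_of_notMem he, hf0 e he]
    have h3 := measurable_lorentzQ (m := m)
    rw [h2]
    exact Measurable.indicator (by fun_prop) hS
  have hφS : Measurable (S.indicator fun e => (g e.2 : ℝ≥0∞) * bergmanWeight ν e.2) :=
    (hφ.comp measurable_snd).indicator hS
  have hkφ : Measurable fun v => k v * (g v * bergmanWeight ν v) := hk.mul hφ
  have hI := lintegral_slice hS hφ (V := lightCone (m + 2))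
  have hint : Integrable f μ := by
    refine ⟨hfm.aestronglyMeasurable, ?_⟩
    refine lt_of_le_of_lt (b := ∫⁻ e, C * S.indicator
      (fun e => (g e.2 : ℝ≥0∞) * bergmanWeight ν e.2) e ∂μ) (lintegral_mono fun e => ?_) ?_
    · by_cases he : e ∈ S
      · rw [indicator_of_mem he, hf1 e he, hφ1 e he, enorm_mul]
        refine mul_le_mul' (ENNReal.coe_le_coe.2 (hC e he)) ?_
        rw [← ofReal_norm, norm_real, Real.norm_of_nonneg]
        exact mul_nonneg (NNReal.coe_nonneg _) (hw e he)
      · rw [hf0 e he]; simp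
    · rw [lintegral_const_mul _ hφS, hI]
      exact ENNReal.mul_lt_top ENNReal.coe_lt_top hfin.lt_top
  have hre : Integrable (fun e => (f e).re) μ := hint.re
  have hpos : ∫⁻ v in lightCone (m + 2), k v * (g v * bergmanWeight ν v) * volume (slice S' v) ≤
      ∫⁻ e, ENNReal.ofReal (f e).re ∂μ := by
    rw [← lintegral_slice hS' hkφ]
    refine lintegral_mono fun e => ?_
    by_cases he : e ∈ S'
    · rw [indicator_of_mem he, hf1 e (hSS' he), re_mul_ofReal,
        ENNReal.ofReal_mul' (mul_nonneg (NNReal.coe_nonneg _) (hw e (hSS' he))),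
        ← hφ1 e (hSS' he)]
      exact mul_le_mul' (hnear e he) le_rfl
    · rw [indicator_of_notMem he]; exact zero_le
  have hneg : ∫⁻ e, ENNReal.ofReal (-(f e).re) ∂μ ≤
      h * ∫⁻ v in lightCone (m + 2), g v * bergmanWeight ν v * volume (slice S v) := by
    rw [← hI, ← lintegral_const_mul _ hφS]
    refine lintegral_mono fun e => ?_
    by_cases he : e ∈ S
    · rw [indicator_of_mem he, hf1 e he, re_mul_ofReal, ← neg_mul,
        ENNReal.ofReal_mul' (mul_nonneg (NNReal.coe_nonneg _) (hw e he)), ← hφ1 e he]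
      exact mul_le_mul' (hfar e he) le_rfl
    · rw [hf0 e he]; simp
  refine hpos.trans (le_trans ?_ (add_le_add le_rfl hneg))
  have hfin1 : ∫⁻ e, ENNReal.ofReal (f e).re ∂μ ≠ ∞ := hre.lintegral_lt_top.ne
  have hfin2 : ∫⁻ e, ENNReal.ofReal (-(f e).re) ∂μ ≠ ∞ := hre.neg.lintegral_lt_top.ne
  have h1 := integral_eq_lintegral_pos_part_sub_lintegral_neg_part hre
  have h2 : ∫ e, (f e).re ∂μ ≤ ‖∫ e, f e ∂μ‖ := by
    have h3 : ∫ e, (f e).re ∂μ = (∫ e, f e ∂μ).re := integral_re hint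
    rw [h3]; exact re_le_norm _
  rw [← ENNReal.ofReal_toReal hfin1, ← ENNReal.ofReal_toReal hfin2, ← ofReal_norm,
    ← ENNReal.ofReal_add (norm_nonneg _) ENNReal.toReal_nonneg]
  refine ENNReal.ofReal_le_ofReal ?_
  change _ ≤ ‖∫ e, f e ∂μ‖ + _
  linarith

/-- The boundedness of the Bergman operator on the finite elements of `L^{p,q}_ν`. -/
def BergmanBound (m : ℕ) (ν p q C : ℝ) : Prop :=
  ∀ F : (Fin (m + 2) → ℂ) → ℂ, Measurable F →
    mixedNorm (m + 2) 2 2 ν F < ∞ → mixedNorm (m + 2) p q ν F < ∞ →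
    mixedNorm (m + 2) p q ν (bergmanOp (m + 2) ν F) ≤
      ENNReal.ofReal C * mixedNorm (m + 2) p q ν F

lemma le_mixedNorm {p q ν : ℝ} (hp : 0 < p) (hq : 0 < q) {F : (Fin (m + 2) → ℂ) → ℂ}
    {V : Set (Fin (m + 2) → ℝ)} (hV : MeasurableSet V) (hVc : V ⊆ lightCone (m + 2))
    {X : (Fin (m + 2) → ℝ) → Set (Fin (m + 2) → ℝ)} (hX : ∀ y, MeasurableSet (X y))
    {L : (Fin (m + 2) → ℝ) → ℝ≥0∞}
    (hL : ∀ y ∈ V, ∀ x ∈ X y, L y ≤ ‖F (tubePt (m + 2) x y)‖ₑ) :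
    (∫⁻ y in V, (L y ^ p * volume (X y)) ^ (q / p) * bergmanWeight ν y) ^ (1 / q) ≤
      mixedNorm (m + 2) p q ν F := by
  unfold mixedNorm
  refine ENNReal.rpow_le_rpow ?_ (by positivity)
  refine le_trans ?_ (lintegral_mono_set hVc)
  refine setLIntegral_mono' hV fun y hy => ?_
  refine mul_le_mul' (ENNReal.rpow_le_rpow ?_ (by positivity)) le_rfl
  rw [← setLIntegral_const]
  refine le_trans (setLIntegral_mono' (hX y) fun x hx => ?_) (setLIntegral_le_lintegral _ _)
  exact ENNReal.rpow_le_rpow (hL y hy x hx) hp.le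

lemma setLIntegral_slice_le {S : Set ((Fin (m + 2) → ℝ) × (Fin (m + 2) → ℝ))}
    {V : Set (Fin (m + 2) → ℝ)} (hV : MeasurableSet V) (hSV : ∀ e ∈ S, e.2 ∈ V)
    {σ : (Fin (m + 2) → ℝ) → ℝ≥0∞} (hσ : ∀ v ∈ V, volume (slice S v) ≤ σ v)
    (φ : (Fin (m + 2) → ℝ) → ℝ≥0∞) (W : Set (Fin (m + 2) → ℝ)) :
    ∫⁻ v in W, φ v * volume (slice S v) ≤ ∫⁻ v in V, φ v * σ v := by
  refine (setLIntegral_le_lintegral _ _).trans ?_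
  rw [← lintegral_indicator hV]
  refine lintegral_mono fun v => ?_
  by_cases hv : v ∈ V
  · rw [indicator_of_mem hv]
    exact mul_le_mul' le_rfl (hσ v hv)
  · have : slice S v = ∅ := eq_empty_of_forall_notMem fun u hu => hv (hSV _ hu)
    rw [this, measure_empty, mul_zero]
    exact zero_le

lemma rpow_two_abs_le {a b γ : ℝ} (ha : 0 < a) (hb : b ∈ Icc a (2 * a)) :
    2 ^ (-|γ|) * a ^ γ ≤ b ^ γ ∧ b ^ γ ≤ 2 ^ |γ| * a ^ γ := by
  have haγ := Real.rpow_pos_of_pos ha γ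
  have h1 : (1 : ℝ) ≤ 2 ^ |γ| := Real.one_le_rpow one_le_two (abs_nonneg _)
  have h2 : (2 : ℝ) ^ (-|γ|) ≤ 1 :=
    Real.rpow_le_one_of_one_le_of_nonpos one_le_two (by linarith [abs_nonneg γ])
  have h3 : (2 * a) ^ γ = 2 ^ γ * a ^ γ := Real.mul_rpow zero_le_two ha.le
  rcases le_total 0 γ with h | h
  · have h4 := Real.rpow_le_rpow ha.le hb.1 h
    have h5 := Real.rpow_le_rpow (ha.le.trans hb.1) hb.2 h
    rw [h3] at h5
    rw [abs_of_nonneg h] at *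
    exact ⟨by nlinarith, h5⟩
  · have h4 := Real.rpow_le_rpow_of_nonpos ha hb.1 h
    have h5 := Real.rpow_le_rpow_of_nonpos (ha.trans_le hb.1) hb.2 h
    rw [h3] at h5
    rw [abs_of_nonpos h] at *
    rw [neg_neg] at *
    exact ⟨h5, by nlinarith⟩

lemma bergmanWeight_mem {ν R S : ℝ} (hR : 0 < R) {w : Fin (m + 2) → ℝ}
    (hw : w ∈ coneShell m R S) :
    ENNReal.ofReal (2 ^ (-|weightExp m ν|) * nullA w ^ weightExp m ν) ≤ bergmanWeight ν w ∧
      bergmanWeight ν w ≤ ENNReal.ofReal (2 ^ |weightExp m ν| * nullA w ^ weightExp m ν) := by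
  have h := rpow_two_abs_le (γ := weightExp m ν) (hR.trans_le hw.1.1) (coneShell_lorentzQ hR hw)
  exact ⟨ENNReal.ofReal_le_ofReal h.1, ENNReal.ofReal_le_ofReal h.2⟩

lemma lintegral_coneShell_rpow {R S : ℝ} (hR : 0 < R) {C : ℝ} (hC : 0 ≤ C) (e : ℝ) :
    ∫⁻ w in coneShell m R S, ENNReal.ofReal (C * nullA w ^ e) =
      ENNReal.ofReal (nullConst m * C) * ∫⁻ a in Icc R S, ENNReal.ofReal (a ^ (e + m)) := by
  rw [lintegral_coneShell (h := fun a => ENNReal.ofReal (C * a ^ e)) hR (by fun_prop),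
    ENNReal.ofReal_mul nullConst_pos.le, mul_assoc]
  congr 1
  rw [← lintegral_const_mul _ (by fun_prop)]
  refine setLIntegral_congr_fun measurableSet_Icc fun a ha => ?_
  have ha0 : 0 < a := hR.trans_le ha.1
  rw [← ENNReal.ofReal_mul (by positivity), ← ENNReal.ofReal_mul hC, Real.rpow_add ha0,
    Real.rpow_natCast, mul_assoc]

/-- Integrals of powers against the Bergman weight over a shell. -/
lemma lintegral_weight_le {ν R S : ℝ} (hR : 0 < R) {C : ℝ} (hC : 0 ≤ C) (e : ℝ) :
    ∫⁻ w in coneShell m R S, ENNReal.ofReal (C * nullA w ^ e) * bergmanWeight ν w ≤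
      ENNReal.ofReal (nullConst m * (C * 2 ^ |weightExp m ν|)) *
        ∫⁻ a in Icc R S, ENNReal.ofReal (a ^ (e + weightExp m ν + m)) := by
  rw [← lintegral_coneShell_rpow hR (by positivity)]
  refine setLIntegral_mono' (measurableSet_coneShell R S) fun w hw => ?_
  have hA : 0 < nullA w := hR.trans_le hw.1.1
  refine (mul_le_mul' le_rfl (bergmanWeight_mem hR hw).2).trans_eq ?_
  rw [← ENNReal.ofReal_mul (by positivity), Real.rpow_add hA]
  congr 1; ring

lemma le_lintegral_weight {ν R S : ℝ} (hR : 0 < R) {C : ℝ} (hC : 0 ≤ C) (e : ℝ) :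
    ENNReal.ofReal (nullConst m * (C * 2 ^ (-|weightExp m ν|))) *
        ∫⁻ a in Icc R S, ENNReal.ofReal (a ^ (e + weightExp m ν + m)) ≤
      ∫⁻ w in coneShell m R S, ENNReal.ofReal (C * nullA w ^ e) * bergmanWeight ν w := by
  rw [← lintegral_coneShell_rpow hR (by positivity)]
  refine setLIntegral_mono' (measurableSet_coneShell R S) fun w hw => ?_
  have hA : 0 < nullA w := hR.trans_le hw.1.1
  refine le_of_eq_of_le ?_ (mul_le_mul' le_rfl (bergmanWeight_mem hR hw).1)
  rw [← ENNReal.ofReal_mul (by positivity), Real.rpow_add hA]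
  congr 1; ring

lemma lintegral_Icc_rpow_lt_top {R S : ℝ} (hR : 0 < R) (e : ℝ) :
    ∫⁻ a in Icc R S, ENNReal.ofReal (a ^ e) < ∞ := by
  have : IntegrableOn (fun a : ℝ => a ^ e) (Icc R S) := by
    refine ContinuousOn.integrableOn_Icc fun a ha => ?_
    exact (Real.continuousAt_rpow_const _ _ (.inl (hR.trans_le ha.1).ne')).continuousWithinAt
  exact this.lintegral_lt_top

lemma lintegral_Icc_inv {R S : ℝ} (hR : 0 < R) (hS : R ≤ S) :
    ∫⁻ a in Icc R S, ENNReal.ofReal (a ^ (-1 : ℝ)) = ENNReal.ofReal (Real.log (S / R)) := by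
  rw [← ofReal_integral_eq_lintegral_ofReal, integral_Icc_eq_integral_Ioc,
    ← intervalIntegral.integral_of_le hS]
  · congr 1
    simp only [Real.rpow_neg_one]
    exact integral_inv_of_pos hR (hR.trans_le hS)
  · refine ContinuousOn.integrableOn_Icc fun a ha => ?_
    exact (Real.continuousAt_rpow_const _ _ (.inl (hR.trans_le ha.1).ne')).continuousWithinAt
  · refine (ae_restrict_iff' measurableSet_Icc).2 (.of_forall fun a ha => ?_)
    exact Real.rpow_nonneg (hR.le.trans ha.1) _

lemma lintegral_Icc_rpow_le_inv {R S : ℝ} (hR : 1 ≤ R) {e : ℝ} (he : e ≤ -1) :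
    ∫⁻ a in Icc R S, ENNReal.ofReal (a ^ e) ≤ ∫⁻ a in Icc R S, ENNReal.ofReal (a ^ (-1 : ℝ)) :=
  setLIntegral_mono' measurableSet_Icc fun _ ha => ENNReal.ofReal_le_ofReal
    (Real.rpow_le_rpow_of_exponent_le (hR.trans ha.1) he)

lemma le_lintegral_Icc_double {R : ℝ} (hR : 0 < R) (e : ℝ) :
    ENNReal.ofReal (2 ^ (-|e|) * R ^ (e + 1)) ≤
      ∫⁻ a in Icc R (2 * R), ENNReal.ofReal (a ^ e) := by
  have h : ENNReal.ofReal (2 ^ (-|e|) * R ^ (e + 1)) =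
      ∫⁻ _ in Icc R (2 * R), ENNReal.ofReal (2 ^ (-|e|) * R ^ e) := by
    rw [setLIntegral_const, Real.volume_Icc, ← ENNReal.ofReal_mul (by positivity),
      Real.rpow_add hR, Real.rpow_one]
    congr 1; ring
  rw [h]
  exact setLIntegral_mono' measurableSet_Icc fun a ha =>
    ENNReal.ofReal_le_ofReal (rpow_two_abs_le hR ha).1

/-- The weighted volume of the bounded region used below. -/
def baseMass (m : ℕ) (ν : ℝ) : ℝ := (∫⁻ y in coneShell m 1 2, bergmanWeight ν y).toReal

lemma lintegral_base_lt_top (ν : ℝ) : ∫⁻ y in coneShell m 1 2, bergmanWeight ν y < ∞ := by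
  have h := lintegral_weight_le (m := m) (ν := ν) (S := 2) one_pos zero_le_one 0
  simp only [Real.rpow_zero, mul_one, ENNReal.ofReal_one, one_mul] at h
  exact h.trans_lt (ENNReal.mul_lt_top ENNReal.ofReal_lt_top (lintegral_Icc_rpow_lt_top one_pos _))

lemma baseMass_pos (ν : ℝ) : 0 < baseMass m ν := by
  refine ENNReal.toReal_pos ?_ (lintegral_base_lt_top ν).ne
  have h := le_lintegral_weight (m := m) (ν := ν) (S := 2) one_pos zero_le_one 0
  simp only [Real.rpow_zero, mul_one, ENNReal.ofReal_one, one_mul] at h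
  refine (lt_of_lt_of_le ?_ h).ne'
  have h1 := le_lintegral_Icc_double one_pos (0 + weightExp m ν + m)
  rw [mul_one] at h1
  refine ENNReal.mul_pos ?_ (lt_of_lt_of_le ?_ h1).ne'
  · have := nullConst_pos (m := m)
    rw [Ne, ENNReal.ofReal_eq_zero, not_le]; positivity
  · rw [ENNReal.ofReal_pos]; positivity

lemma ofReal_baseMass (ν : ℝ) :
    ENNReal.ofReal (baseMass m ν) = ∫⁻ y in coneShell m 1 2, bergmanWeight ν y :=
  ENNReal.ofReal_toReal (lintegral_base_lt_top ν).ne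

lemma mem_plate_of_mem_unit {ν R : ℝ} (hs : 0 < kernelExp m ν) (hR : threshold m ν ≤ R)
    {θ : Fin m → ℝ} (hθ : ∀ i, θ i ∈ Icc (0 : ℝ) 1) {x : Fin (m + 2) → ℝ}
    (hx : x ∈ plate 1 (0 : Fin m → ℝ) (width m ν / 2 / (3 * m + 2))) :
    x ∈ plate R θ (width m ν / 2) :=
  plate_subset (by linarith [two_le_threshold hs]) (by linarith [width_pos hs]) hθ hx

/-- Positivity of the kernel between a point near the light cone and the base region. -/
lemma bergmanKernel_direction {ν T : ℝ} (hs : 0 < kernelExp m ν) {w y : Fin (m + 2) → ℝ}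
    (hw : w ∈ coneShell m (threshold m ν) T) (hy : y ∈ coneShell m 1 2)
    {r : Fin (m + 2) → ℝ} (hr : r ∈ plate (nullA w) (direction w) (width m ν)) :
    (sectorBound m * nullA w) ^ (-kernelExp m ν) / 2 ≤ (bergmanKernel ν (w + y) r).re ∧
      ‖bergmanKernel ν (w + y) r‖ ≤ 1 := by
  have h2 := two_le_threshold hs
  have hA : 0 < nullA w := by linarith [hw.1.1]
  have hc := width_pos hs
  refine bergmanKernel_near hs hw.1.1 (by linarith) (fun i =>
    Ico_subset_Icc_self (direction_mem (by linarith) hw i)) hw ⟨le_rfl, by linarith⟩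
    (fun i => ?_) hy hr
  rw [tiltT_eq_direction hA.ne', sub_self, mul_zero, abs_zero]
  positivity

/-- Plates moving with the imaginary part. -/
def movingPlates (m : ℕ) (ν T : ℝ) : Set ((Fin (m + 2) → ℝ) × (Fin (m + 2) → ℝ)) :=
  {e | e.2 ∈ coneShell m (threshold m ν) T ∧
    e.1 ∈ plate (nullA e.2) (direction e.2) (width m ν / 2)}

lemma measurableSet_movingPlates (ν T : ℝ) : MeasurableSet (movingPlates m ν T) := by
  have hA : Measurable fun e : (Fin (m + 2) → ℝ) × (Fin (m + 2) → ℝ) => nullA e.2 :=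
    measurable_nullA.comp measurable_snd
  have hd : Measurable fun e : (Fin (m + 2) → ℝ) × (Fin (m + 2) → ℝ) =>
      (direction e.2, e.1) := by
    refine Measurable.prodMk (measurable_pi_iff.2 fun i => ?_) measurable_fst
    exact ((measurable_pi_iff.1 measurable_nullT i).comp measurable_snd).div hA
  refine (measurable_snd (measurableSet_coneShell _ _)).inter (MeasurableSet.inter ?_
    (MeasurableSet.inter ?_ ?_))
  · exact measurableSet_le (measurable_nullA.comp measurable_fst).norm (hA.const_mul _)
  · exact measurableSet_forall fun i =>
      measurableSet_le ((measurable_tiltT i).comp hd).norm (hA.sqrt.const_mul _)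
  · exact measurableSet_le (measurable_tiltB.comp hd).norm measurable_const

lemma volume_slice_movingPlates {ν T : ℝ} (hs : 0 < kernelExp m ν) {v : Fin (m + 2) → ℝ}
    (hv : v ∈ coneShell m (threshold m ν) T) :
    volume (slice (movingPlates m ν T) v) =
      ENNReal.ofReal (plateConst m (width m ν / 2) * nullA v ^ ((m : ℝ) / 2 + 1)) := by
  have h2 := two_le_threshold hs
  have hA : 0 < nullA v := by linarith [hv.1.1]
  have : slice (movingPlates m ν T) v = plate (nullA v) (direction v) (width m ν / 2) := by
    ext u; simp [slice, movingPlates, hv]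
  rw [this, volume_plate hA (by linarith [width_pos hs])]

/-- The amplitude of the test function on moving plates. -/
def amplitude (v : Fin (m + 2) → ℝ) : ℝ≥0 := (nullA v ^ (-(m : ℝ) / 2)).toNNReal

lemma measurable_amplitude : Measurable (amplitude (m := m)) := by
  have := measurable_nullA (m := m)
  unfold amplitude; fun_prop

lemma coe_amplitude {v : Fin (m + 2) → ℝ} :
    (amplitude v : ℝ≥0∞) = ENNReal.ofReal (nullA v ^ (-(m : ℝ) / 2)) := rfl

/-- The growth exponent of the norm of the test function on moving plates. -/
def blockExp (m : ℕ) (ν p q : ℝ) : ℝ :=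
  (-(m : ℝ) / 2 * p + ((m : ℝ) / 2 + 1)) * (q / p) + weightExp m ν + m

lemma lintegral_movingPlates_le {ν T p q : ℝ} (hs : 0 < kernelExp m ν) (hp : 0 < p) (hq : 0 < q) :
    ∫⁻ v in coneShell m (threshold m ν) T, ((amplitude v : ℝ≥0∞) ^ p *
        volume (slice (movingPlates m ν T) v)) ^ (q / p) * bergmanWeight ν v ≤
      ENNReal.ofReal (nullConst m * (plateConst m (width m ν / 2) ^ (q / p) *
        2 ^ |weightExp m ν|)) *
      ∫⁻ a in Icc (threshold m ν) T, ENNReal.ofReal (a ^ blockExp m ν p q) := by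
  have h2 := two_le_threshold hs
  have hpc := plateConst_pos (m := m) (half_pos (width_pos hs))
  refine le_trans (le_of_eq ?_) (lintegral_weight_le (by linarith) (by positivity) _)
  refine setLIntegral_congr_fun (measurableSet_coneShell _ _) fun v hv => ?_
  have hA : 0 < nullA v := by linarith [hv.1.1]
  rw [volume_slice_movingPlates hs hv, coe_amplitude,
    ENNReal.ofReal_rpow_of_nonneg (by positivity) hp.le, ← ENNReal.ofReal_mul (by positivity),
    ENNReal.ofReal_rpow_of_nonneg (by positivity) (by positivity), ← Real.rpow_mul hA.le,
    mul_left_comm, ← Real.rpow_add hA, Real.mul_rpow hpc.le (by positivity), ← Real.rpow_mul hA.le]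

lemma mixedNorm_movingPlates_le {ν T p q : ℝ} (hs : 0 < kernelExp m ν) (hp : 0 < p)
    (hq : 0 < q) :
    mixedNorm (m + 2) p q ν (blockFun amplitude (movingPlates m ν T)) ≤
      (ENNReal.ofReal (nullConst m * (plateConst m (width m ν / 2) ^ (q / p) *
        2 ^ |weightExp m ν|)) *
      ∫⁻ a in Icc (threshold m ν) T, ENNReal.ofReal (a ^ blockExp m ν p q)) ^ (1 / q) :=
  (mixedNorm_blockFun_le hp hq (measurableSet_movingPlates ν T) (measurableSet_coneShell _ _)
    (fun _ he => he.1) fun _ _ => le_rfl).trans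
    (ENNReal.rpow_le_rpow (lintegral_movingPlates_le hs hp hq) (by positivity))

lemma mixedNorm_movingPlates_lt_top {ν T p q : ℝ} (hs : 0 < kernelExp m ν) (hp : 0 < p)
    (hq : 0 < q) : mixedNorm (m + 2) p q ν (blockFun amplitude (movingPlates m ν T)) < ∞ := by
  have h2 := two_le_threshold hs
  refine (mixedNorm_movingPlates_le hs hp hq).trans_lt
    (ENNReal.rpow_lt_top_of_nonneg (by positivity) ?_)
  exact (ENNReal.mul_lt_top ENNReal.ofReal_lt_top
    (lintegral_Icc_rpow_lt_top (by linarith) _)).ne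

/-- The constant in `le_bergmanOp_movingPlates`. -/
def movingConst (m : ℕ) (ν : ℝ) : ℝ :=
  nullConst m * (sectorBound m ^ (-kernelExp m ν) / 2 * plateConst m (width m ν / 2) *
    2 ^ (-|weightExp m ν|))

lemma movingConst_pos {ν : ℝ} (hs : 0 < kernelExp m ν) : 0 < movingConst m ν := by
  have := nullConst_pos (m := m)
  have := plateConst_pos (m := m) (half_pos (width_pos hs))
  have := sectorBound_pos (m := m)
  unfold movingConst; positivity

lemma le_bergmanOp_movingPlates {ν T : ℝ} (hs : 0 < kernelExp m ν) {x y : Fin (m + 2) → ℝ}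
    (hx : x ∈ plate 1 (0 : Fin m → ℝ) (width m ν / 2 / (3 * m + 2))) (hy : y ∈ coneShell m 1 2) :
    ENNReal.ofReal (movingConst m ν) *
        ∫⁻ a in Icc (threshold m ν) T, ENNReal.ofReal (a ^ (-1 : ℝ)) ≤
      ‖bergmanOp (m + 2) ν (blockFun amplitude (movingPlates m ν T)) (tubePt (m + 2) x y)‖ₑ := by
  have h2 := two_le_threshold hs
  have hM := sectorBound_pos (m := m)
  have hpc := plateConst_pos (m := m) (half_pos (width_pos hs))
  have hR : 0 < threshold m ν := by linarith
  have hV := measurableSet_coneShell (m := m) (threshold m ν) T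
  have hVc := coneShell_subset_lightCone (m := m) (S := T) hR
  have hker : ∀ e ∈ movingPlates m ν T,
      (sectorBound m * nullA e.2) ^ (-kernelExp m ν) / 2 ≤
        (bergmanKernel ν (y + e.2) (x - e.1)).re ∧
      ‖bergmanKernel ν (y + e.2) (x - e.1)‖ ≤ 1 := by
    intro e he
    rw [add_comm y]
    refine bergmanKernel_direction hs he.1 hy (plate_sub_half ?_ he.2)
    exact mem_plate_of_mem_unit hs he.1.1.1
      (fun i => Ico_subset_Icc_self (direction_mem hR he.1 i)) hx
  have hpos : ∀ e ∈ movingPlates m ν T, 0 < nullA e.2 := fun e he => hR.trans_le he.1.1.1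
  have hk : Measurable fun v : Fin (m + 2) → ℝ =>
      ENNReal.ofReal ((sectorBound m * nullA v) ^ (-kernelExp m ν) / 2) := by
    have := measurable_nullA (m := m)
    fun_prop
  have hmain := lintegral_slice_le_bergmanOp (h := 0) (C := 1) (x := x) (y := y) (ν := ν)
    measurable_amplitude (measurableSet_movingPlates ν T) (measurableSet_movingPlates ν T)
    subset_rfl (fun e he => hVc he.1) hk (fun e he => (hker e he).2)
    (fun e he => ENNReal.ofReal_le_ofReal (hker e he).1)
    (fun e he => ?_) ?_
  · rw [zero_mul, add_zero] at hmain
    refine le_trans ?_ hmain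
    refine le_trans ?_ (lintegral_mono_set hVc)
    have he : (-1 : ℝ) = -kernelExp m ν + -(m : ℝ) / 2 + ((m : ℝ) / 2 + 1)
        + weightExp m ν + m := by
      simp only [kernelExp, weightExp]; push_cast; ring
    rw [movingConst, he]
    refine (le_lintegral_weight hR (by positivity) _).trans (le_of_eq ?_)
    refine setLIntegral_congr_fun hV fun v hv => ?_
    have hA : 0 < nullA v := hR.trans_le hv.1.1
    have hr : ∀ a b c d : ℝ≥0∞, a * (b * c) * d = a * b * d * c := by intros; ring
    rw [volume_slice_movingPlates hs hv, coe_amplitude, hr,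
      ← ENNReal.ofReal_mul (by positivity), ← ENNReal.ofReal_mul (by positivity),
      Real.rpow_add hA, Real.rpow_add hA, Real.mul_rpow hM.le hA.le]
    congr 2; ring
  · rw [ENNReal.ofReal_of_nonpos]
    have := (hker e he).1
    have := hpos e he
    have : 0 < (sectorBound m * nullA e.2) ^ (-kernelExp m ν) / 2 := by positivity
    linarith
  · refine ((setLIntegral_slice_le hV (fun e he => he.1) (fun _ _ => le_rfl) _ _).trans_lt ?_).ne
    refine lt_of_le_of_lt (le_of_eq ?_) ((lintegral_movingPlates_le hs (p := 1) (q := 1)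
      (T := T) one_pos one_pos).trans_lt (ENNReal.mul_lt_top ENNReal.ofReal_lt_top
        (lintegral_Icc_rpow_lt_top hR _)))
    refine lintegral_congr fun v => ?_
    simp only [ENNReal.rpow_one, div_one]
    ring

lemma unit_mass_pos {c : ℝ} (hc : 0 < c) (p q ν : ℝ) :
    0 < plateConst m c ^ (1 / p) * baseMass m ν ^ (1 / q) := by
  have := plateConst_pos (m := m) hc
  have := baseMass_pos (m := m) ν
  positivity

/-- A lower bound for the mixed norm of a function that is large on a fixed box. -/
lemma le_mixedNorm_unit {p q ν c L : ℝ} (hp : 0 < p) (hq : 0 < q) (hc : 0 < c) (hL : 0 ≤ L)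
    {F : (Fin (m + 2) → ℂ) → ℂ}
    (h : ∀ y ∈ coneShell m 1 2, ∀ x ∈ plate 1 (0 : Fin m → ℝ) c,
      ENNReal.ofReal L ≤ ‖F (tubePt (m + 2) x y)‖ₑ) :
    ENNReal.ofReal (L * (plateConst m c ^ (1 / p) * baseMass m ν ^ (1 / q))) ≤
      mixedNorm (m + 2) p q ν F := by
  have hpc := plateConst_pos (m := m) hc
  have hb := baseMass_pos (m := m) ν
  refine le_of_eq_of_le ?_ (le_mixedNorm hp hq (measurableSet_coneShell 1 2)
    (coneShell_subset_lightCone one_pos) (fun _ => measurableSet_plate _ _ _) h)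
  have hme := measurable_bergmanWeight (m := m) ν
  rw [lintegral_const_mul _ hme, ← ofReal_baseMass, volume_plate one_pos hc, Real.one_rpow,
    mul_one, ENNReal.ofReal_rpow_of_nonneg hL hp.le, ← ENNReal.ofReal_mul (by positivity),
    ENNReal.ofReal_rpow_of_nonneg (by positivity) (by positivity),
    ← ENNReal.ofReal_mul (by positivity),
    ENNReal.ofReal_rpow_of_nonneg (by positivity) (by positivity),
    Real.mul_rpow (by positivity) hb.le, ← Real.rpow_mul (by positivity),
    Real.mul_rpow (by positivity) hpc.le, ← Real.rpow_mul hL]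
  congr 1
  have h1 : p * (q / p * (1 / q)) = 1 := by field_simp
  have h2 : q / p * (1 / q) = 1 / p := by field_simp
  rw [h1, h2, Real.rpow_one, mul_assoc]

theorem not_bergmanBound_of_blockExp_le {ν p q C : ℝ} (hs : 0 < kernelExp m ν) (hp : 0 < p)
    (hq : 1 < q) (he : blockExp m ν p q ≤ -1) (hC : 0 < C) : ¬ BergmanBound m ν p q C := by
  intro hB
  have hq0 : 0 < q := one_pos.trans hq
  have h2 := two_le_threshold hs
  have hR : 0 < threshold m ν := by linarith
  have hw := width_pos hs
  have hn := nullConst_pos (m := m)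
  have hpc := plateConst_pos (m := m) (half_pos hw)
  have hmc := movingConst_pos hs
  have hc : 0 < width m ν / 2 / (3 * m + 2) := by positivity
  have hκ := unit_mass_pos (m := m) hc p q ν
  set κ := plateConst m (width m ν / 2 / (3 * m + 2)) ^ (1 / p) * baseMass m ν ^ (1 / q)
  set D := nullConst m * (plateConst m (width m ν / 2) ^ (q / p) * 2 ^ |weightExp m ν|) with hD
  have hD0 : 0 < D := by positivity
  have key : ∀ t : ℝ, 0 < t → movingConst m ν * t * κ ≤ C * (D * t) ^ (1 / q) := by
    intro t ht
    have hT : threshold m ν ≤ threshold m ν * Real.exp t :=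
      le_mul_of_one_le_right hR.le (Real.one_le_exp ht.le)
    have hI := lintegral_Icc_inv hR hT
    rw [mul_div_cancel_left₀ _ hR.ne', Real.log_exp] at hI
    have h1 := hB _ (measurable_blockFun measurable_amplitude
      (measurableSet_movingPlates ν (threshold m ν * Real.exp t)))
      (mixedNorm_movingPlates_lt_top hs two_pos two_pos) (mixedNorm_movingPlates_lt_top hs hp hq0)
    have h3 := le_mixedNorm_unit (ν := ν) hp hq0 hc (L := movingConst m ν * t) (by positivity)
      fun y hy x hx => (by
        have h := le_bergmanOp_movingPlates (T := threshold m ν * Real.exp t) hs hx hy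
        rwa [hI, ← ENNReal.ofReal_mul hmc.le] at h)
    have h4 := mixedNorm_movingPlates_le (ν := ν) (T := threshold m ν * Real.exp t) hs hp hq0
    have h5 : ENNReal.ofReal (movingConst m ν * t * κ) ≤
        ENNReal.ofReal (C * (D * t) ^ (1 / q)) := by
      refine (h3.trans h1).trans ?_
      rw [ENNReal.ofReal_mul hC.le, ← ENNReal.ofReal_rpow_of_nonneg (by positivity)
        (by positivity), ENNReal.ofReal_mul hD0.le, ← hI]
      refine mul_le_mul' le_rfl (h4.trans ?_)
      refine ENNReal.rpow_le_rpow (mul_le_mul' le_rfl ?_) (by positivity)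
      exact lintegral_Icc_rpow_le_inv (by linarith) he
    exact (ENNReal.ofReal_le_ofReal_iff (by positivity)).1 h5
  have h6 : 0 < 1 - 1 / q := by
    have : 1 / q < 1 := (div_lt_one hq0).2 hq
    linarith
  obtain ⟨t, ht, ht'⟩ := (((tendsto_rpow_atTop h6).eventually_gt_atTop
    (C * D ^ (1 / q) / (movingConst m ν * κ))).and (Filter.eventually_gt_atTop 0)).exists
  have h7 := key t ht'
  rw [div_lt_iff₀ (by positivity)] at ht
  rw [Real.mul_rpow hD0.le ht'.le] at h7
  have h8 : t = t ^ (1 - 1 / q) * t ^ (1 / q) := by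
    rw [← Real.rpow_add ht', sub_add_cancel, Real.rpow_one]
  have h9 : 0 < t ^ (1 / q) := by positivity
  have h10 : movingConst m ν * t * κ = t ^ (1 - 1 / q) * (movingConst m ν * κ) * t ^ (1 / q) := by
    conv_lhs => rw [h8]
    ring
  nlinarith

lemma mixedNorm_base_le {p q ν σ : ℝ} (hp : 0 < p) (hq : 0 < q) (hσ0 : 0 ≤ σ)
    {S : Set ((Fin (m + 2) → ℝ) × (Fin (m + 2) → ℝ))} (hS : MeasurableSet S)
    (hSU : ∀ e ∈ S, e.2 ∈ coneShell m 1 2)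
    (hσ : ∀ v ∈ coneShell m 1 2, volume (slice S v) ≤ ENNReal.ofReal σ) :
    mixedNorm (m + 2) p q ν (blockFun (fun _ => 1) S) ≤
      ENNReal.ofReal (σ ^ (1 / p) * baseMass m ν ^ (1 / q)) := by
  have hb := baseMass_pos (m := m) ν
  refine (mixedNorm_blockFun_le hp hq hS (measurableSet_coneShell 1 2) hSU hσ).trans_eq ?_
  rw [lintegral_const_mul _ (measurable_bergmanWeight ν), ← ofReal_baseMass, ENNReal.coe_one,
    ENNReal.one_rpow, one_mul, ENNReal.ofReal_rpow_of_nonneg hσ0 (by positivity),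
    ← ENNReal.ofReal_mul (by positivity),
    ENNReal.ofReal_rpow_of_nonneg (by positivity) (by positivity),
    Real.mul_rpow (by positivity) hb.le, ← Real.rpow_mul hσ0]
  have h2 : q / p * (1 / q) = 1 / p := by field_simp
  rw [← mul_div_assoc, mul_one] at h2
  rw [← mul_div_assoc, mul_one, h2]

lemma le_bergmanOp_base {ν k h σ τ : ℝ} (hk : 0 ≤ k) (hh : 0 ≤ h) (hσ0 : 0 ≤ σ)
    {S S' : Set ((Fin (m + 2) → ℝ) × (Fin (m + 2) → ℝ))} (hS : MeasurableSet S)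
    (hS' : MeasurableSet S') (hSS' : S' ⊆ S) (hSU : ∀ e ∈ S, e.2 ∈ coneShell m 1 2)
    (hσ : ∀ v ∈ coneShell m 1 2, volume (slice S v) ≤ ENNReal.ofReal σ)
    (hτ : ∀ v ∈ coneShell m 1 2, ENNReal.ofReal τ ≤ volume (slice S' v))
    {x y : Fin (m + 2) → ℝ} (hC : ∀ e ∈ S, ‖bergmanKernel ν (y + e.2) (x - e.1)‖ ≤ 1)
    (hnear : ∀ e ∈ S', k ≤ (bergmanKernel ν (y + e.2) (x - e.1)).re)
    (hfar : ∀ e ∈ S, -(bergmanKernel ν (y + e.2) (x - e.1)).re ≤ h) :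
    ENNReal.ofReal ((k * τ - h * σ) * baseMass m ν) ≤
      ‖bergmanOp (m + 2) ν (blockFun (fun _ => 1) S) (tubePt (m + 2) x y)‖ₑ := by
  have hb := baseMass_pos (m := m) ν
  have hU := measurableSet_coneShell (m := m) 1 2
  have hUc := coneShell_subset_lightCone (m := m) (S := 2) one_pos
  have hw := measurable_bergmanWeight (m := m) ν
  have hup : ∫⁻ v in lightCone (m + 2), ((1 : ℝ≥0) : ℝ≥0∞) * bergmanWeight ν v *
      volume (slice S v) ≤ ENNReal.ofReal (σ * baseMass m ν) := by
    refine (setLIntegral_slice_le hU hSU hσ _ _).trans_eq ?_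
    simp only [ENNReal.coe_one, one_mul]
    rw [lintegral_mul_const _ hw, ← ofReal_baseMass, ← ENNReal.ofReal_mul hb.le, mul_comm]
  have hmain := lintegral_slice_le_bergmanOp (h := ENNReal.ofReal h) (C := 1) (x := x) (y := y)
    (ν := ν) (g := fun _ => 1) (k := fun _ => ENNReal.ofReal k) measurable_const hS hS' hSS'
    (fun e he => hUc (hSU e he)) measurable_const (fun e he => hC e he)
    (fun e he => ENNReal.ofReal_le_ofReal (hnear e he))
    (fun e he => ENNReal.ofReal_le_ofReal (hfar e he)) (hup.trans_lt ENNReal.ofReal_lt_top).ne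
  have hlow : ENNReal.ofReal (k * τ * baseMass m ν) ≤ ∫⁻ v in lightCone (m + 2),
      ENNReal.ofReal k * (((1 : ℝ≥0) : ℝ≥0∞) * bergmanWeight ν v) * volume (slice S' v) := by
    refine le_trans ?_ (lintegral_mono_set hUc)
    refine le_trans (le_of_eq ?_) (setLIntegral_mono' hU fun v hv => mul_le_mul' le_rfl (hτ v hv))
    simp only [ENNReal.coe_one, one_mul]
    rw [lintegral_mul_const _ (hw.const_mul _), lintegral_const_mul _ hw, ← ofReal_baseMass,
      ← ENNReal.ofReal_mul hk, ← ENNReal.ofReal_mul (by positivity)]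
    congr 1; ring
  rw [sub_mul, ENNReal.ofReal_sub _ (by positivity), tsub_le_iff_right]
  refine (hlow.trans hmain).trans (add_le_add le_rfl ?_)
  rw [mul_assoc, ENNReal.ofReal_mul hh]
  exact mul_le_mul' le_rfl hup

theorem not_bergmanBound_one {ν C : ℝ} (hs : 0 < kernelExp m ν) (hC : 0 < C) :
    ¬ BergmanBound m ν 1 1 C := by
  intro hB
  have h2 := two_le_threshold hs
  have hR : 0 < threshold m ν := by linarith
  have hw := width_pos hs
  have hn := nullConst_pos (m := m)
  have hM := sectorBound_pos (m := m)
  have hb := baseMass_pos (m := m) ν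
  have hpc := plateConst_pos (m := m) (half_pos hw)
  set c := width m ν / 2 / (3 * m + 2) with hcdef
  have hc : 0 < c := by positivity
  have hpc' := plateConst_pos (m := m) hc
  set S : Set ((Fin (m + 2) → ℝ) × (Fin (m + 2) → ℝ)) :=
    plate 1 (0 : Fin m → ℝ) c ×ˢ coneShell m 1 2 with hSdef
  have hS : MeasurableSet S := (measurableSet_plate _ _ _).prod (measurableSet_coneShell _ _)
  have hSU : ∀ e ∈ S, e.2 ∈ coneShell m 1 2 := fun e he => he.2
  have hvol : ∀ v ∈ coneShell m 1 2, volume (slice S v) = ENNReal.ofReal (plateConst m c) := by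
    intro v hv
    have : slice S v = plate 1 (0 : Fin m → ℝ) c := by ext u; simp [slice, S, hv]
    rw [this, volume_plate one_pos hc, Real.one_rpow, mul_one]
  have hF : ∀ p : ℝ, 0 < p → mixedNorm (m + 2) p p ν (blockFun (fun _ => 1) S) ≤
      ENNReal.ofReal (plateConst m c ^ (1 / p) * baseMass m ν ^ (1 / p)) := fun p hp =>
    mixedNorm_base_le hp hp hpc'.le hS hSU fun v hv => (hvol v hv).le
  set D := nullConst m * (sectorBound m ^ (-kernelExp m ν) / 2 * plateConst m c * baseMass m ν *
    plateConst m (width m ν / 2) * 2 ^ (-|weightExp m ν|)) with hD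
  have hD0 : 0 < D := by positivity
  have key : ∀ t : ℝ, 0 < t → D * t ≤ C * (plateConst m c * baseMass m ν) := by
    intro t ht
    set T := threshold m ν * Real.exp t with hTdef
    have hT : threshold m ν ≤ T := le_mul_of_one_le_right hR.le (Real.one_le_exp ht.le)
    have hI := lintegral_Icc_inv hR hT
    rw [hTdef, mul_div_cancel_left₀ _ hR.ne', Real.log_exp, ← hTdef] at hI
    have hL : ∀ w ∈ coneShell m (threshold m ν) T,
        ∀ x ∈ plate (nullA w) (direction w) (width m ν / 2),
        ENNReal.ofReal ((sectorBound m * nullA w) ^ (-kernelExp m ν) / 2 * plateConst m c *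
          baseMass m ν) ≤
          ‖bergmanOp (m + 2) ν (blockFun (fun _ => 1) S) (tubePt (m + 2) x w)‖ₑ := by
      intro w hw' x hx
      have hA : 0 < nullA w := hR.trans_le hw'.1.1
      have hker : ∀ e ∈ S, (sectorBound m * nullA w) ^ (-kernelExp m ν) / 2 ≤
          (bergmanKernel ν (w + e.2) (x - e.1)).re ∧
          ‖bergmanKernel ν (w + e.2) (x - e.1)‖ ≤ 1 := fun e he =>
        bergmanKernel_direction hs hw' he.2 (plate_sub_half hx
          (mem_plate_of_mem_unit hs hw'.1.1
            (fun i => Ico_subset_Icc_self (direction_mem hR hw' i)) he.1))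
      have h := le_bergmanOp_base (k := (sectorBound m * nullA w) ^ (-kernelExp m ν) / 2) (h := 0)
        (by positivity) le_rfl hpc'.le hS hS subset_rfl hSU
        (fun v hv => (hvol v hv).le) (fun v hv => (hvol v hv).ge)
        (fun e he => (hker e he).2) (fun e he => (hker e he).1) fun e he => by
          have h3 := (hker e he).1
          have : 0 < (sectorBound m * nullA w) ^ (-kernelExp m ν) / 2 := by positivity
          linarith
      simpa only [zero_mul, sub_zero] using h
    have h3 := le_mixedNorm (ν := ν) one_pos one_pos (measurableSet_coneShell (threshold m ν) T)
      (coneShell_subset_lightCone hR) (fun w => measurableSet_plate _ _ _) hL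
    have h1 := hB _ (measurable_blockFun measurable_const hS)
      ((hF 2 two_pos).trans_lt ENNReal.ofReal_lt_top)
      ((hF 1 one_pos).trans_lt ENNReal.ofReal_lt_top)
    have h4 := (h3.trans h1).trans (mul_le_mul' le_rfl (hF 1 one_pos))
    rw [← ENNReal.ofReal_mul hC.le] at h4
    simp only [div_one, ENNReal.rpow_one, Real.rpow_one] at h4
    have h5 : ENNReal.ofReal (D * t) ≤ ENNReal.ofReal (C * (plateConst m c * baseMass m ν)) := by
      refine le_trans ?_ h4
      rw [ENNReal.ofReal_mul hD0.le, ← hI]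
      have he : (-1 : ℝ) ≤ -kernelExp m ν + ((m : ℝ) / 2 + 1) + weightExp m ν + m := by
        have : (0 : ℝ) ≤ m := Nat.cast_nonneg m
        simp only [kernelExp, weightExp]; push_cast; linarith
      refine (mul_le_mul' le_rfl (setLIntegral_mono' measurableSet_Icc fun a ha =>
        ENNReal.ofReal_le_ofReal (Real.rpow_le_rpow_of_exponent_le
          (by linarith [ha.1]) he))).trans ?_
      refine (le_lintegral_weight hR (by positivity) _).trans (le_of_eq ?_)
      refine setLIntegral_congr_fun (measurableSet_coneShell _ _) fun w hw' => ?_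
      have hA : 0 < nullA w := hR.trans_le hw'.1.1
      rw [volume_plate hA (half_pos hw), ← ENNReal.ofReal_mul (by positivity),
        Real.rpow_add hA, Real.mul_rpow hM.le hA.le]
      congr 2; ring
    exact (ENNReal.ofReal_le_ofReal_iff (by positivity)).1 h5
  have h7 := key (C * (plateConst m c * baseMass m ν) / D + 1) (by positivity)
  rw [mul_add, mul_div_cancel₀ _ hD0.ne'] at h7
  linarith

/-- The directions `k / L`. -/
def gridDir {L : ℕ} (k : Fin m → Fin L) : Fin m → ℝ := fun i => (k i : ℝ) / L

lemma gridDir_mem {L : ℕ} (k : Fin m → Fin L) (i : Fin m) : gridDir k i ∈ Icc (0 : ℝ) 1 := by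
  refine ⟨by unfold gridDir; positivity, div_le_one_of_le₀ ?_ (Nat.cast_nonneg L)⟩
  exact_mod_cast (k i).2.le

/-- The grid point closest to the direction of `w`, from below. -/
def gridIndex (L : ℕ) [NeZero L] (w : Fin (m + 2) → ℝ) : Fin m → Fin L :=
  fun i => Fin.ofNat L ⌊L * direction w i⌋₊

lemma abs_tiltT_gridIndex_le {L : ℕ} [NeZero L] {R S : ℝ} (hR : 0 < R) {w : Fin (m + 2) → ℝ}
    (hw : w ∈ coneShell m R S) (i : Fin m) :
    |tiltT (gridDir (gridIndex L w)) w i| ≤ nullA w / L := by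
  have hA : 0 < nullA w := hR.trans_le hw.1.1
  have hL : (0 : ℝ) < L := Nat.cast_pos.2 (NeZero.pos L)
  obtain ⟨hd0, hd1⟩ := direction_mem hR hw i
  have h0 : 0 ≤ L * direction w i := by positivity
  have hlt : ⌊L * direction w i⌋₊ < L := (Nat.floor_lt h0).2 (by nlinarith)
  have hg : gridDir (gridIndex L w) i = ⌊L * direction w i⌋₊ / L := by
    simp [gridDir, gridIndex, Fin.ofNat, Nat.mod_eq_of_lt hlt]
  have h1 := Nat.floor_le h0
  have h2 := (Nat.lt_floor_add_one (L * direction w i)).le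
  rw [tiltT_eq_direction hA.ne', hg, abs_mul, abs_of_pos hA, div_eq_mul_inv (nullA w)]
  refine mul_le_mul_of_nonneg_left ?_ hA.le
  have h3 : direction w i - ⌊L * direction w i⌋₊ / L =
      (L * direction w i - ⌊L * direction w i⌋₊) * (L : ℝ)⁻¹ := by field_simp
  rw [h3, abs_of_nonneg (mul_nonneg (by linarith) (by positivity))]
  exact mul_le_of_le_one_left (by positivity) (by linarith)

/-- The translates of plates in the directions of a grid, with mutual separation `D`. -/
def gridPlate {L : ℕ} (ν R D : ℝ) (k : Fin m → Fin L) : Set (Fin (m + 2) → ℝ) :=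
  {x | x - timeShift (D * (Fintype.equivFin (Fin m → Fin L) k).val) ∈
    plate R (gridDir k) (width m ν / 2)}

lemma measurableSet_gridPlate {L : ℕ} (ν R D : ℝ) (k : Fin m → Fin L) :
    MeasurableSet (gridPlate ν R D k) :=
  (measurableSet_plate _ _ _).preimage (measurable_id.sub_const _)

/-- The volume of the plates of size `R` used in the grid. -/
def plateVolume (m : ℕ) (ν R : ℝ) : ℝ := plateConst m (width m ν / 2) * R ^ ((m : ℝ) / 2 + 1)

lemma plateVolume_pos {ν R : ℝ} (hs : 0 < kernelExp m ν) (hR : 0 < R) :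
    0 < plateVolume m ν R := by
  have := plateConst_pos (m := m) (half_pos (width_pos hs))
  unfold plateVolume; positivity

lemma volume_gridPlate {L : ℕ} {ν R : ℝ} (hs : 0 < kernelExp m ν) (hR : 0 < R) (D : ℝ)
    (k : Fin m → Fin L) : volume (gridPlate ν R D k) = ENNReal.ofReal (plateVolume m ν R) := by
  rw [plateVolume, ← volume_plate hR (half_pos (width_pos hs)) (gridDir k)]
  simp only [gridPlate, sub_eq_add_neg]
  exact measure_preimage_add_right _ _ _

/-- The union of the grid plates, over the base region. -/
def gridSet (m L : ℕ) (ν R D : ℝ) : Set ((Fin (m + 2) → ℝ) × (Fin (m + 2) → ℝ)) :=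
  {e | e.2 ∈ coneShell m 1 2 ∧ ∃ k : Fin m → Fin L, e.1 ∈ gridPlate ν R D k}

lemma measurableSet_gridSet (L : ℕ) (ν R D : ℝ) : MeasurableSet (gridSet m L ν R D) := by
  have : gridSet m L ν R D =
      Prod.snd ⁻¹' coneShell m 1 2 ∩ ⋃ k : Fin m → Fin L, Prod.fst ⁻¹' gridPlate ν R D k := by
    ext; simp [gridSet]
  rw [this]
  exact (measurable_snd (measurableSet_coneShell _ _)).inter
    (MeasurableSet.iUnion fun k => measurable_fst (measurableSet_gridPlate _ _ _ k))

lemma volume_slice_gridSet_le {L : ℕ} {ν R : ℝ} (hs : 0 < kernelExp m ν) (hR : 0 < R) (D : ℝ)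
    (v : Fin (m + 2) → ℝ) :
    volume (slice (gridSet m L ν R D) v) ≤ ENNReal.ofReal ((L : ℝ) ^ m * plateVolume m ν R) := by
  have h : slice (gridSet m L ν R D) v ⊆ ⋃ k : Fin m → Fin L, gridPlate ν R D k := by
    rintro u ⟨-, k, hk⟩
    exact mem_iUnion.2 ⟨k, hk⟩
  refine (measure_mono h).trans ((measure_iUnion_fintype_le _ _).trans (le_of_eq ?_))
  simp only [volume_gridPlate hs hR]
  rw [Finset.sum_const, Finset.card_univ, Fintype.card_fun, Fintype.card_fin, Fintype.card_fin,
    nsmul_eq_mul, ENNReal.ofReal_mul (by positivity), ← Nat.cast_pow, ENNReal.ofReal_natCast]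

lemma bergmanKernel_gridPlate_far {L : ℕ} {ν R S T H : ℝ} (hs : 0 < kernelExp m ν)
    (hR : threshold m ν ≤ R) (hS : 0 < S) (hH : 0 < H) {k j : Fin m → Fin L} (hkj : k ≠ j)
    {w y : Fin (m + 2) → ℝ} (hw : w ∈ coneShell m S T) (hwR : nullA w ∈ Icc R (2 * R))
    (hwT : ∀ i, |tiltT (gridDir k) w i| ≤ width m ν * √R / 2) (hy : y ∈ coneShell m 1 2)
    {x u : Fin (m + 2) → ℝ} (hx : x ∈ gridPlate ν R (separation m ν R H) k)
    (hu : u ∈ gridPlate ν R (separation m ν R H) j) :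
    ‖bergmanKernel ν (w + y) (x - u)‖ ≤ H ^ (-kernelExp m ν) := by
  have hR0 : 0 < R := by linarith [two_le_threshold hs]
  set D := separation m ν R H with hD
  have hD0 : 0 < D := separation_pos hs hR0 hH
  set a : ℕ := (Fintype.equivFin (Fin m → Fin L) k).val with ha
  set b : ℕ := (Fintype.equivFin (Fin m → Fin L) j).val with hb
  have hab : (a : ℤ) - b ≠ 0 := by
    intro h
    refine hkj ((Fintype.equivFin (Fin m → Fin L)).injective (Fin.ext ?_))
    omega
  have h1 : (1 : ℝ) ≤ |(a : ℝ) - b| := by exact_mod_cast Int.one_le_abs hab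
  have h2 : x - u = timeShift (D * a - D * b) +
      ((x - timeShift (D * a)) - (u - timeShift (D * b))) := by
    simp only [timeShift, Pi.single_sub]
    abel
  rw [h2]
  refine bergmanKernel_far hs hR hS hH (gridDir_mem k) (gridDir_mem j) hw hwR hwT hy ?_ hx hu
  rw [← mul_sub, abs_mul, abs_of_pos hD0]
  exact le_mul_of_one_le_right hD0.le h1

/-- The height that makes the total interaction of `N` plates negligible. -/
def gridHeight (m : ℕ) (ν R N : ℝ) : ℝ := sectorBound m * R * (4 * N) ^ (1 / kernelExp m ν)

lemma gridHeight_rpow {ν R N : ℝ} (hs : 0 < kernelExp m ν) (hR : 0 < R) (hN : 0 < N) :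
    gridHeight m ν R N ^ (-kernelExp m ν) = (sectorBound m * R) ^ (-kernelExp m ν) / (4 * N) := by
  have hM := sectorBound_pos (m := m)
  rw [gridHeight, Real.mul_rpow (by positivity) (by positivity),
    ← Real.rpow_mul (by positivity), mul_neg, one_div_mul_cancel hs.ne', Real.rpow_neg_one,
    div_eq_mul_inv]

lemma one_le_gridHeight {ν R N : ℝ} (hs : 0 < kernelExp m ν) (hR : 1 ≤ R) (hN : 1 ≤ N) :
    1 ≤ gridHeight m ν R N := by
  have hM : 1 ≤ sectorBound m := by
    have := one_le_tiltBound (m := m)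
    unfold sectorBound; linarith
  have h1 : 1 ≤ (4 * N) ^ (1 / kernelExp m ν) :=
    Real.one_le_rpow (by linarith) (by positivity)
  exact one_le_mul_of_one_le_of_one_le (one_le_mul_of_one_le_of_one_le hM hR) h1

/-- The lower bound in `le_bergmanOp_gridSet`. -/
def gridBound (m : ℕ) (ν R : ℝ) : ℝ :=
  (sectorBound m * R) ^ (-kernelExp m ν) / 4 * plateVolume m ν R * baseMass m ν

lemma le_bergmanOp_gridSet {L : ℕ} [NeZero L] {ν R : ℝ} (hs : 0 < kernelExp m ν)
    (hR : threshold m ν ≤ R) (hL : 4 * √R ≤ width m ν * L) {w : Fin (m + 2) → ℝ}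
    (hw : w ∈ coneShell m R (2 * R)) {x : Fin (m + 2) → ℝ}
    (hx : x ∈ gridPlate ν R (separation m ν R (gridHeight m ν R ((L : ℝ) ^ m))) (gridIndex L w)) :
    ENNReal.ofReal (gridBound m ν R) ≤
      ‖bergmanOp (m + 2) ν (blockFun (fun _ => 1)
        (gridSet m L ν R (separation m ν R (gridHeight m ν R ((L : ℝ) ^ m)))))
        (tubePt (m + 2) x w)‖ₑ := by
  have hR2 := (two_le_threshold hs).trans hR
  have hR0 : 0 < R := by linarith
  have hM := sectorBound_pos (m := m)
  have hV := plateVolume_pos hs hR0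
  have hL1 : (1 : ℝ) ≤ L := by exact_mod_cast NeZero.one_le
  have hN1 : (1 : ℝ) ≤ (L : ℝ) ^ m := one_le_pow₀ hL1
  have hN0 : (0 : ℝ) < (L : ℝ) ^ m := by linarith
  set H := gridHeight m ν R ((L : ℝ) ^ m) with hH
  have hH1 : 1 ≤ H := one_le_gridHeight hs (by linarith) hN1
  have hHs := gridHeight_rpow hs hR0 hN0
  rw [← hH] at hHs
  have hH0 : 0 ≤ H ^ (-kernelExp m ν) := by positivity
  set D := separation m ν R H with hD
  have hwT : ∀ i, |tiltT (gridDir (gridIndex L w)) w i| ≤ width m ν * √R / 2 := by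
    intro i
    refine (abs_tiltT_gridIndex_le hR0 hw i).trans ?_
    rw [div_le_iff₀ (by linarith)]
    have h1 := Real.mul_self_sqrt hR0.le
    have h2 := Real.sqrt_nonneg R
    nlinarith [hw.1.2]
  set S' : Set ((Fin (m + 2) → ℝ) × (Fin (m + 2) → ℝ)) :=
    gridPlate ν R D (gridIndex L w) ×ˢ coneShell m 1 2 with hS'
  have hnear : ∀ e ∈ S', (sectorBound m * R) ^ (-kernelExp m ν) / 2 ≤
      (bergmanKernel ν (w + e.2) (x - e.1)).re ∧ ‖bergmanKernel ν (w + e.2) (x - e.1)‖ ≤ 1 := by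
    intro e he
    refine bergmanKernel_near hs hR hR0 (gridDir_mem _) hw hw.1 hwT he.2 ?_
    rw [← sub_sub_sub_cancel_right x e.1]
    exact plate_sub_half hx he.1
  have hdich : ∀ e ∈ gridSet m L ν R D,
      e ∈ S' ∨ ‖bergmanKernel ν (w + e.2) (x - e.1)‖ ≤ H ^ (-kernelExp m ν) := by
    rintro e ⟨he, j, hj⟩
    by_cases hk : gridIndex L w = j
    · exact .inl ⟨hk ▸ hj, he⟩
    · exact .inr (bergmanKernel_gridPlate_far hs hR hR0 (by linarith) hk hw hw.1 hwT he hx hj)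
  have hvol : ∀ v ∈ coneShell m 1 2,
      volume (slice S' v) = ENNReal.ofReal (plateVolume m ν R) := by
    intro v hv
    have : slice S' v = gridPlate ν R D (gridIndex L w) := by ext u; simp [slice, S', hv]
    rw [this, volume_gridPlate hs hR0]
  have h := le_bergmanOp_base (ν := ν) (x := x) (y := w)
    (k := (sectorBound m * R) ^ (-kernelExp m ν) / 2) (h := H ^ (-kernelExp m ν))
    (by positivity) hH0 (by positivity) (measurableSet_gridSet L ν R D)
    ((measurableSet_gridPlate ν R D _).prod (measurableSet_coneShell 1 2))
    (fun e he => ⟨he.2, _, he.1⟩) (fun e he => he.1)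
    (fun v _ => volume_slice_gridSet_le hs hR0 D v) (fun v hv => (hvol v hv).ge)
    (fun e he => (hdich e he).elim (fun h => (hnear e h).2) fun h => h.trans
      (Real.rpow_le_one_of_one_le_of_nonpos hH1 (by linarith)))
    (fun e he => (hnear e he).1)
    (fun e he => by
      rcases hdich e he with h | h
      · have h1 := (hnear e h).1
        have : 0 < (sectorBound m * R) ^ (-kernelExp m ν) / 2 := by positivity
        linarith
      · exact ((neg_le_abs _).trans (Complex.abs_re_le_norm _)).trans h)
  refine le_of_eq_of_le ?_ h
  rw [hHs, gridBound]
  congr 1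
  field_simp
  ring

/-- A lower bound for the mixed norm of a function that is large on plates over a shell. -/
lemma le_mixedNorm_shell {p q ν R σ κ : ℝ} (hp : 0 < p) (hq : 0 < q) (hR : 0 < R)
    (hσ : 0 ≤ σ) (hκ : 0 ≤ κ) {F : (Fin (m + 2) → ℂ) → ℂ}
    {X : (Fin (m + 2) → ℝ) → Set (Fin (m + 2) → ℝ)} (hX : ∀ y, MeasurableSet (X y))
    (hXσ : ∀ y, volume (X y) = ENNReal.ofReal σ)
    (hF : ∀ y ∈ coneShell m R (2 * R), ∀ x ∈ X y,
      ENNReal.ofReal κ ≤ ‖F (tubePt (m + 2) x y)‖ₑ) :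
    ENNReal.ofReal (κ * σ ^ (1 / p) * (nullConst m * 2 ^ (-|weightExp m ν|) *
      2 ^ (-|weightExp m ν + m|) * R ^ (weightExp m ν + m + 1)) ^ (1 / q)) ≤
      mixedNorm (m + 2) p q ν F := by
  have hn := nullConst_pos (m := m)
  refine le_trans ?_ (le_mixedNorm hp hq (measurableSet_coneShell R (2 * R))
    (coneShell_subset_lightCone hR) hX hF)
  have h1 := le_lintegral_weight (m := m) (ν := ν) (S := 2 * R) hR zero_le_one 0
  simp only [Real.rpow_zero, mul_one, ENNReal.ofReal_one, one_mul, zero_add] at h1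
  have h2 := (mul_le_mul' le_rfl (le_lintegral_Icc_double hR (weightExp m ν + m))).trans h1
  rw [← ENNReal.ofReal_mul (by positivity)] at h2
  simp only [hXσ]
  rw [lintegral_const_mul _ (measurable_bergmanWeight ν)]
  refine le_trans (le_of_eq ?_) (ENNReal.rpow_le_rpow (mul_le_mul' le_rfl h2) (by positivity))
  rw [ENNReal.ofReal_rpow_of_nonneg hκ hp.le, ← ENNReal.ofReal_mul (by positivity),
    ENNReal.ofReal_rpow_of_nonneg (by positivity) (by positivity),
    ← ENNReal.ofReal_mul (by positivity),
    ENNReal.ofReal_rpow_of_nonneg (by positivity) (by positivity),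
    Real.mul_rpow (x := (κ ^ p * σ) ^ (q / p)) (by positivity) (by positivity),
    ← Real.rpow_mul (by positivity), Real.mul_rpow (by positivity) hσ, ← Real.rpow_mul hκ]
  have h3 : p * (q / p * (1 / q)) = 1 := by field_simp
  have h4 : q / p * (1 / q) = 1 / p := by field_simp
  rw [h3, h4, Real.rpow_one, mul_assoc (nullConst m * _)]

theorem not_bergmanBound_of_lt {ν p q C : ℝ} (hs : 0 < kernelExp m ν) (hp : 0 < p) (hq : 0 < q)
    (h : ν + m / (2 * p) < (ν + m / 2) / q) (hC : 0 < C) : ¬ BergmanBound m ν p q C := by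
  intro hB
  have hw := width_pos hs
  have hn := nullConst_pos (m := m)
  have hM := sectorBound_pos (m := m)
  have hb := baseMass_pos (m := m) ν
  have hpc := plateConst_pos (m := m) (half_pos hw)
  set δ := (ν + m / 2) / q - (ν + m / (2 * p)) with hδ
  set a := sectorBound m ^ (-kernelExp m ν) / 4 * plateConst m (width m ν / 2) * baseMass m ν *
    (nullConst m * 2 ^ (-|weightExp m ν|) * 2 ^ (-|weightExp m ν + m|)) ^ (1 / q) with ha
  set b := C * (4 / width m ν) ^ (m / p) * baseMass m ν ^ (1 / q) with hbdef
  have ha0 : 0 < a := by positivity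
  have key : ∀ L : ℕ, 1 ≤ L → threshold m ν ≤ (width m ν * L / 4) ^ 2 →
      a * ((width m ν * L / 4) ^ 2) ^ δ ≤ b := by
    intro L hL hR
    have : NeZero L := ⟨by omega⟩
    have hL0 : (0 : ℝ) < L := by exact_mod_cast hL
    have hsq : √((width m ν * L / 4) ^ 2) = width m ν * L / 4 := Real.sqrt_sq (by positivity)
    have hr : 0 < width m ν * L / 4 := by positivity
    have hLr : (L : ℝ) = 4 / width m ν * (width m ν * L / 4) := by field_simp
    set r := width m ν * L / 4 with hrdef
    set R := r ^ 2 with hRdef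
    have hR0 : 0 < R := by positivity
    have hV := plateVolume_pos hs hR0
    have hS := measurableSet_gridSet (m := m) L ν R
      (separation m ν R (gridHeight m ν R ((L : ℝ) ^ m)))
    have hF : ∀ p q : ℝ, 0 < p → 0 < q → mixedNorm (m + 2) p q ν (blockFun (fun _ => 1)
        (gridSet m L ν R (separation m ν R (gridHeight m ν R ((L : ℝ) ^ m))))) ≤
        ENNReal.ofReal (((L : ℝ) ^ m * plateVolume m ν R) ^ (1 / p) *
          baseMass m ν ^ (1 / q)) := fun p q hp hq =>
      mixedNorm_base_le hp hq (by positivity) hS (fun e he => he.1)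
        fun v _ => volume_slice_gridSet_le hs hR0 _ v
    have h1 := hB _ (measurable_blockFun measurable_const hS)
      ((hF 2 2 two_pos two_pos).trans_lt ENNReal.ofReal_lt_top)
      ((hF p q hp hq).trans_lt ENNReal.ofReal_lt_top)
    have h2 := le_mixedNorm_shell (ν := ν) (κ := gridBound m ν R) hp hq hR0 hV.le
      (by unfold gridBound; positivity)
      (fun w => measurableSet_gridPlate ν R _ (gridIndex L w))
      (fun w => volume_gridPlate hs hR0 _ (gridIndex L w))
      (fun w hw' x hx => le_bergmanOp_gridSet hs hR (by rw [hsq, hrdef]; linarith) hw' hx)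
    have h3 := (h2.trans h1).trans (mul_le_mul' le_rfl (hF p q hp hq))
    rw [← ENNReal.ofReal_mul hC.le, ENNReal.ofReal_le_ofReal_iff (by positivity),
      Real.mul_rpow (by positivity) hV.le] at h3
    have h4 : 0 < plateVolume m ν R ^ (1 / p) := by positivity
    have h5 : gridBound m ν R * (nullConst m * 2 ^ (-|weightExp m ν|) *
        2 ^ (-|weightExp m ν + m|) * R ^ (weightExp m ν + m + 1)) ^ (1 / q) ≤
        C * ((L : ℝ) ^ m) ^ (1 / p) * baseMass m ν ^ (1 / q) := by
      refine le_of_mul_le_mul_right ?_ h4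
      linarith
    have h6 : ((L : ℝ) ^ m) ^ (1 / p) =
        (4 / width m ν) ^ (m / p) * R ^ ((m : ℝ) / (2 * p)) := by
      rw [← Real.rpow_natCast, ← Real.rpow_mul hL0.le, mul_one_div, hLr,
        Real.mul_rpow (by positivity) hr.le, hRdef, ← Real.rpow_natCast r, ← Real.rpow_mul hr.le]
      congr 2
      push_cast; field_simp
    have h7 : gridBound m ν R * (nullConst m * 2 ^ (-|weightExp m ν|) *
        2 ^ (-|weightExp m ν + m|) * R ^ (weightExp m ν + m + 1)) ^ (1 / q) =
        a * R ^ δ * R ^ ((m : ℝ) / (2 * p)) := by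
      have he : -kernelExp m ν + (m / 2 + 1) + (weightExp m ν + m + 1) * (1 / q) =
          δ + (m : ℝ) / (2 * p) := by
        rw [hδ]; simp only [kernelExp, weightExp]; push_cast; ring
      rw [mul_assoc a, ← Real.rpow_add hR0, ← he,
        Real.rpow_add hR0 _ ((weightExp m ν + m + 1) * _), Real.rpow_add hR0 _ (_ / 2 + 1),
        Real.rpow_mul hR0.le, Real.mul_rpow (by positivity) (by positivity), gridBound,
        plateVolume, Real.mul_rpow hM.le hR0.le, ha]
      ring
    rw [h6, h7] at h5
    have h8 : 0 < R ^ ((m : ℝ) / (2 * p)) := by positivity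
    refine le_of_mul_le_mul_right ?_ h8
    rw [hbdef]
    linarith
  have hδ0 : 0 < δ := by linarith
  have hlim : Filter.Tendsto (fun L : ℕ => (width m ν * L / 4) ^ 2) Filter.atTop Filter.atTop :=
    (Filter.tendsto_pow_atTop two_ne_zero).comp
      ((tendsto_natCast_atTop_atTop.const_mul_atTop hw).atTop_div_const (by norm_num))
  obtain ⟨L, ⟨hL1, hL2⟩, hL3⟩ := (((hlim.eventually_ge_atTop (threshold m ν)).and
    (((tendsto_rpow_atTop hδ0).comp hlim).eventually_gt_atTop (b / a))).and
    (Filter.eventually_ge_atTop 1)).exists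
  have h1 := key L hL3 hL1
  rw [Function.comp_apply, div_lt_iff₀ ha0] at hL2
  linarith

lemma not_bergmanBound_one_of_one_lt {ν p C : ℝ} (hm : 1 ≤ m) (hν : 0 < ν) (hp : 1 < p)
    (hC : 0 < C) : ¬ BergmanBound m ν p 1 C := by
  have hm' : (1 : ℝ) ≤ m := by exact_mod_cast hm
  have hs : 0 < kernelExp m ν := by unfold kernelExp; positivity
  refine not_bergmanBound_of_lt hs (by linarith) one_pos ?_ hC
  rw [div_one]
  have : (m : ℝ) / (2 * p) < m / 2 := by gcongr; linarith
  linarith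

theorem not_bergmanBound {ν p q C : ℝ} (hm : 1 ≤ m) (hν : ((m + 2 : ℕ) : ℝ) / 2 - 1 < ν)
    (hp : 1 ≤ p) (hq1 : 1 ≤ q)
    (hq : q ≤ qtildeConj (m + 2) ν p ∨ qtilde (m + 2) ν p ≤ ENNReal.ofReal q) (hC : 0 < C) :
    ¬ BergmanBound m ν p q C := by
  have hm' : (1 : ℝ) ≤ m := by exact_mod_cast hm
  have hp0 : 0 < p := by linarith
  have hq0 : 0 < q := by linarith
  have hνm : (m : ℝ) / 2 < ν := by push_cast at hν; linarith
  have hν0 : 0 < ν := by linarith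
  have hs : 0 < kernelExp m ν := by unfold kernelExp; positivity
  have hA : ν + ((m + 2 : ℕ) : ℝ) / 2 - 1 = ν + m / 2 := by push_cast; ring
  have hip : 0 < 1 / p := by positivity
  set D := ((m + 2 : ℕ) : ℝ) / 2 * (1 - 1 / p) - 1 with hD
  have hD' : D = (m / 2 + 1) * (1 - 1 / p) - 1 := by rw [hD]; push_cast; ring
  have hDA : D < ν + m / 2 := by rw [hD']; nlinarith
  by_cases h1 : 1 < ((m + 2 : ℕ) : ℝ) / 2 * (1 - 1 / p)
  · have hD0 : 0 < D := by linarith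
    have hQ : 1 < (ν + m / 2) / D := (one_lt_div hD0).2 hDA
    rw [qtildeConj, qtilde, if_pos h1, if_pos h1, hA] at hq
    rcases hq with hq | hq
    · refine not_bergmanBound_of_lt hs hp0 hq0 ?_ hC
      have h2 : (ν + m / 2) / D / ((ν + m / 2) / D - 1) = (ν + m / 2) / (ν + m / 2 - D) := by
        have : ν + m / 2 - D ≠ 0 := by linarith
        field_simp
      rw [← hD, h2, le_div_iff₀ (by linarith)] at hq
      rw [lt_div_iff₀ hq0]
      have h3 : ν + m / 2 - D = ν + m / (2 * p) + 1 / p := by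
        rw [hD']; field_simp; ring
      rw [h3] at hq
      nlinarith
    · rw [← hD] at hq
      have hq' := (ENNReal.ofReal_le_ofReal_iff hq0.le).1 hq
      refine not_bergmanBound_of_blockExp_le hs hp0 (by linarith) ?_ hC
      rw [div_le_iff₀ hD0] at hq'
      have h2 : blockExp m ν p q = ν + m / 2 - q * D - 1 := by
        rw [hD', blockExp, weightExp]; push_cast; field_simp; ring
      rw [h2]
      linarith
  · rw [qtildeConj, qtilde, if_neg h1, if_neg h1] at hq
    rcases hq with hq | hq
    · obtain rfl : q = 1 := le_antisymm hq hq1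
      rcases hp.eq_or_lt with rfl | hp
      · exact not_bergmanBound_one hs hC
      · exact not_bergmanBound_one_of_one_lt hm hν0 hp hC
    · exact absurd (top_le_iff.1 hq) ENNReal.ofReal_ne_top

end LightCone

/-- For `n ≥ 3`, `ν > n/2 − 1`, `1 ≤ p < ∞`, `1 ≤ q < ∞`, if
`q ≤ (q̃_{ν,p})'` or `q ≥ q̃_{ν,p}`, then the weighted Bergman projection admits no
bounded extension to `L^{p,q}_ν`. -/
theorem statement5 (n : ℕ) [NeZero n] (hn : 3 ≤ n) (ν p q : ℝ)
    (hν : (n : ℝ) / 2 - 1 < ν) (hp : 1 ≤ p) (hq1 : 1 ≤ q)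
    (hq : q ≤ qtildeConj n ν p ∨ qtilde n ν p ≤ ENNReal.ofReal q) :
    ¬ ∃ C : ℝ, 0 < C ∧
        ∀ F : (Fin n → ℂ) → ℂ, Measurable F →
          mixedNorm n 2 2 ν F < ∞ → mixedNorm n p q ν F < ∞ →
          mixedNorm n p q ν (bergmanOp n ν F) ≤ ENNReal.ofReal C * mixedNorm n p q ν F := by
  obtain ⟨m, rfl⟩ : ∃ m, n = m + 2 := ⟨n - 2, by omega⟩
  rintro ⟨C, hC, h⟩
  exact LightCone.not_bergmanBound (by omega) hν hp hq1 hq hC h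
end
end

section
/- Let n ≥ 3 and α ∈ ℝ. The function g_α(ξ) = e^{−ξ₁} / ( Q(ξ) · (1 + |log( Q(ξ)/(ξ₁+ξ₂) )|)^α ) is integrable over Λ_n (with respect to Lebesgue measure) if and only if α > 1. (Note that for ξ ∈ Λ_n one has ξ₁ + ξ₂ > 0 and Q(ξ) > 0, so the logarithm is well defined; Q(ξ)/(ξ₁+ξ₂) is the generalized power Δ_{(0,1)}(ξ) of the rank-2 cone Λ_n.) -/
open MeasureTheory Complex Set
open scoped ENNReal NNReal

noncomputable section

theorem integrable_exp_neg_exp_mul_one_add_abs_rpow_iff (α : ℝ) :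
    Integrable (fun s : ℝ => Real.exp (-(Real.exp s) / 2) * (1 + |s|) ^ (-α)) ↔ 1 < α := by
  constructor
  · intro h
    have h1 := ((h.comp_sub_left 1).const_mul (Real.exp (1 / 2))).integrableOn (s := Ioi 1)
    have h2 : IntegrableOn (fun x : ℝ => x ^ (-α)) (Ioi 1) := by
      refine h1.mono' (by fun_prop) ?_
      filter_upwards [ae_restrict_mem measurableSet_Ioi] with x (hx : 1 < x)
      have hx0 : 0 < x := by linarith
      rw [Real.norm_of_nonneg (Real.rpow_nonneg hx0.le _),
        abs_of_neg (by linarith : 1 - x < 0), show 1 + -(1 - x) = x by ring,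
        ← mul_assoc, ← Real.exp_add]
      refine le_mul_of_one_le_left (Real.rpow_nonneg hx0.le _) (Real.one_le_exp ?_)
      have : Real.exp (1 - x) ≤ 1 := Real.exp_le_one_iff.2 (by linarith)
      linarith
    have := (integrableOn_Ioi_rpow_iff one_pos).1 h2
    linarith
  · intro h
    have h1 : Integrable (fun s : ℝ => (1 + ‖s‖) ^ (-α)) :=
      integrable_one_add_norm (by simpa using h)
    refine h1.mono' (by fun_prop) (ae_of_all _ fun s => ?_)
    have h0 : 0 ≤ (1 + |s|) ^ (-α) := Real.rpow_nonneg (by positivity) _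
    rw [Real.norm_of_nonneg (mul_nonneg (Real.exp_pos _).le h0)]
    refine mul_le_of_le_one_left h0 (Real.exp_le_one_iff.2 ?_)
    have := Real.exp_pos s
    linarith

theorem integrableOn_exp_div_mul_one_add_abs_log_rpow_iff (α : ℝ) :
    IntegrableOn (fun w : ℝ => Real.exp (-w / 2) / (w * (1 + |Real.log w|) ^ α)) (Ioi 0)
      ↔ 1 < α := by
  have key := integrableOn_image_iff_integrableOn_abs_deriv_smul (f := Real.exp) (f' := Real.exp)
    MeasurableSet.univ (fun x _ => (Real.hasDerivAt_exp x).hasDerivWithinAt)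
    Real.exp_injective.injOn
    (fun w : ℝ => Real.exp (-w / 2) / (w * (1 + |Real.log w|) ^ α))
  rw [image_univ, Real.range_exp, integrableOn_univ] at key
  rw [key, ← integrable_exp_neg_exp_mul_one_add_abs_rpow_iff α]
  refine integrable_congr (ae_of_all _ fun s => ?_)
  have h := Real.exp_pos s
  dsimp only
  rw [Real.log_exp, abs_of_pos h, Real.rpow_neg (by positivity), smul_eq_mul]
  field_simp

theorem integrable_indicator_exp_neg_add_sum_sq_div {m : ℕ} (hm : 0 < m) :
    Integrable (fun p : ℝ × (Fin m → ℝ) =>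
      (Ioi (0 : ℝ)).indicator
        (fun u => Real.exp (-(u + (∑ i, p.2 i ^ 2) / u) / 2) / u) p.1) := by
  have hmeas : Measurable (fun p : ℝ × (Fin m → ℝ) =>
      (Ioi (0 : ℝ)).indicator
        (fun u => Real.exp (-(u + (∑ i, p.2 i ^ 2) / u) / 2) / u) p.1) := by
    have : Measurable (fun p : ℝ × (Fin m → ℝ) =>
      Real.exp (-(p.1 + (∑ i, p.2 i ^ 2) / p.1) / 2) / p.1) := by fun_prop
    exact this.indicator (measurableSet_Ioi.preimage measurable_fst)
  have hprod (u : ℝ) (hu : 0 < u) (x : Fin m → ℝ) :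
      Real.exp (-(u + (∑ i, x i ^ 2) / u) / 2) / u
        = Real.exp (-u / 2) / u * ∏ i, Real.exp (-(1 / (2 * u)) * x i ^ 2) := by
    rw [← Real.exp_sum, ← Finset.mul_sum, div_mul_eq_mul_div, ← Real.exp_add]
    congr 2
    field_simp
    ring
  have hnonneg (u : ℝ) (x : Fin m → ℝ) : 0 ≤ (Ioi (0 : ℝ)).indicator
      (fun u => Real.exp (-(u + (∑ i, x i ^ 2) / u) / 2) / u) u :=
    indicator_nonneg (fun u (hu : 0 < u) => by positivity) u
  rw [Measure.volume_eq_prod, integrable_prod_iff hmeas.aestronglyMeasurable]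
  constructor
  · refine ae_of_all _ fun u => ?_
    by_cases hu : 0 < u
    · simp only [indicator_of_mem (mem_Ioi.2 hu), hprod u hu]
      exact (Integrable.fintype_prod fun _ => integrable_exp_neg_mul_sq (by positivity)).const_mul _
    · simp [hu]
  · have hgamma := integrableOn_rpow_mul_exp_neg_mul_rpow (p := 1) (s := (m : ℝ) / 2 - 1) (b := 1 / 2)
      (by have : (0 : ℝ) < m := by exact_mod_cast hm
          linarith) one_pos (by norm_num)
    refine ((integrable_indicator_iff measurableSet_Ioi).2
      (hgamma.const_mul ((2 * Real.pi) ^ ((m : ℝ) / 2)))).congr (ae_of_all _ fun u => ?_)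
    simp only [Real.norm_of_nonneg (hnonneg _ _)]
    by_cases hu : 0 < u
    · simp only [indicator_of_mem (mem_Ioi.2 hu), hprod u hu]
      rw [integral_const_mul,
        integral_fintype_prod_volume_eq_pow (fun y : ℝ => Real.exp (-(1 / (2 * u)) * y ^ 2)),
        integral_gaussian, Fintype.card_fin, Real.sqrt_eq_rpow, ← Real.rpow_natCast,
        ← Real.rpow_mul (by positivity), show Real.pi / (1 / (2 * u)) = 2 * Real.pi * u by
          field_simp, Real.mul_rpow (by positivity) hu.le, Real.rpow_sub_one hu.ne', Real.rpow_one,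
        show (1 / 2 * (m : ℝ)) = m / 2 by ring, show -(1 / 2) * u = -u / 2 by ring]
      ring
    · simp [hu]

/-- Coordinates on `ℝ ^ (m + 2)` in which, at the point with parameters `((u, x), t)`,
`ξ 0 + ξ 1 = u` and `Q ξ = -2 * t * u`. -/
def lorentzParam {m : ℕ} (p : (ℝ × (Fin m → ℝ)) × ℝ) : Fin (m + 2) → ℝ :=
  Fin.cons (p.1.1 - (p.2 + (p.1.1 - (∑ i, p.1.2 i ^ 2) / p.1.1) / 2))
    (Fin.cons (p.2 + (p.1.1 - (∑ i, p.1.2 i ^ 2) / p.1.1) / 2) p.1.2)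

theorem measurePreserving_cons (m : ℕ) :
    MeasurePreserving (fun p : ℝ × (Fin m → ℝ) => (Fin.cons p.1 p.2 : Fin (m + 1) → ℝ)) := by
  convert (volume_preserving_piFinSuccAbove (fun _ : Fin (m + 1) => ℝ) 0).symm using 2
  rw [MeasurableEquiv.piFinSuccAbove_symm_apply]
  simp [Fin.insertNthEquiv]

theorem measurePreserving_lorentzParam (m : ℕ) :
    MeasurePreserving (lorentzParam (m := m)) := by
  have shear : MeasurePreserving (fun p : (ℝ × (Fin m → ℝ)) × ℝ =>
      (p.1, p.2 + (p.1.1 - (∑ i, p.1.2 i ^ 2) / p.1.1) / 2)) :=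
    (MeasurePreserving.id volume).skew_product
      (g := fun (q : ℝ × (Fin m → ℝ)) (t : ℝ) => t + (q.1 - (∑ i, q.2 i ^ 2) / q.1) / 2) (by fun_prop)
      (ae_of_all _ fun _ => (measurePreserving_add_right volume _).map_eq)
  have inner : MeasurePreserving (fun p : ℝ × ((Fin m → ℝ) × ℝ) =>
      (p.1, (Fin.cons p.2.2 p.2.1 : Fin (m + 1) → ℝ))) :=
    (MeasurePreserving.id volume).prod
      ((measurePreserving_cons m).comp Measure.measurePreserving_swap)
  have outer : MeasurePreserving (fun p : (Fin (m + 1) → ℝ) × ℝ => (p.1, p.2 - p.1 0)) :=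
    (MeasurePreserving.id volume).skew_product (g := fun (y : Fin (m + 1) → ℝ) (u : ℝ) => u - y 0) (by fun_prop)
      (ae_of_all _ fun y => (measurePreserving_sub_right volume (y 0)).map_eq)
  exact (measurePreserving_cons (m + 1)).comp <| Measure.measurePreserving_swap.comp <|
    outer.comp <| Measure.measurePreserving_swap.comp <| inner.comp <|
      volume_preserving_prodAssoc.comp shear

theorem lorentzQ_add_two (m : ℕ) [NeZero (m + 2)] (ξ : Fin (m + 2) → ℝ) :
    lorentzQ (m + 2) ξ = ξ 0 ^ 2 - ξ 1 ^ 2 - ∑ i : Fin m, ξ i.succ.succ ^ 2 := by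
  have h := Finset.sum_filter_add_sum_filter_not Finset.univ
    (fun k : Fin (m + 2) => k ≠ 0) (fun k => ξ k ^ 2)
  have h0 : Finset.univ.filter (fun k : Fin (m + 2) => ¬ k ≠ 0) = {0} := by ext; simp
  rw [h0, Finset.sum_singleton, Fin.sum_univ_succ, Fin.sum_univ_succ] at h
  simp only [Fin.succ_zero_eq_one] at h
  unfold lorentzQ
  linarith

theorem measurable_lorentzQ (n : ℕ) [NeZero n] : Measurable (lorentzQ n) := by
  unfold lorentzQ
  fun_prop

theorem measurableSet_lightCone (n : ℕ) [NeZero n] : MeasurableSet (lightCone n) :=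
  (measurableSet_lt measurable_const (measurable_pi_apply 0)).inter
    (measurableSet_lt measurable_const (measurable_lorentzQ n))

theorem lorentzParam_zero_add_one {m : ℕ} (p : (ℝ × (Fin m → ℝ)) × ℝ) :
    lorentzParam p 0 + lorentzParam p 1 = p.1.1 := by
  exact sub_add_cancel _ _

theorem lorentzQ_lorentzParam {m : ℕ} [NeZero (m + 2)] (p : (ℝ × (Fin m → ℝ)) × ℝ)
    (hp : 0 < p.1.1) : lorentzQ (m + 2) (lorentzParam p) = p.1.1 * (-2 * p.2) := by
  rw [lorentzQ_add_two]
  change (p.1.1 - (p.2 + (p.1.1 - (∑ i, p.1.2 i ^ 2) / p.1.1) / 2)) ^ 2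
    - (p.2 + (p.1.1 - (∑ i, p.1.2 i ^ 2) / p.1.1) / 2) ^ 2 - ∑ i, p.1.2 i ^ 2 = _
  field_simp
  ring

theorem lorentzParam_mem_lightCone_iff {m : ℕ} [NeZero (m + 2)] (p : (ℝ × (Fin m → ℝ)) × ℝ) :
    lorentzParam p ∈ lightCone (m + 2) ↔ 0 < p.1.1 ∧ 0 < -2 * p.2 := by
  have hsum := lorentzParam_zero_add_one p
  constructor
  · rintro ⟨h0, hQ⟩
    have hu : 0 < p.1.1 := by
      have hQ2 := hQ
      rw [lorentzQ_add_two] at hQ2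
      have hs : 0 ≤ ∑ i : Fin m, lorentzParam p i.succ.succ ^ 2 :=
        Finset.sum_nonneg fun i _ => sq_nonneg _
      have h1 := (abs_lt_of_sq_lt_sq (by linarith : lorentzParam p 1 ^ 2 < lorentzParam p 0 ^ 2)
        h0.le)
      linarith [neg_le_abs (lorentzParam p 1)]
    rw [lorentzQ_lorentzParam p hu] at hQ
    exact ⟨hu, pos_of_mul_pos_right hQ hu.le⟩
  · rintro ⟨hu, hw⟩
    refine ⟨?_, ?_⟩
    · change 0 < p.1.1 - (p.2 + (p.1.1 - (∑ i, p.1.2 i ^ 2) / p.1.1) / 2)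
      have : 0 ≤ (∑ i, p.1.2 i ^ 2) / p.1.1 :=
        div_nonneg (Finset.sum_nonneg fun i _ => sq_nonneg _) hu.le
      linarith
    · rw [lorentzQ_lorentzParam p hu]
      positivity

theorem indicator_lightCone_lorentzParam {m : ℕ} [NeZero (m + 2)] (α : ℝ)
    (p : (ℝ × (Fin m → ℝ)) × ℝ) :
    (lightCone (m + 2)).indicator
      (fun ξ => Real.exp (-(ξ 0)) /
          (lorentzQ (m + 2) ξ * (1 + |Real.log (lorentzQ (m + 2) ξ / (ξ 0 + ξ 1))|) ^ α))
      (lorentzParam p) =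
    (Ioi (0 : ℝ)).indicator
        (fun u => Real.exp (-(u + (∑ i, p.1.2 i ^ 2) / u) / 2) / u) p.1.1 *
      (Ioi (0 : ℝ)).indicator
        (fun w => Real.exp (-w / 2) / (w * (1 + |Real.log w|) ^ α)) (-2 * p.2) := by
  have hiff := lorentzParam_mem_lightCone_iff p
  by_cases hu : 0 < p.1.1
  · by_cases hw : 0 < -2 * p.2
    · rw [indicator_of_mem (hiff.2 ⟨hu, hw⟩), indicator_of_mem (mem_Ioi.2 hu),
        indicator_of_mem (mem_Ioi.2 hw), lorentzParam_zero_add_one, lorentzQ_lorentzParam p hu,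
        mul_div_cancel_left₀ _ hu.ne', div_mul_div_comm, ← Real.exp_add, mul_assoc]
      congr 2
      change -(p.1.1 - (p.2 + (p.1.1 - (∑ i, p.1.2 i ^ 2) / p.1.1) / 2)) = _
      ring
    · rw [indicator_of_notMem (fun h => hw (hiff.1 h).2),
        indicator_of_notMem (fun h => hw (mem_Ioi.1 h)) (a := -2 * p.2), mul_zero]
  · rw [indicator_of_notMem (fun h => hu (hiff.1 h).1),
      indicator_of_notMem (fun h => hu (mem_Ioi.1 h)) (a := p.1.1), zero_mul]

/-- The function
`g_α(ξ) = e^{−ξ₁} / ( Q(ξ)·(1 + |log(Q(ξ)/(ξ₁+ξ₂))|)^α )` is integrable over the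
light cone `Λ_n` iff `α > 1`. -/
theorem statement7 (n : ℕ) [NeZero n] (hn : 3 ≤ n) (α : ℝ) :
    IntegrableOn
      (fun ξ : Fin n → ℝ =>
        Real.exp (-(ξ 0)) /
          (lorentzQ n ξ * (1 + |Real.log (lorentzQ n ξ / (ξ 0 + ξ 1))|) ^ α))
      (lightCone n) ↔ 1 < α := by
  obtain ⟨m, rfl⟩ : ∃ m, n = m + 2 := ⟨n - 2, by omega⟩
  have hmeas : Measurable (fun ξ : Fin (m + 2) → ℝ =>
      Real.exp (-(ξ 0)) / (lorentzQ (m + 2) ξ *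
        (1 + |Real.log (lorentzQ (m + 2) ξ / (ξ 0 + ξ 1))|) ^ α)) := by
    have := measurable_lorentzQ (m + 2)
    fun_prop
  have hcone := measurableSet_lightCone (m + 2)
  rw [← integrable_indicator_iff hcone, ← (measurePreserving_lorentzParam m).integrable_comp
    (hmeas.indicator hcone).aestronglyMeasurable]
  simp only [Function.comp_def, indicator_lightCone_lorentzParam]
  have hF := integrable_indicator_exp_neg_add_sum_sq_div (m := m) (by omega)
  rw [← integrableOn_exp_div_mul_one_add_abs_log_rpow_iff α,
    ← integrable_indicator_iff measurableSet_Ioi,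
    ← integrable_comp_mul_left_iff _ (by norm_num : (-2 : ℝ) ≠ 0)]
  refine ⟨fun h => ?_, fun h => hF.mul_prod h⟩
  have hpos : volume (Ioi (0 : ℝ) ×ˢ (univ : Set (Fin m → ℝ))) ≠ 0 := by
    rw [Measure.volume_eq_prod, Measure.prod_prod]
    simp [NeZero.ne]
  obtain ⟨q, hq, hqi⟩ := ((frequently_ae_mem_iff.2 hpos).and_eventually
    h.prod_right_ae).exists
  have hq0 : 0 < q.1 := hq.1
  dsimp only at hqi
  rw [integrable_const_mul_iff] at hqi
  · exact hqi
  · rw [indicator_of_mem hq.1]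
    exact (by positivity : Real.exp (-(q.1 + (∑ i, q.2 i ^ 2) / q.1) / 2) / q.1 ≠ 0).isUnit
end
end

section
/- Let n ≥ 3, α, δ ∈ ℝ and β > −1. The function g(y) = Q(y)^β / ( Q(y+e)^α · (1 + log Q(y+e))^δ ) is integrable over Λ_n (with respect to Lebesgue measure) if and only if either α − β > n − 1, or α − β = n − 1 and δ > 1. (Note that for y ∈ Λ_n one has Q(y+e) > 1, so log Q(y+e) > 0.) -/
open MeasureTheory Complex Set
open scoped ENNReal NNReal

noncomputable section

theorem rpow_le_two_rpow_abs_mul_rpow {x y : ℝ} (c : ℝ) (hx : 0 < x) (hy : 0 < y)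
    (hxy : x ≤ 2 * y) (hyx : y ≤ 2 * x) : x ^ c ≤ 2 ^ |c| * y ^ c := by
  rcases le_total 0 c with hc | hc
  · rw [abs_of_nonneg hc, ← Real.mul_rpow zero_le_two hy.le]
    exact Real.rpow_le_rpow hx.le hxy hc
  · rw [abs_of_nonpos hc, Real.rpow_neg zero_le_two, ← Real.inv_rpow zero_le_two,
      ← Real.mul_rpow (by norm_num) hy.le]
    exact Real.rpow_le_rpow_of_nonpos (by positivity) (by linarith) hc

theorem integrableOn_Ioi_exp_mul_rpow_iff {S : ℝ} (hS : 0 < S) (p d : ℝ) :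
    IntegrableOn (fun s : ℝ => Real.exp ((1 - p) * s) * s ^ (-d)) (Ioi S) ↔
      1 < p ∨ (p = 1 ∧ 1 < d) := by
  rcases lt_trichotomy p 1 with hp | rfl | hp
  · have hO := (isLittleO_rpow_exp_pos_mul_atTop (d - 1) (sub_pos.2 hp)).bound one_pos
    obtain ⟨R, hR⟩ := Filter.eventually_atTop.1 hO
    refine iff_of_false (fun h => ?_) (by rintro (h | ⟨h, -⟩) <;> linarith)
    have hm : 0 < max R S := lt_max_of_lt_right hS
    have h1 : IntegrableOn (fun s : ℝ => s ^ (-1 : ℝ)) (Ioi (max R S)) := by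
      refine (h.mono_set (Ioi_subset_Ioi (le_max_right R S))).mono'
        (by fun_prop) ?_
      filter_upwards [ae_restrict_mem measurableSet_Ioi] with s hs
      have hs0 : 0 < s := hm.trans hs
      have := hR s ((le_max_left R S).trans (le_of_lt hs))
      rw [Real.norm_of_nonneg (by positivity), Real.norm_of_nonneg (by positivity), one_mul] at this
      rw [Real.norm_of_nonneg (by positivity), show (-1 : ℝ) = (d - 1) + -d by ring,
        Real.rpow_add hs0]
      gcongr
    exact absurd ((integrableOn_Ioi_rpow_iff hm).1 h1) (lt_irrefl _)
  · simp only [sub_self, zero_mul, Real.exp_zero, one_mul, lt_irrefl, true_and, false_or]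
    rw [integrableOn_Ioi_rpow_iff hS, neg_lt_neg_iff]
  · refine iff_of_true ?_ (Or.inl hp)
    have hb : 0 < (p - 1) / 2 := by linarith
    refine integrable_of_isBigO_exp_neg hb (fun s hs => ?_) ?_
    · have : s ≠ 0 := (hS.trans_le hs).ne'
      exact (ContinuousAt.mul (by fun_prop)
        (Real.continuousAt_rpow_const _ _ (Or.inl this))).continuousWithinAt
    · refine (Asymptotics.IsBigO.mul (Asymptotics.isBigO_refl _ _)
        (isLittleO_rpow_exp_pos_mul_atTop (-d) hb).isBigO).congr_right fun s => ?_
      rw [← Real.exp_add]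
      congr 1
      ring

theorem integrableOn_Ioi_one_add_rpow_mul_log_iff {T : ℝ} (hT : 0 ≤ T) (p d : ℝ) :
    IntegrableOn (fun v : ℝ => (1 + v) ^ (-p) * (1 + Real.log (1 + v)) ^ (-d)) (Ioi T) ↔
      1 < p ∨ (p = 1 ∧ 1 < d) := by
  have hlog : 0 ≤ Real.log (1 + T) := Real.log_nonneg (by linarith)
  have himg : (fun s : ℝ => Real.exp (s - 1) - 1) '' Ioi (1 + Real.log (1 + T)) = Ioi T := by
    ext v
    simp only [mem_image, mem_Ioi]
    constructor
    · rintro ⟨s, hs, rfl⟩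
      have : Real.log (1 + T) < s - 1 := by linarith
      rw [Real.log_lt_iff_lt_exp (by linarith)] at this
      linarith
    · intro hv
      refine ⟨1 + Real.log (1 + v), ?_, ?_⟩
      · gcongr
      · rw [add_sub_cancel_left, Real.exp_log (by linarith)]
        ring
  rw [← himg, integrableOn_image_iff_integrableOn_abs_deriv_smul measurableSet_Ioi
    (f' := fun s => Real.exp (s - 1)), ← integrableOn_Ioi_exp_mul_rpow_iff
      (show 0 < 1 + Real.log (1 + T) by linarith)]
  · rw [IntegrableOn, IntegrableOn, ← integrable_const_mul_iff (c := Real.exp (1 - p))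
      (Real.exp_pos _).ne'.isUnit]
    refine integrable_congr (Filter.Eventually.of_forall fun s => ?_)
    simp only [smul_eq_mul, abs_of_pos (Real.exp_pos _), add_sub_cancel, Real.log_exp]
    rw [← Real.exp_mul, ← mul_assoc, ← mul_assoc, ← Real.exp_add, ← Real.exp_add]
    congr 2
    ring
  · intro s _
    exact ((((hasDerivAt_id s).sub_const 1).exp).sub_const 1).hasDerivWithinAt.congr_deriv
      (by simp)
  · intro s _ t _ h
    simpa using h

/-- The radial weight `v ^ b (1 + v) ^ (-a) (1 + log (1 + v)) ^ (-d)`. -/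
def logWeight (b a d v : ℝ) : ℝ :=
  v ^ b * (1 + v) ^ (-a) * (1 + Real.log (1 + v)) ^ (-d)

@[fun_prop]
theorem measurable_logWeight (b a d : ℝ) : Measurable (logWeight b a d) := by
  unfold logWeight
  fun_prop

theorem logWeight_nonneg (b a d : ℝ) {v : ℝ} (hv : 0 ≤ v) : 0 ≤ logWeight b a d v := by
  have : 0 ≤ Real.log (1 + v) := Real.log_nonneg (by linarith)
  unfold logWeight
  positivity

theorem integrableOn_Ioi_logWeight_iff {T : ℝ} (hT : 1 ≤ T) (b a d : ℝ) :
    IntegrableOn (logWeight b a d) (Ioi T) ↔ 1 < a - b ∨ (a - b = 1 ∧ 1 < d) := by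
  rw [← integrableOn_Ioi_one_add_rpow_mul_log_iff (zero_le_one.trans hT)]
  have key (v : ℝ) (hv : T < v) : (1 + v) ^ (-(a - b)) * (1 + Real.log (1 + v)) ^ (-d) =
      (1 + v) ^ b * (1 + v) ^ (-a) * (1 + Real.log (1 + v)) ^ (-d) := by
    rw [← Real.rpow_add (by linarith)]
    congr 2
    ring
  constructor <;> intro h
  · refine (h.const_mul (2 ^ |b|)).mono' (by fun_prop) ?_
    filter_upwards [ae_restrict_mem measurableSet_Ioi] with v hv
    have hv' : T < v := hv
    have hlog : 0 ≤ Real.log (1 + v) := Real.log_nonneg (by linarith)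
    have h1v : 0 < 1 + v := by linarith
    rw [Real.norm_of_nonneg (by positivity), key v hv, logWeight, ← mul_assoc, ← mul_assoc]
    gcongr
    exact rpow_le_two_rpow_abs_mul_rpow b h1v (by linarith) (by linarith) (by linarith)
  · refine (h.const_mul (2 ^ |b|)).mono' (by fun_prop) ?_
    filter_upwards [ae_restrict_mem measurableSet_Ioi] with v hv
    have hv' : T < v := hv
    have hlog : 0 ≤ Real.log (1 + v) := Real.log_nonneg (by linarith)
    have h1v : 0 < 1 + v := by linarith
    rw [Real.norm_of_nonneg (logWeight_nonneg b a d (by linarith)), key v hv, logWeight,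
      ← mul_assoc, ← mul_assoc]
    gcongr
    exact rpow_le_two_rpow_abs_mul_rpow b (by linarith) h1v (by linarith) (by linarith)

theorem integrableOn_Ioi_zero_logWeight {b a d : ℝ} (hb : -1 < b)
    (h : 1 < a - b ∨ (a - b = 1 ∧ 1 < d)) : IntegrableOn (logWeight b a d) (Ioi 0) := by
  rw [← Ioc_union_Ioi_eq_Ioi zero_le_one]
  refine IntegrableOn.union ?_ ((integrableOn_Ioi_logWeight_iff le_rfl b a d).2 h)
  rw [← intervalIntegrable_iff_integrableOn_Ioc_of_le zero_le_one]
  have hc : ContinuousOn (fun v : ℝ => (1 + v) ^ (-a) * (1 + Real.log (1 + v)) ^ (-d))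
      (uIcc 0 1) := by
    rw [uIcc_of_le zero_le_one]
    intro v hv
    have h1v : 1 + v ≠ 0 := by linarith [hv.1]
    have hlog : 0 ≤ Real.log (1 + v) := Real.log_nonneg (by linarith [hv.1])
    refine ContinuousAt.continuousWithinAt (ContinuousAt.mul ?_ ?_)
    · exact ContinuousAt.rpow_const (by fun_prop) (Or.inl h1v)
    · refine ContinuousAt.rpow_const ?_ (Or.inl (by linarith))
      exact continuousAt_const.add (ContinuousAt.log (by fun_prop) h1v)
  refine ((intervalIntegral.intervalIntegrable_rpow' hb).mul_continuousOn hc).congr fun v _ => ?_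
  simp only [logWeight, mul_assoc]

theorem lintegral_fun_norm_addHaar {E : Type*} [NormedAddCommGroup E] [NormedSpace ℝ E]
    [MeasurableSpace E] [BorelSpace E] [Nontrivial E] [FiniteDimensional ℝ E]
    (μ : Measure E) [μ.IsAddHaarMeasure] {f : ℝ → ℝ≥0∞} (hf : Measurable f) :
    ∫⁻ x, f ‖x‖ ∂μ = μ.toSphere univ *
      ∫⁻ r in Ioi (0 : ℝ), ENNReal.ofReal (r ^ (Module.finrank ℝ E - 1)) * f r := by
  calc
    ∫⁻ x, f ‖x‖ ∂μ = ∫⁻ x : ({(0)}ᶜ : Set E), f ‖x.1‖ ∂(μ.comap (↑)) := by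
      rw [lintegral_subtype_comap (measurableSet_singleton _).compl fun x ↦ f (‖x‖),
        restrict_compl_singleton]
    _ = ∫⁻ x, f x.2 ∂μ.toSphere.prod (.volumeIoiPow (Module.finrank ℝ E - 1)) := by
      simpa using μ.measurePreserving_homeomorphUnitSphereProd.lintegral_comp_emb
        (Homeomorph.measurableEmbedding _) (f ∘ Subtype.val ∘ Prod.snd)
    _ = μ.toSphere univ *
        ∫⁻ x : Ioi (0 : ℝ), f x ∂.volumeIoiPow (Module.finrank ℝ E - 1) := by
      rw [lintegral_prod _ (by fun_prop)]
      simp [mul_comm]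
    _ = _ := by
      rw [Measure.volumeIoiPow, lintegral_withDensity_eq_lintegral_mul _ (by fun_prop)
        (by fun_prop)]
      simp only [Pi.mul_apply]
      rw [lintegral_subtype_comap measurableSet_Ioi fun r ↦
        ENNReal.ofReal (r ^ (Module.finrank ℝ E - 1)) * f r]

/-- Integration in the coordinates `u = t - r` and `r`, where `t` is the first coordinate and `r`
is the Euclidean norm of the remaining ones. -/
theorem lintegral_fin_succ_eq_light_cone_coordinates {m : ℕ} (hm : m ≠ 0) :
    ∃ c : ℝ≥0∞, c ≠ 0 ∧ c ≠ ∞ ∧ ∀ F : ℝ × ℝ → ℝ≥0∞, Measurable F →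
      ∫⁻ y : Fin (m + 1) → ℝ, F (y 0, √(∑ i : Fin m, y i.succ ^ 2)) =
        c * ∫⁻ u : ℝ, ∫⁻ r in Ioi (0 : ℝ), ENNReal.ofReal (r ^ (m - 1)) * F (u + r, r) := by
  have : NeZero m := ⟨hm⟩
  let μ : Measure (EuclideanSpace ℝ (Fin m)) := volume
  refine ⟨μ.toSphere univ, ?_, measure_ne_top _ _, fun F hF => ?_⟩
  · rw [Ne, Measure.measure_univ_eq_zero]
    exact μ.toSphere_ne_zero
  have hswap : ∫⁻ t : ℝ, ∫⁻ r in Ioi (0 : ℝ), ENNReal.ofReal (r ^ (m - 1)) * F (t, r) =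
      ∫⁻ u : ℝ, ∫⁻ r in Ioi (0 : ℝ), ENNReal.ofReal (r ^ (m - 1)) * F (u + r, r) := by
    refine (lintegral_lintegral_swap (by fun_prop)).trans
      (Eq.trans (lintegral_congr fun r => ?_) (lintegral_lintegral_swap (by fun_prop)).symm)
    exact (lintegral_add_right_eq_self (μ := volume)
      (fun t : ℝ => ENNReal.ofReal (r ^ (m - 1)) * F (t, r)) r).symm
  calc
    _ = ∫⁻ z : ℝ × (Fin m → ℝ), F (z.1, √(∑ i, z.2 i ^ 2)) := by
      rw [← (volume_preserving_piFinSuccAbove (fun _ : Fin (m + 1) => ℝ) 0).lintegral_comp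
        (by fun_prop)]
      rfl
    _ = ∫⁻ t : ℝ, ∫⁻ x : Fin m → ℝ, F (t, √(∑ i, x i ^ 2)) := by
      rw [Measure.volume_eq_prod, lintegral_prod _ (by fun_prop)]
    _ = ∫⁻ t : ℝ, ∫⁻ x : EuclideanSpace ℝ (Fin m), F (t, ‖x‖) := by
      refine lintegral_congr fun t => ?_
      rw [← (PiLp.volume_preserving_ofLp (Fin m)).lintegral_comp (by fun_prop)]
      simp [EuclideanSpace.norm_eq]
    _ = ∫⁻ t : ℝ, μ.toSphere univ *
        ∫⁻ r in Ioi (0 : ℝ), ENNReal.ofReal (r ^ (m - 1)) * F (t, r) := by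
      refine lintegral_congr fun t => ?_
      rw [lintegral_fun_norm_addHaar volume (f := fun r => F (t, r)) (by fun_prop),
        finrank_euclideanSpace_fin]
    _ = _ := by
      rw [lintegral_const_mul' _ _ (measure_ne_top _ _), hswap]

/-- The integrand as a function of the first coordinate and of the Euclidean norm of the remaining
ones, extended by zero outside the light cone. -/
def coneProfile (α δ β : ℝ) (z : ℝ × ℝ) : ℝ :=
  if 0 < z.1 ∧ 0 < z.1 ^ 2 - z.2 ^ 2 then
    (z.1 ^ 2 - z.2 ^ 2) ^ β / (((z.1 + 1) ^ 2 - z.2 ^ 2) ^ α *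
      (1 + Real.log ((z.1 + 1) ^ 2 - z.2 ^ 2)) ^ δ)
  else 0

@[fun_prop]
theorem measurable_coneProfile (α δ β : ℝ) : Measurable (coneProfile α δ β) := by
  unfold coneProfile
  have hQ : Measurable fun z : ℝ × ℝ => z.1 ^ 2 - z.2 ^ 2 := by fun_prop
  exact Measurable.ite ((measurableSet_lt measurable_const measurable_fst).inter
    (measurableSet_lt measurable_const hQ)) (by fun_prop) measurable_const

theorem coneProfile_nonneg (α δ β : ℝ) (z : ℝ × ℝ) : 0 ≤ coneProfile α δ β z := by
  unfold coneProfile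
  split_ifs with h
  · have h1 : 1 ≤ (z.1 + 1) ^ 2 - z.2 ^ 2 := by nlinarith [h.1, h.2]
    have := Real.log_nonneg h1
    have := h.2
    positivity
  · exact le_rfl

theorem coneProfile_eq_zero (α δ β : ℝ) {u r : ℝ} (hu : u ≤ 0) (hr : 0 < r) :
    coneProfile α δ β (u + r, r) = 0 := by
  refine if_neg fun h => ?_
  simp only at h
  nlinarith [h.1, h.2]

theorem coneProfile_eq (α δ β : ℝ) {u r : ℝ} (hu : 0 < u) (hr : 0 < r) :
    coneProfile α δ β (u + r, r) = u ^ β * (1 + u) ^ (-α) * ((u + 2 * r) ^ β *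
      (1 + (u + 2 * r)) ^ (-α) *
        (1 + (Real.log (1 + u) + Real.log (1 + (u + 2 * r)))) ^ (-δ)) := by
  have h1 : (u + r) ^ 2 - r ^ 2 = u * (u + 2 * r) := by ring
  have h2 : (u + r + 1) ^ 2 - r ^ 2 = (1 + u) * (1 + (u + 2 * r)) := by ring
  have hl1 : 0 ≤ Real.log (1 + u) := Real.log_nonneg (by linarith)
  have hl2 : 0 ≤ Real.log (1 + (u + 2 * r)) := Real.log_nonneg (by linarith)
  unfold coneProfile
  simp only [h1, h2]
  rw [if_pos ⟨by positivity, by positivity⟩, Real.log_mul (by positivity) (by positivity),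
    Real.mul_rpow (by positivity) (by positivity), Real.mul_rpow (by positivity) (by positivity),
    Real.rpow_neg (by positivity), Real.rpow_neg (by positivity), Real.rpow_neg (by positivity)]
  field_simp

theorem pow_mul_coneProfile_le (α δ β : ℝ) (k : ℕ) {u r : ℝ} (hu : 0 < u) (hr : 0 < r) :
    r ^ k * coneProfile α δ β (u + r, r) ≤
      2 ^ |δ| * logWeight β α 0 u * logWeight (β + k) α δ (u + 2 * r) := by
  rw [coneProfile_eq α δ β hu hr]
  set v := u + 2 * r with hv
  have hv0 : 0 < v := by positivity
  have hl1 : 0 ≤ Real.log (1 + u) := Real.log_nonneg (by linarith)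
  have hl2 : Real.log (1 + u) ≤ Real.log (1 + v) := by gcongr; linarith
  have hl3 : 0 ≤ Real.log (1 + v) := hl1.trans hl2
  have hpow : r ^ k ≤ v ^ k := by gcongr; linarith
  have hlog : (1 + (Real.log (1 + u) + Real.log (1 + v))) ^ (-δ) ≤
      2 ^ |δ| * (1 + Real.log (1 + v)) ^ (-δ) := by
    simpa using rpow_le_two_rpow_abs_mul_rpow (-δ)
      (show 0 < 1 + (Real.log (1 + u) + Real.log (1 + v)) by linarith)
      (show 0 < 1 + Real.log (1 + v) by linarith) (by linarith) (by linarith)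
  simp only [logWeight, neg_zero, Real.rpow_zero, mul_one]
  rw [Real.rpow_add hv0, Real.rpow_natCast]
  calc
    _ ≤ v ^ k * (u ^ β * (1 + u) ^ (-α) * (v ^ β * (1 + v) ^ (-α) *
        (2 ^ |δ| * (1 + Real.log (1 + v)) ^ (-δ)))) := by gcongr
    _ = _ := by ring

theorem logWeight_mul_le_pow_mul_coneProfile (α δ β : ℝ) (k : ℕ) {u r : ℝ} (hu : 0 < u)
    (hur : u ≤ r) :
    logWeight β α 0 u * logWeight (β + k) α δ (u + 2 * r) ≤
      2 ^ |δ| * 3 ^ k * (r ^ k * coneProfile α δ β (u + r, r)) := by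
  have hr : 0 < r := hu.trans_le hur
  rw [coneProfile_eq α δ β hu hr]
  set v := u + 2 * r with hv
  have hv0 : 0 < v := by positivity
  have hl1 : 0 ≤ Real.log (1 + u) := Real.log_nonneg (by linarith)
  have hl2 : Real.log (1 + u) ≤ Real.log (1 + v) := by gcongr; linarith
  have hl3 : 0 ≤ Real.log (1 + v) := hl1.trans hl2
  have hpow : v ^ k ≤ 3 ^ k * r ^ k := by rw [← mul_pow]; gcongr; linarith
  have hlog : (1 + Real.log (1 + v)) ^ (-δ) ≤
      2 ^ |δ| * (1 + (Real.log (1 + u) + Real.log (1 + v))) ^ (-δ) := by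
    simpa using rpow_le_two_rpow_abs_mul_rpow (-δ)
      (show 0 < 1 + Real.log (1 + v) by linarith)
      (show 0 < 1 + (Real.log (1 + u) + Real.log (1 + v)) by linarith)
      (by linarith) (by linarith)
  simp only [logWeight, neg_zero, Real.rpow_zero, mul_one]
  rw [Real.rpow_add hv0, Real.rpow_natCast]
  calc
    _ ≤ u ^ β * (1 + u) ^ (-α) * (v ^ β * (3 ^ k * r ^ k) * (1 + v) ^ (-α) *
        (2 ^ |δ| * (1 + (Real.log (1 + u) + Real.log (1 + v))) ^ (-δ))) := by gcongr
    _ = _ := by ring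

theorem lintegral_coneProfile_ne_top {α δ β : ℝ} (hβ : -1 < β) {k : ℕ} (hk : k ≠ 0)
    (h : 1 < α - (β + k) ∨ (α - (β + k) = 1 ∧ 1 < δ)) :
    ∫⁻ u : ℝ, ∫⁻ r in Ioi (0 : ℝ), ENNReal.ofReal (r ^ k) *
      ENNReal.ofReal (coneProfile α δ β (u + r, r)) ≠ ∞ := by
  have hk1 : (1 : ℝ) ≤ k := by exact_mod_cast Nat.one_le_iff_ne_zero.2 hk
  have hu : IntegrableOn (logWeight β α 0) (Ioi 0) :=
    integrableOn_Ioi_zero_logWeight hβ (Or.inl (by rcases h with h | h <;> linarith))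
  have hv : IntegrableOn (logWeight (β + k) α δ) (Ioi 0) :=
    integrableOn_Ioi_zero_logWeight (by linarith) h
  have hv2 : Integrable fun r : ℝ => (Ioi (0 : ℝ)).indicator (logWeight (β + k) α δ) (2 * r) :=
    (integrable_comp_mul_left_iff _ two_ne_zero).2
      ((integrable_indicator_iff measurableSet_Ioi).2 hv)
  set W : ℝ → ℝ≥0∞ := fun r =>
    ENNReal.ofReal ((Ioi (0 : ℝ)).indicator (logWeight (β + k) α δ) (2 * r)) with hW
  have hWtop : ∫⁻ r, W r ≠ ∞ := hv2.lintegral_lt_top.ne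
  refine ne_top_of_le_ne_top (b := ∫⁻ u in Ioi (0 : ℝ),
    ENNReal.ofReal (2 ^ |δ| * logWeight β α 0 u) * ∫⁻ r, W r) ?_ ?_
  · rw [lintegral_mul_const' _ _ hWtop]
    exact ENNReal.mul_ne_top (hu.const_mul _).lintegral_lt_top.ne hWtop
  rw [← lintegral_indicator measurableSet_Ioi]
  refine lintegral_mono fun u => ?_
  rcases le_or_gt u 0 with hu0 | hu0
  · refine (setLIntegral_congr_fun measurableSet_Ioi fun r hr => ?_).trans_le
      ((lintegral_zero).trans_le zero_le)
    rw [coneProfile_eq_zero α δ β hu0 hr, ENNReal.ofReal_zero, mul_zero]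
  · rw [indicator_of_mem (mem_Ioi.2 hu0), ← lintegral_add_left_eq_self W (u / 2),
      ← lintegral_const_mul' _ _ ENNReal.ofReal_ne_top]
    refine (setLIntegral_mono' measurableSet_Ioi fun r hr => ?_).trans
      (setLIntegral_le_lintegral _ _)
    have hr0 : 0 < r := hr
    have hv0 : 0 < u + 2 * r := by positivity
    have hW' : W (u / 2 + r) = ENNReal.ofReal (logWeight (β + k) α δ (u + 2 * r)) := by
      rw [hW]
      simp only
      rw [show 2 * (u / 2 + r) = u + 2 * r by ring, indicator_of_mem (mem_Ioi.2 hv0)]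
    rw [hW', ← ENNReal.ofReal_mul (by positivity),
      ← ENNReal.ofReal_mul (mul_nonneg (by positivity) (logWeight_nonneg _ _ _ hu0.le))]
    exact ENNReal.ofReal_le_ofReal (pow_mul_coneProfile_le α δ β k hu0 hr0)

theorem of_lintegral_coneProfile_ne_top {α δ β : ℝ} {k : ℕ}
    (h : ∫⁻ u : ℝ, ∫⁻ r in Ioi (0 : ℝ), ENNReal.ofReal (r ^ k) *
      ENNReal.ofReal (coneProfile α δ β (u + r, r)) ≠ ∞) :
    1 < α - (β + k) ∨ (α - (β + k) = 1 ∧ 1 < δ) := by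
  have hae := ae_lt_top (Measurable.lintegral_prod_right' (f := fun z : ℝ × ℝ =>
    ENNReal.ofReal (z.2 ^ k) * ENNReal.ofReal (coneProfile α δ β (z.1 + z.2, z.2)))
    (by fun_prop)) h
  obtain ⟨u, hu, hfin⟩ : ∃ u ∈ Ioo (0 : ℝ) 1, ∫⁻ r in Ioi (0 : ℝ), ENNReal.ofReal (r ^ k) *
      ENNReal.ofReal (coneProfile α δ β (u + r, r)) < ∞ := by
    by_contra! hcon
    have : volume (Ioo (0 : ℝ) 1) = 0 :=
      measure_mono_null (fun u hu => not_lt.2 (hcon u hu)) (ae_iff.1 hae)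
    simp at this
  obtain ⟨hu0, hu1⟩ := hu
  have hint : IntegrableOn (fun r => r ^ k * coneProfile α δ β (u + r, r)) (Ioi 0) := by
    refine (lintegral_ofReal_ne_top_iff_integrable (by fun_prop) ?_).1 ?_
    · filter_upwards [ae_restrict_mem measurableSet_Ioi] with r hr
      exact mul_nonneg (pow_nonneg (le_of_lt hr) k) (coneProfile_nonneg _ _ _ _)
    · rw [setLIntegral_congr_fun measurableSet_Ioi fun r hr =>
        ENNReal.ofReal_mul (pow_nonneg (le_of_lt hr) k)]
      exact hfin.ne
  have hw : 0 < logWeight β α 0 u := by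
    simp only [logWeight, neg_zero, Real.rpow_zero, mul_one]
    positivity
  have hint2 : IntegrableOn (fun r => logWeight (β + k) α δ (u + 2 * r)) (Ioi 1) := by
    refine ((hint.mono_set (Ioi_subset_Ioi zero_le_one)).const_mul
      ((logWeight β α 0 u)⁻¹ * (2 ^ |δ| * 3 ^ k))).mono'
      (Measurable.aestronglyMeasurable (by fun_prop)) ?_
    filter_upwards [ae_restrict_mem measurableSet_Ioi] with r hr
    have hr1 : 1 < r := hr
    rw [Real.norm_of_nonneg (logWeight_nonneg _ _ _ (by linarith)), mul_assoc,
      le_inv_mul_iff₀ hw]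
    exact logWeight_mul_le_pow_mul_coneProfile α δ β k hu0 (by linarith)
  rw [← integrableOn_Ioi_logWeight_iff (show 1 ≤ u + 2 by linarith),
    ← integrable_indicator_iff measurableSet_Ioi, ← integrable_comp_mul_left_iff _ two_ne_zero]
  convert ((integrable_indicator_iff measurableSet_Ioi).2 hint2).comp_sub_right (u / 2) using 2
    with r
  have hr : 2 * r = u + 2 * (r - u / 2) := by ring
  have hiff : u + 2 < 2 * r ↔ 1 < r - u / 2 := by constructor <;> intro h <;> linarith
  simp only [indicator, mem_Ioi, hiff, ← hr]

theorem lorentzQ_succ (m : ℕ) [NeZero (m + 1)] (y : Fin (m + 1) → ℝ) :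
    lorentzQ (m + 1) y = y 0 ^ 2 - √(∑ i : Fin m, y i.succ ^ 2) ^ 2 := by
  rw [Real.sq_sqrt (Finset.sum_nonneg fun i _ => sq_nonneg _), lorentzQ, Finset.sum_filter,
    Fin.sum_univ_succ]
  simp

theorem lorentzQ_add_eVec_succ (m : ℕ) [NeZero (m + 1)] (y : Fin (m + 1) → ℝ) :
    lorentzQ (m + 1) (y + eVec (m + 1)) =
      (y 0 + 1) ^ 2 - √(∑ i : Fin m, y i.succ ^ 2) ^ 2 := by
  rw [lorentzQ_succ]
  simp [eVec, Fin.succ_ne_zero]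

/-- For `β > −1`, the function
`g(y) = Q(y)^β / ( Q(y+e)^α·(1 + log Q(y+e))^δ )` is integrable over the light cone
`Λ_n` iff `α − β > n − 1`, or `α − β = n − 1` and `δ > 1`. -/
theorem statement8 (n : ℕ) [NeZero n] (hn : 3 ≤ n) (α δ β : ℝ) (hβ : -1 < β) :
    IntegrableOn
      (fun y : Fin n → ℝ =>
        lorentzQ n y ^ β /
          (lorentzQ n (y + eVec n) ^ α *
            (1 + Real.log (lorentzQ n (y + eVec n))) ^ δ))
      (lightCone n) ↔
    ((n : ℝ) - 1 < α - β ∨ (α - β = (n : ℝ) - 1 ∧ 1 < δ)) := by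
  obtain ⟨m, rfl⟩ : ∃ m, n = m + 1 := ⟨n - 1, by omega⟩
  have hm : m - 1 ≠ 0 := by omega
  obtain ⟨c, hc0, hctop, hc⟩ := lintegral_fin_succ_eq_light_cone_coordinates
    (show m ≠ 0 by omega)
  have hmeas : MeasurableSet (lightCone (m + 1)) := by
    simp only [lightCone, lorentzQ_succ]
    have hQ : Measurable fun y : Fin (m + 1) → ℝ =>
        y 0 ^ 2 - √(∑ i : Fin m, y i.succ ^ 2) ^ 2 := by fun_prop
    exact (measurableSet_lt measurable_const (measurable_pi_apply 0)).inter
      (measurableSet_lt measurable_const hQ)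
  have hind : (lightCone (m + 1)).indicator (fun y : Fin (m + 1) → ℝ =>
        lorentzQ (m + 1) y ^ β / (lorentzQ (m + 1) (y + eVec (m + 1)) ^ α *
          (1 + Real.log (lorentzQ (m + 1) (y + eVec (m + 1)))) ^ δ)) =
      fun y => coneProfile α δ β (y 0, √(∑ i : Fin m, y i.succ ^ 2)) := by
    funext y
    simp only [lorentzQ_add_eVec_succ]
    simp only [indicator, lightCone, mem_ofPred_eq, coneProfile, lorentzQ_succ]
  have hcond : ((m + 1 : ℕ) : ℝ) - 1 < α - β ∨ (α - β = ((m + 1 : ℕ) : ℝ) - 1 ∧ 1 < δ) ↔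
      1 < α - (β + (m - 1 : ℕ)) ∨ (α - (β + (m - 1 : ℕ)) = 1 ∧ 1 < δ) := by
    rw [Nat.cast_sub (by omega)]
    push_cast
    refine or_congr ?_ (and_congr_left fun _ => ?_) <;> constructor <;> intro h <;> linarith
  rw [← integrable_indicator_iff hmeas, hind, ← lintegral_ofReal_ne_top_iff_integrable
    (Measurable.aestronglyMeasurable (by fun_prop))
    (Filter.Eventually.of_forall fun y => coneProfile_nonneg _ _ _ _),
    hc (fun z => ENNReal.ofReal (coneProfile α δ β z)) (by fun_prop), hcond]
  refine ⟨fun h => of_lintegral_coneProfile_ne_top fun htop => h ?_,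
    fun h => ENNReal.mul_ne_top hctop (lintegral_coneProfile_ne_top hβ hm h)⟩
  rw [htop, ENNReal.mul_top hc0]
end
end

section
/- Let (X,d) be a metric space and μ a Borel measure on X. Let δ > 0 and 2 ≤ R ≤ R₀, and suppose there are constants 0 < m and M < ∞ such that μ(B(x,δ)) = m and μ(B(x,(2R₀+1)δ)) = M for every x ∈ X (open metric balls). Let {ξ_j}_{j∈J} be a family of points of X with d(ξ_i, ξ_j) ≥ 2δ for all i ≠ j. Then for every subset E ⊆ X whose diameter satisfies diam(E) ≤ R₀·δ, the set of indices {j ∈ J : B(ξ_j, Rδ) ∩ E ≠ ∅} is finite with at most M/m elements. -/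
open MeasureTheory Set
open scoped ENNReal

/-- If the pairwise disjoint measurable sets `A j`, `j ∈ S`, all have measure `m` and are contained
in a set `B` of finite measure, then `S` is finite with at most `μ B / m` elements. -/
theorem finite_and_ncard_le_measure_div {X J : Type*} [MeasurableSpace X] {μ : Measure X}
    {m : ℝ≥0∞} (hm : m ≠ 0) {S : Set J} {A : J → Set X} {B : Set X} (hB : μ B ≠ ∞)
    (hA : ∀ j ∈ S, MeasurableSet (A j)) (hAm : ∀ j ∈ S, μ (A j) = m)
    (hAB : ∀ j ∈ S, A j ⊆ B) (hdisj : S.PairwiseDisjoint A) :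
    S.Finite ∧ (S.ncard : ℝ≥0∞) ≤ μ B / m := by
  have card_le (s : Finset J) (hs : (s : Set J) ⊆ S) : (s.card : ℝ≥0∞) ≤ μ B / m := by
    rw [ENNReal.le_div_iff_mul_le (Or.inl hm) (Or.inr hB)]
    calc (s.card : ℝ≥0∞) * m = ∑ j ∈ s, μ (A j) := by
          rw [Finset.sum_congr rfl fun j hj => hAm j (hs hj), Finset.sum_const, nsmul_eq_mul]
      _ = μ (⋃ j ∈ s, A j) :=
          (measure_biUnion_finset (hdisj.subset hs) fun j hj => hA j (hs hj)).symm
      _ ≤ μ B := measure_mono (iUnion₂_subset fun j hj => hAB j (hs hj))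
  have hfin : S.Finite := by
    by_contra hinf
    obtain ⟨n, hn⟩ := ENNReal.exists_nat_gt (ENNReal.div_ne_top hB hm)
    obtain ⟨s, hs, rfl⟩ := Set.Infinite.exists_subset_card_eq hinf n
    exact (card_le s hs).not_gt hn
  refine ⟨hfin, ?_⟩
  rw [ncard_eq_toFinset_card S hfin]
  exact card_le _ hfin.coe_toFinset.subset

/-- finite intersection property of Whitney-type coverings. If all balls
of radius `δ` have measure `m > 0`, all balls of radius `(2R₀+1)δ` have measure
`M < ∞`, and `{ξ_j}` is `2δ`-separated, then for any set `E` of diameter `≤ R₀δ`,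
at most `M/m` of the balls `B(ξ_j, Rδ)` meet `E`. -/
theorem statement9 {X : Type*} [MetricSpace X] [MeasurableSpace X] [BorelSpace X]
    (μ : Measure X) (δ R R₀ : ℝ) (hδ : 0 < δ) (hR : 2 ≤ R) (hRR : R ≤ R₀)
    (m M : ℝ≥0∞) (hm : 0 < m) (hM : M < ∞)
    (hball : ∀ x : X, μ (Metric.ball x δ) = m)
    (hball' : ∀ x : X, μ (Metric.ball x ((2 * R₀ + 1) * δ)) = M)
    {J : Type*} (ξ : J → X) (hsep : ∀ i j : J, i ≠ j → 2 * δ ≤ dist (ξ i) (ξ j))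
    (E : Set X) (hE : EMetric.diam E ≤ ENNReal.ofReal (R₀ * δ)) :
    {j : J | (Metric.ball (ξ j) (R * δ) ∩ E).Nonempty}.Finite ∧
      ({j : J | (Metric.ball (ξ j) (R * δ) ∩ E).Nonempty}.ncard : ℝ≥0∞) ≤ M / m := by
  obtain hempty | ⟨e, he⟩ := E.eq_empty_or_nonempty
  · simp [hempty]
  rw [← hball' e]
  refine finite_and_ncard_le_measure_div (A := fun j => Metric.ball (ξ j) δ) hm.ne'
    ((hball' e).trans_lt hM).ne (fun _ _ => measurableSet_ball) (fun j _ => hball (ξ j)) ?_ ?_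
  · rintro j ⟨y, hyj, hyE⟩
    have hye : dist y e ≤ R₀ * δ := by
      have h := (Metric.edist_le_ediam_of_mem hyE he).trans hE
      rw [edist_dist] at h
      exact (ENNReal.ofReal_le_ofReal_iff (by nlinarith)).1 h
    apply Metric.ball_subset_ball'
    have htri := dist_triangle_left (ξ j) e y
    have hRδ : R * δ ≤ R₀ * δ := by gcongr
    linarith [Metric.mem_ball.1 hyj]
  · intro i _ j _ hij
    exact Metric.ball_disjoint_ball (by linarith [hsep i j hij])
end

section
/- Let n ≥ 3. For all integers M, N ≥ 0 there exist a constant C > 0 and an integer ℓ ≥ 0 such that for every Schwartz function φ ∈ 𝒮(ℝ^n) whose support is contained in the closure of Λ_n, and for every ξ ∈ Λ_n, one has |φ(ξ)| ≤ C · p_ℓ(φ) · Q(ξ)^M · (1+|ξ|)^{−N}, where p_ℓ(φ) = sup_{|a| ≤ ℓ} sup_{ξ ∈ ℝ^n} (1+|ξ|)^ℓ |∂^a φ(ξ)| is the Schwartz seminorm of order ℓ. -/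
open MeasureTheory Set

noncomputable section

/-- The Lorentz form `Q(y) = y₁² − (y₂² + ⋯ + y_n²)` on Euclidean space. -/
def lorentzQE (n : ℕ) [NeZero n] (y : EuclideanSpace ℝ (Fin n)) : ℝ :=
  y 0 ^ 2 - ∑ k ∈ Finset.univ.filter (fun k => k ≠ 0), y k ^ 2

/-- The light cone `Λ_n` in Euclidean space. -/
def lightConeE (n : ℕ) [NeZero n] : Set (EuclideanSpace ℝ (Fin n)) :=
  {y | 0 < y 0 ∧ 0 < lorentzQE n y}

/-- The Schwartz seminorm `p_ℓ(φ) = sup_{|a| ≤ ℓ} sup_ξ (1+|ξ|)^ℓ |∂^a φ(ξ)|`,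
implemented with iterated (Fréchet) derivatives of order `≤ ℓ`. -/
def schwartzSemi (n : ℕ) (ℓ : ℕ) (φ : SchwartzMap (EuclideanSpace ℝ (Fin n)) ℂ) : ℝ :=
  ⨆ i : Fin (ℓ + 1), ⨆ ξ : EuclideanSpace ℝ (Fin n),
    (1 + ‖ξ‖) ^ ℓ * ‖iteratedFDeriv ℝ (i : ℕ) (φ : EuclideanSpace ℝ (Fin n) → ℂ) ξ‖

/-- Each weighted derivative of order at most `ℓ` is bounded by `p_ℓ(φ)`. -/
lemma le_schwartzSemi (n ℓ i : ℕ) (hi : i ≤ ℓ)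
    (φ : SchwartzMap (EuclideanSpace ℝ (Fin n)) ℂ) (x : EuclideanSpace ℝ (Fin n)) :
    (1 + ‖x‖) ^ ℓ * ‖iteratedFDeriv ℝ i (φ : EuclideanSpace ℝ (Fin n) → ℂ) x‖
      ≤ schwartzSemi n ℓ φ := by
  have hbdd : BddAbove (range fun ξ : EuclideanSpace ℝ (Fin n) =>
      (1 + ‖ξ‖) ^ ℓ * ‖iteratedFDeriv ℝ i (φ : EuclideanSpace ℝ (Fin n) → ℂ) ξ‖) := by
    refine ⟨2 ^ ℓ * (Finset.Iic (ℓ, ℓ)).sup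
      (fun m => SchwartzMap.seminorm ℝ m.1 m.2) φ, ?_⟩
    rintro _ ⟨ξ, rfl⟩
    exact SchwartzMap.one_add_le_sup_seminorm_apply (𝕜 := ℝ) (m := (ℓ, ℓ)) le_rfl hi φ ξ
  refine (le_ciSup hbdd x).trans ?_
  exact le_ciSup (f := fun j : Fin (ℓ + 1) => ⨆ ξ : EuclideanSpace ℝ (Fin n),
    (1 + ‖ξ‖) ^ ℓ * ‖iteratedFDeriv ℝ (j : ℕ) (φ : EuclideanSpace ℝ (Fin n) → ℂ) ξ‖)
    (finite_range _).bddAbove ⟨i, Nat.lt_succ_of_le hi⟩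

/-- A continuous function vanishes off the interior of its topological support. -/
lemma eq_zero_of_notMem_interior_tsupport {E F : Type*} [TopologicalSpace E]
    [TopologicalSpace F] [T1Space F] [Zero F] {f : E → F} (hf : Continuous f) {b : E}
    (hb : b ∉ interior (tsupport f)) : f b = 0 := by
  by_contra h
  exact hb (interior_maximal subset_closure (isOpen_compl_singleton.preimage hf) h)

/-- Taylor estimate along a ray of unit direction starting at a point where the smooth function
vanishes to infinite order. -/
lemma norm_le_mul_pow_of_notMem_interior_tsupport {E : Type} [NormedAddCommGroup E]
    [NormedSpace ℝ E] {b v : E} (hv : ‖v‖ ≤ 1) {B δ : ℝ} (k : ℕ) :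
    ∀ {F : Type} [NormedAddCommGroup F] [NormedSpace ℝ F] {f : E → F},
      ContDiff ℝ (⊤ : ℕ∞) f → b ∉ interior (tsupport f) →
      (∀ s ∈ Icc 0 δ, ‖iteratedFDeriv ℝ k f (b + s • v)‖ ≤ B) →
      ∀ s ∈ Icc 0 δ, ‖f (b + s • v)‖ ≤ B * s ^ k := by
  induction k with
  | zero =>
    intro F _ _ f _ _ hB s hs
    simpa using hB s hs
  | succ k ih =>
    intro F _ _ f hf hb hB s hs
    have hf' : ContDiff ℝ (⊤ : ℕ∞) (fderiv ℝ f) := hf.fderiv_right (by simp)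
    have hfb : f b = 0 := eq_zero_of_notMem_interior_tsupport hf.continuous hb
    have hD : ∀ x ∈ Icc 0 δ, ‖fderiv ℝ f (b + x • v)‖ ≤ B * x ^ k := by
      refine ih hf' (fun h => hb (interior_mono (tsupport_fderiv_subset ℝ) h)) fun x hx => ?_
      rw [norm_iteratedFDeriv_fderiv]
      exact hB x hx
    have hB0 : 0 ≤ B := (norm_nonneg _).trans (hB s hs)
    have hderiv : ∀ x ∈ Icc (0 : ℝ) s, HasDerivWithinAt (fun x : ℝ => f (b + x • v))
        (fderiv ℝ f (b + x • v) v) (Icc 0 s) x := by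
      intro x _
      have h1 : HasDerivAt (fun x : ℝ => b + x • v) v x := by
        simpa using ((hasDerivAt_id x).smul_const v).const_add b
      exact (((hf.differentiable (by simp)) _).hasFDerivAt.comp_hasDerivAt x h1).hasDerivWithinAt
    have hbound : ∀ x ∈ Ico (0 : ℝ) s, ‖fderiv ℝ f (b + x • v) v‖ ≤ B * s ^ k := by
      intro x hx
      calc ‖fderiv ℝ f (b + x • v) v‖ ≤ ‖fderiv ℝ f (b + x • v)‖ * ‖v‖ :=
            ContinuousLinearMap.le_opNorm _ _
        _ ≤ ‖fderiv ℝ f (b + x • v)‖ := mul_le_of_le_one_right (norm_nonneg _) hv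
        _ ≤ B * x ^ k := hD x ⟨hx.1, hx.2.le.trans hs.2⟩
        _ ≤ B * s ^ k := by
          have := hx.1
          have := hx.2.le
          gcongr
    have := norm_image_sub_le_of_norm_deriv_le_segment' hderiv hbound s ⟨hs.1, le_rfl⟩
    simpa [hfb, pow_succ, mul_assoc] using this

/-- The Euclidean norm of the spatial part of a vector. -/
def spatialNorm (n : ℕ) [NeZero n] (y : EuclideanSpace ℝ (Fin n)) : ℝ :=
  √(∑ k ∈ Finset.univ.filter (fun k => k ≠ 0), y k ^ 2)

lemma lorentzQE_eq (n : ℕ) [NeZero n] (y : EuclideanSpace ℝ (Fin n)) :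
    lorentzQE n y = y 0 ^ 2 - spatialNorm n y ^ 2 := by
  rw [spatialNorm, Real.sq_sqrt (Finset.sum_nonneg fun _ _ => sq_nonneg _), lorentzQE]

lemma spatialNorm_add_smul_single (n : ℕ) [NeZero n] (y : EuclideanSpace ℝ (Fin n)) (s : ℝ) :
    spatialNorm n (y + s • EuclideanSpace.single 0 1) = spatialNorm n y := by
  unfold spatialNorm
  congr 1
  refine Finset.sum_congr rfl fun k hk => ?_
  have hk : k ≠ 0 := (Finset.mem_filter.1 hk).2
  simp [hk]

lemma spatialNorm_lt_of_mem_lightConeE {n : ℕ} [NeZero n] {y : EuclideanSpace ℝ (Fin n)}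
    (hy : y ∈ lightConeE n) : spatialNorm n y < y 0 := by
  obtain ⟨h0, hQ⟩ := hy
  rw [lorentzQE_eq] at hQ
  exact lt_of_pow_lt_pow_left₀ 2 h0.le (by linarith)

lemma closure_lightConeE_subset (n : ℕ) [NeZero n] :
    closure (lightConeE n) ⊆ {y | spatialNorm n y ≤ y 0} := by
  refine closure_minimal (fun y hy => (spatialNorm_lt_of_mem_lightConeE hy).le) ?_
  refine isClosed_le ?_ (by fun_prop)
  unfold spatialNorm
  fun_prop

/-- Points of the boundary cone are not interior to the closed cone. -/
lemma notMem_interior_closure_lightConeE {n : ℕ} [NeZero n] {b : EuclideanSpace ℝ (Fin n)}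
    (hb : b 0 ≤ spatialNorm n b) : b ∉ interior (closure (lightConeE n)) := by
  intro h
  have hcont : Filter.Tendsto
      (fun s : ℝ => b + s • (EuclideanSpace.single 0 1 : EuclideanSpace ℝ (Fin n)))
      (nhdsWithin 0 (Iio 0)) (nhds b) := by
    have : Continuous
        (fun s : ℝ => b + s • (EuclideanSpace.single 0 1 : EuclideanSpace ℝ (Fin n))) := by
      fun_prop
    simpa using (this.tendsto 0).mono_left nhdsWithin_le_nhds
  obtain ⟨s, hs, hs0⟩ := ((hcont.eventually (mem_interior_iff_mem_nhds.1 h)).and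
    self_mem_nhdsWithin).exists
  have hs' := closure_lightConeE_subset n hs
  have hs0 : s < 0 := hs0
  rw [mem_ofPred_eq, spatialNorm_add_smul_single] at hs'
  simp at hs'
  linarith

/-- For all `M, N ≥ 0` there are `C > 0` and `ℓ ≥ 0` such that every
Schwartz function supported in the closed light cone satisfies
`|φ(ξ)| ≤ C·p_ℓ(φ)·Q(ξ)^M·(1+|ξ|)^{−N}` on the cone. -/
theorem statement11 (n : ℕ) [NeZero n] (hn : 3 ≤ n) (M N : ℕ) :
    ∃ C : ℝ, 0 < C ∧ ∃ ℓ : ℕ,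
      ∀ φ : SchwartzMap (EuclideanSpace ℝ (Fin n)) ℂ,
        Function.support (φ : EuclideanSpace ℝ (Fin n) → ℂ) ⊆ closure (lightConeE n) →
        ∀ ξ ∈ lightConeE n,
          ‖φ ξ‖ ≤ C * schwartzSemi n ℓ φ * lorentzQE n ξ ^ M / (1 + ‖ξ‖) ^ N := by
  refine ⟨2 ^ (2 * M + N), by positivity, 2 * M + N, fun φ hφ ξ hξ => ?_⟩
  set ℓ := 2 * M + N with hℓ
  have hr := spatialNorm_lt_of_mem_lightConeE hξ
  have hr0 : 0 ≤ spatialNorm n ξ := Real.sqrt_nonneg _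
  set δ := ξ 0 - spatialNorm n ξ with hδ
  have hδ0 : 0 < δ := sub_pos.2 hr
  have hδQ : δ ^ 2 ≤ lorentzQE n ξ := by
    rw [lorentzQE_eq]
    nlinarith
  have hp0 : 0 ≤ schwartzSemi n ℓ φ :=
    le_trans (by positivity) (le_schwartzSemi n ℓ 0 (Nat.zero_le _) φ ξ)
  have hξ1 : (1 : ℝ) ≤ 1 + ‖ξ‖ := le_add_of_nonneg_right (norm_nonneg _)
  have hpow : (1 + ‖ξ‖) ^ N ≤ (1 + ‖ξ‖) ^ ℓ := pow_le_pow_right₀ hξ1 (by omega)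
  rw [le_div_iff₀ (by positivity)]
  rcases le_total 1 δ with h1 | h1
  · have hQ1 : 1 ≤ lorentzQE n ξ ^ M := one_le_pow₀ ((one_le_pow₀ h1).trans hδQ)
    have h := le_schwartzSemi n ℓ 0 (Nat.zero_le _) φ ξ
    rw [norm_iteratedFDeriv_zero] at h
    calc ‖φ ξ‖ * (1 + ‖ξ‖) ^ N ≤ ‖φ ξ‖ * (1 + ‖ξ‖) ^ ℓ := by gcongr
      _ = 1 * ((1 + ‖ξ‖) ^ ℓ * ‖φ ξ‖) * 1 := by ring
      _ ≤ 2 ^ ℓ * schwartzSemi n ℓ φ * lorentzQE n ξ ^ M := by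
        gcongr
        exact one_le_pow₀ (by norm_num)
  · set v : EuclideanSpace ℝ (Fin n) := EuclideanSpace.single 0 1 with hv
    have hv1 : ‖v‖ = 1 := by simp [hv]
    set b := ξ + (-δ) • v with hb
    have hbξ : b + δ • v = ξ := by simp [hb]
    have hbK : b ∉ interior (tsupport φ) := by
      refine fun h => notMem_interior_closure_lightConeE (b := b) ?_
        (interior_mono (closure_minimal hφ isClosed_closure) h)
      rw [hb, hv, spatialNorm_add_smul_single]
      simp [hδ]
    have hB : ∀ s ∈ Icc 0 δ, ‖iteratedFDeriv ℝ (2 * M) φ (b + s • v)‖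
        ≤ 2 ^ ℓ * schwartzSemi n ℓ φ / (1 + ‖ξ‖) ^ ℓ := by
      intro s hs
      have hnorm : ‖ξ‖ ≤ ‖b + s • v‖ + 1 := by
        have heq : ξ = (b + s • v) + (δ - s) • v := by
          rw [← hbξ]
          module
        calc ‖ξ‖ = ‖(b + s • v) + (δ - s) • v‖ := congrArg _ heq
          _ ≤ ‖b + s • v‖ + ‖(δ - s) • v‖ := norm_add_le _ _
          _ ≤ ‖b + s • v‖ + 1 := by
            rw [norm_smul, hv1, Real.norm_of_nonneg (sub_nonneg.2 hs.2)]
            linarith [hs.1]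
      rw [le_div_iff₀ (by positivity)]
      calc _ ≤ ‖iteratedFDeriv ℝ (2 * M) φ (b + s • v)‖ * (2 * (1 + ‖b + s • v‖)) ^ ℓ := by
            gcongr
            linarith [norm_nonneg (b + s • v)]
        _ = 2 ^ ℓ * ((1 + ‖b + s • v‖) ^ ℓ *
              ‖iteratedFDeriv ℝ (2 * M) φ (b + s • v)‖) := by
            rw [mul_pow]
            ring
        _ ≤ _ := by
            gcongr
            exact le_schwartzSemi n ℓ (2 * M) (by omega) φ _
    have h := norm_le_mul_pow_of_notMem_interior_tsupport hv1.le (2 * M) (φ.smooth ⊤) hbK hB δ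
      ⟨hδ0.le, le_rfl⟩
    rw [hbξ, div_mul_eq_mul_div, le_div_iff₀ (by positivity)] at h
    calc ‖φ ξ‖ * (1 + ‖ξ‖) ^ N ≤ ‖φ ξ‖ * (1 + ‖ξ‖) ^ ℓ := by gcongr
      _ ≤ 2 ^ ℓ * schwartzSemi n ℓ φ * (δ ^ 2) ^ M := by rwa [← pow_mul]
      _ ≤ 2 ^ ℓ * schwartzSemi n ℓ φ * lorentzQE n ξ ^ M := by gcongr
end
end
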